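/- arXiv:1810.04205 — 2 statements merged into one kernel-verified Lean document; each statement's English description precedes it below -/
import Mathlib

section
/- Let X be a finite dimensional normed space with dim(X) ≥ 2, let Ω ⊂ X be open, and let F : ℝ × Ω × X* → ℝ be a continuous mapping such that: (A) F(0, x, 0) ≤ 0 for every x ∈ Ω; and (B) for every compact subset K of Ω there exist constants α_K, M_K > 0 such that for all x ∈ K, r ∈ [0, α_K] and x* ∈ X* with ‖x*‖_* ≥ M_K one has F(r, x, x*) > 0. Then for every ε > 0 there exists a function u : cl(Ω) → ℝ with 0 ≤ u ≤ ε on cl(Ω) such that: u = 0 on ∂Ω; u is differentiable at every point of Ω with F(u(x), x, Du(x)) ≤ 0 for all x ∈ Ω; F(u(x), x, Du(x)) = 0 for almost every x ∈ Ω (with respect to Lebesgue measure); and moreover the extension ũ of u defined by ũ = 0 on X∖Ω is differentiable at every point of X. -/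
open Metric Set MeasureTheory

/-- `lipOn f s` is the Lipschitz constant of `f` on `s`:
the infimum of all `L > 0` such that `|f x - f y| ≤ L * dist x y` for all `x, y ∈ s`. -/
noncomputable def lipOn {X : Type*} [PseudoMetricSpace X] (f : X → ℝ) (s : Set X) : ℝ :=
  sInf {L : ℝ | 0 < L ∧ ∀ x ∈ s, ∀ y ∈ s, |f x - f y| ≤ L * dist x y}

/-- `f` is `K`-Lipschitz on `s`. -/
def IsLipschitzWithOn {X : Type*} [PseudoMetricSpace X] (K : ℝ) (f : X → ℝ) (s : Set X) : Prop :=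
  ∀ x ∈ s, ∀ y ∈ s, |f x - f y| ≤ K * dist x y

open Filter Topology

/-- A continuous hysteresis operator: the state `s ∈ [-1, 1]` is pushed to `1` by inputs `z ≤ -2`
and to `-1` by inputs `z ≥ 2`, and is unaffected by inputs `z ∈ [-1, 1]`. -/
noncomputable def hyst (z s : ℝ) : ℝ := max (min 1 (-3 - 2 * z)) (min (max (-1) (3 - 2 * z)) s)

lemma abs_hyst_le {s : ℝ} (z : ℝ) (hs : |s| ≤ 1) : |hyst z s| ≤ 1 := by
  rw [abs_le] at *
  unfold hyst
  constructor
  · exact le_max_of_le_right (le_min (le_max_left _ _) hs.1)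
  · exact max_le (min_le_left _ _) (min_le_of_right_le hs.2)

lemma abs_hyst_sub_le {s : ℝ} (z : ℝ) (hs : |s| ≤ 1) :
    |hyst z s - s| ≤ (s - hyst z s) * z := by
  rw [abs_le] at hs
  obtain ⟨h1, h2⟩ := hs
  unfold hyst
  rcases le_total 1 z with hz | hz
  · rw [max_eq_right (b := min _ s)
      ((min_le_right _ _).trans (le_min (by linarith [le_max_left (-1) (3 - 2 * z)]) (by linarith)))]
    have : min (max (-1) (3 - 2 * z)) s ≤ s := min_le_right _ _
    rw [abs_of_nonpos (by linarith)]
    nlinarith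
  · rw [max_eq_right (b := 3 - 2 * z) (by linarith), min_eq_right (b := s) (by linarith)]
    rcases le_total z (-1) with hz' | hz'
    · have : s ≤ max (min 1 (-3 - 2 * z)) s := le_max_right _ _
      rw [abs_of_nonneg (by linarith)]
      nlinarith
    · rw [max_eq_right (b := s) ((min_le_right _ _).trans (by linarith))]
      simp

lemma hyst_of_le {z s : ℝ} (hz : z ≤ -2) (hs : |s| ≤ 1) : hyst z s = 1 := by
  rw [abs_le] at hs
  unfold hyst
  rw [min_eq_left (by linarith), max_eq_left (min_le_of_right_le hs.2)]

lemma hyst_of_ge {z s : ℝ} (hz : 2 ≤ z) (hs : |s| ≤ 1) : hyst z s = -1 := by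
  rw [abs_le] at hs
  unfold hyst
  rw [max_eq_left (a := (-1 : ℝ)) (by linarith), min_eq_left hs.1,
    max_eq_right (min_le_of_right_le (by linarith))]

/-- If `y` moves along `x` with slope a weighted sum of hysteresis states that are driven by affine
functions of `x` detecting all intervals, then boundedness of `x` and `y` forces both to
converge. -/
lemma exists_tendsto_of_hyst {ι : Type*} {w a b : ι → ℝ} (hw : ∀ i, 0 < w i)
    (hwa : Summable fun i => w i * |a i|) (hwb : Summable fun i => w i * |b i|)
    (hab : ∀ l r : ℝ, l < r → ∃ i, (∀ z ≤ l, a i * z + b i ≤ -2) ∧ ∀ z, r ≤ z → 2 ≤ a i * z + b i)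
    {x y e : ℕ → ℝ} {s : ℕ → ι → ℝ} (hs0 : ∀ i, |s 0 i| ≤ 1)
    (hs : ∀ n i, s (n + 1) i = hyst (a i * x (n + 1) + b i) (s n i))
    (hy : ∀ n, y (n + 1) - y n = (∑' i, w i * a i * s n i) * (x (n + 1) - x n) + e n)
    (he : Summable e) {B : ℝ} (hxB : ∀ n, |x n| ≤ B) (hyB : ∀ n, |y n| ≤ B) :
    (∃ l, Tendsto x atTop (𝓝 l)) ∧ ∃ l, Tendsto y atTop (𝓝 l) := by
  have hs1 : ∀ n i, |s n i| ≤ 1 := by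
    intro n i
    induction n with
    | zero => exact hs0 i
    | succ n ih => rw [hs]; exact abs_hyst_le _ ih
  have hB : 0 ≤ B := (abs_nonneg _).trans (hxB 0)
  have hbd : Summable fun i => w i * |a i| * B + w i * |b i| := (hwa.mul_right B).add hwb
  have hc_le : ∀ n i, ‖w i * (s n i * (a i * x n + b i))‖ ≤ w i * |a i| * B + w i * |b i| := by
    intro n i
    rw [Real.norm_eq_abs, abs_mul, abs_mul, abs_of_pos (hw i)]
    have h1 : |a i * x n + b i| ≤ |a i| * B + |b i| := by
      refine (abs_add_le _ _).trans ?_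
      rw [abs_mul]
      gcongr
      exact hxB n
    calc w i * (|s n i| * |a i * x n + b i|) ≤ w i * (1 * (|a i| * B + |b i|)) := by
          have := (hw i).le
          gcongr
          exact hs1 n i
      _ = _ := by ring
  have hcs : ∀ n, Summable fun i => w i * (s n i * (a i * x n + b i)) := fun n =>
    Summable.of_norm_bounded hbd (hc_le n)
  have hσs : ∀ n, Summable fun i => w i * a i * s n i := by
    intro n
    refine Summable.of_norm_bounded hwa fun i => ?_
    rw [Real.norm_eq_abs, abs_mul, abs_mul, abs_of_pos (hw i)]
    have := mul_nonneg (hw i).le (abs_nonneg (a i))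
    nlinarith [hs1 n i]
  set C : ℕ → ℝ := fun n => ∑' i, w i * (s n i * (a i * x n + b i)) with hC
  set Θ : ℕ → ℝ := fun n => y n - ∑ j ∈ Finset.range n, e j - C n with hΘ
  have hΘstep : ∀ n, HasSum (fun i => w i * ((s n i - s (n + 1) i) * (a i * x (n + 1) + b i)))
      (Θ (n + 1) - Θ n) := by
    intro n
    have h := (((hσs n).hasSum.mul_right (x (n + 1) - x n)).sub (hcs (n + 1)).hasSum).add
      (hcs n).hasSum
    have e1 : Θ (n + 1) - Θ n = (∑' i, w i * a i * s n i) * (x (n + 1) - x n) - C (n + 1) + C n := by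
      change y (n + 1) - ∑ j ∈ Finset.range (n + 1), e j - C (n + 1) -
        (y n - ∑ j ∈ Finset.range n, e j - C n) = _
      rw [Finset.sum_range_succ]
      linarith [hy n]
    rw [e1]
    refine h.congr_fun fun i => ?_
    ring
  have hinc : ∀ n i, |s (n + 1) i - s n i| ≤ (s n i - s (n + 1) i) * (a i * x (n + 1) + b i) := by
    intro n i
    rw [hs n i]
    exact abs_hyst_sub_le _ (hs1 n i)
  have hstep : ∀ n i, w i * |s (n + 1) i - s n i| ≤ Θ (n + 1) - Θ n := by
    intro n i
    refine (mul_le_mul_of_nonneg_left (hinc n i) (hw i).le).trans ?_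
    exact le_hasSum (hΘstep n) i fun j _ =>
      mul_nonneg (hw j).le ((abs_nonneg _).trans (hinc n j))
  have hmono : Monotone Θ := monotone_nat_of_le_succ fun n => by
    have := (hΘstep n).nonneg fun j => mul_nonneg (hw j).le ((abs_nonneg _).trans (hinc n j))
    linarith
  have hCb : ∀ n, |C n| ≤ ∑' i, (w i * |a i| * B + w i * |b i|) := fun n =>
    tsum_of_norm_bounded hbd.hasSum (hc_le n)
  obtain ⟨D, hD⟩ := he.hasSum.tendsto_sum_nat.norm.bddAbove_range
  have hbdd : BddAbove (range Θ) := by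
    refine ⟨B + D + ∑' i, (w i * |a i| * B + w i * |b i|), ?_⟩
    rintro _ ⟨n, rfl⟩
    have h1 : |∑ j ∈ Finset.range n, e j| ≤ D := hD ⟨n, rfl⟩
    have h2 := abs_le.1 h1
    have h3 := abs_le.1 (hCb n)
    have h4 := abs_le.1 (hyB n)
    simp only [hΘ]
    linarith [h2.1, h3.1, h4.2]
  have hΘlim := tendsto_atTop_ciSup hmono hbdd
  have hslim : ∀ i, ∃ l, Tendsto (fun n => s n i) atTop (𝓝 l) := by
    intro i
    refine cauchySeq_tendsto_of_complete (cauchySeq_of_summable_dist ?_)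
    refine summable_of_sum_range_le (c := (w i)⁻¹ * ((⨆ n, Θ n) - Θ 0))
      (fun _ => dist_nonneg) fun n => ?_
    rw [inv_mul_eq_div, le_div_iff₀ (hw i), Finset.sum_mul]
    calc ∑ k ∈ Finset.range n, dist (s k i) (s (k + 1) i) * w i
        ≤ ∑ k ∈ Finset.range n, (Θ (k + 1) - Θ k) := by
          refine Finset.sum_le_sum fun k _ => ?_
          rw [dist_comm, Real.dist_eq, mul_comm]
          exact hstep k i
      _ = Θ n - Θ 0 := Finset.sum_range_sub _ _
      _ ≤ _ := by linarith [le_ciSup hbdd n]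
  have hxlim : ∃ l, Tendsto x atTop (𝓝 l) := by
    have hbA : IsBoundedUnder (· ≤ ·) atTop x :=
      isBoundedUnder_of ⟨B, fun n => (abs_le.1 (hxB n)).2⟩
    have hbB : IsBoundedUnder (· ≥ ·) atTop x :=
      isBoundedUnder_of ⟨-B, fun n => (abs_le.1 (hxB n)).1⟩
    refine tendsto_of_no_upcrossings (s := univ) dense_univ ?_ hbA hbB
    rintro l - r - hlr ⟨hl, hr⟩
    obtain ⟨i, hi1, hi2⟩ := hab l r hlr
    obtain ⟨L, hL⟩ := hslim i
    have hL' : Tendsto (fun n => s (n + 1) i) atTop (𝓝 L) := (tendsto_add_atTop_iff_nat 1).2 hL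
    have shift : ∀ p : ℕ → Prop, (∃ᶠ n in atTop, p n) → ∃ᶠ n in atTop, p (n + 1) := by
      intro p hp
      rw [frequently_atTop] at *
      intro n
      obtain ⟨m, hm, hpm⟩ := hp (n + 1)
      exact ⟨m - 1, by omega, by rwa [Nat.sub_add_cancel (by omega)]⟩
    have h1 : L = 1 := by
      refine (isClosed_singleton (x := (1 : ℝ))).mem_of_frequently_of_tendsto ?_ hL'
      refine (shift _ hl).mono fun n hn => ?_
      rw [mem_singleton_iff, hs n i]
      exact hyst_of_le (hi1 _ hn.le) (hs1 n i)
    have h2 : L = -1 := by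
      refine (isClosed_singleton (x := (-1 : ℝ))).mem_of_frequently_of_tendsto ?_ hL'
      refine (shift _ hr).mono fun n hn => ?_
      rw [mem_singleton_iff, hs n i]
      exact hyst_of_ge (hi2 _ hn.le) (hs1 n i)
    linarith
  refine ⟨hxlim, ?_⟩
  obtain ⟨lx, hlx⟩ := hxlim
  choose ls hls using hslim
  have hClim : Tendsto C atTop (𝓝 (∑' i, w i * (ls i * (a i * lx + b i)))) := by
    refine tendsto_tsum_of_dominated_convergence hbd (fun i => ?_)
      (Eventually.of_forall fun n i => hc_le n i)
    exact ((hls i).mul ((hlx.const_mul _).add_const _)).const_mul _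
  refine ⟨_, ((hΘlim.add hClim).add he.hasSum.tendsto_sum_nat).congr fun n => ?_⟩
  simp only [hΘ]
  ring

lemma exists_contDiff_bump {X : Type*} [NormedAddCommGroup X] [NormedSpace ℝ X]
    [FiniteDimensional ℝ X] {C V : Set X} (hC : IsCompact C) (hV : IsOpen V) (hCV : C ⊆ V) :
    ∃ f : X → ℝ, ContDiff ℝ 1 f ∧ HasCompactSupport f ∧ tsupport f ⊆ V ∧
      (∀ x, f x ∈ Icc (0 : ℝ) 1) ∧ ∀ x ∈ C, f x = 1 := by
  obtain ⟨K, hK, hCK, hKV⟩ := exists_compact_between hC hV hCV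
  obtain ⟨f, hf, hfr, hfs, hf1⟩ := exists_contMDiff_support_eq_eq_one_iff (n := 1)
    (modelWithCornersSelf ℝ X) isOpen_interior hC.isClosed hCK
  have hts : tsupport f ⊆ K := closure_minimal (hfs.subset.trans interior_subset) hK.isClosed
  exact ⟨f, hf.contDiff, hK.of_isClosed_subset (isClosed_tsupport f) hts, hts.trans hKV,
    fun x => hfr ⟨x, rfl⟩, fun x hx => (hf1 x).1 hx⟩

/-- Disjointly supported bumps, on each of which `σ` is almost constant, that equal one on most of
`O ∩ L`. -/
lemma exists_disjoint_bumps {X : Type*} [NormedAddCommGroup X] [NormedSpace ℝ X]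
    [FiniteDimensional ℝ X] [MeasurableSpace X] [BorelSpace X] (μ : Measure X)
    [μ.IsAddHaarMeasure] {O L : Set X} (hO : IsOpen O) (hL : IsCompact L) {σ : X → ℝ}
    (hσ : Continuous σ) {B : ℝ} (hσB : ∀ x, |σ x| ≤ B) {κ : ℝ} (hκ : 0 < κ) {η : ENNReal}
    (hη : 0 < η) :
    ∃ (ι : Type) (_ : Fintype ι) (c : ι → ℝ) (a : ι → X → ℝ) (G : Set X),
      (∀ j, ContDiff ℝ 1 (a j)) ∧ (∀ j, HasCompactSupport (a j)) ∧ (∀ j, tsupport (a j) ⊆ O) ∧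
      (∀ j x, a j x ∈ Icc (0 : ℝ) 1) ∧ (∀ j x, a j x ≠ 0 → |c j - σ x| ≤ κ) ∧
      (∀ x i j, a i x ≠ 0 → a j x ≠ 0 → i = j) ∧
      MeasurableSet G ∧ G ⊆ L ∧ μ ((O ∩ L) \ G) ≤ η ∧ ∀ x ∈ G, ∃ j, a j x = 1 := by
  classical
  set N : ℕ := ⌈B / (κ / 2)⌉₊ + 1
  let ι : Type := Finset.Icc (-(N : ℤ)) N
  let P : ι → Set X := fun j => (O ∩ L) ∩ {x | ⌊σ x / (κ / 2)⌋ = (j : ℤ)}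
  have hPm : ∀ j, MeasurableSet (P j) := fun j => (hO.measurableSet.inter hL.measurableSet).inter
    (measurableSet_eq_fun (Int.measurable_floor.comp (hσ.measurable.div_const _)) measurable_const)
  have hPfin : ∀ j, μ (P j) ≠ ⊤ := fun j => ne_top_of_le_ne_top hL.measure_lt_top.ne
    (measure_mono fun x hx => hx.1.2)
  obtain ⟨η', hη'0, hη'⟩ := ENNReal.exists_pos_sum_of_countable' hη.ne' ι
  choose C hCP hC hCμ using fun j => (hPm j).exists_isCompact_sdiff_lt (hPfin j) (hη'0 j).ne'
  have hCdisj : ∀ i j, ∀ x ∈ C i, x ∈ C j → i = j := fun i j x hi hj =>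
    Subtype.ext ((hCP i hi).2.symm.trans (hCP j hj).2)
  let V : ι → Set X := fun j => (O ∩ {x | |(j : ℤ) * (κ / 2) - σ x| < κ}) ∩
    ⋂ i ∈ {i | i ≠ j}, {x | infEDist x (C j) < infEDist x (C i)}
  have hV : ∀ j, IsOpen (V j) := by
    intro j
    refine (hO.inter (isOpen_lt (by fun_prop) continuous_const)).inter ?_
    exact (Set.toFinite _).isOpen_biInter fun i _ =>
      isOpen_lt continuous_infEDist continuous_infEDist
  have hCV : ∀ j, C j ⊆ V j := by
    intro j x hx
    refine ⟨⟨(hCP j hx).1.1, ?_⟩, ?_⟩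
    · have h := (hCP j hx).2
      rw [mem_ofPred_eq, Int.floor_eq_iff, le_div_iff₀ (by positivity),
        div_lt_iff₀ (by positivity)] at h
      rw [mem_ofPred_eq, abs_lt]
      constructor <;> nlinarith [h.1, h.2]
    · simp only [mem_iInter, mem_ofPred_eq]
      intro i hij
      rw [infEDist_zero_of_mem hx, pos_iff_ne_zero]
      intro h0
      exact hij (hCdisj i j x ((hC i).isClosed.closure_eq ▸ mem_closure_iff_infEDist_zero.2 h0) hx)
  have hVdisj : ∀ i j x, x ∈ V i → x ∈ V j → i = j := by
    intro i j x hi hj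
    by_contra hij
    have h1 := mem_iInter₂.1 hi.2 j (Ne.symm hij)
    have h2 := mem_iInter₂.1 hj.2 i hij
    exact lt_asymm (mem_ofPred_eq ▸ h1) h2
  choose a ha1 ha2 ha3 ha4 ha5 using fun j => exists_contDiff_bump (hC j) (hV j) (hCV j)
  have haV : ∀ j x, a j x ≠ 0 → x ∈ V j := fun j x hx => ha3 j (subset_tsupport _ hx)
  refine ⟨ι, inferInstance, fun j => (j : ℤ) * (κ / 2), a, ⋃ j, C j, ha1, ha2,
    fun j => (ha3 j).trans fun x hx => hx.1.1, ha4, fun j x hx => (haV j x hx).1.2.le,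
    fun x i j hi hj => hVdisj i j x (haV i x hi) (haV j x hj),
    .iUnion fun j => (hC j).measurableSet, iUnion_subset fun j x hx => (hCP j hx).1.2, ?_, ?_⟩
  · have hsub : (O ∩ L) \ (⋃ j, C j) ⊆ ⋃ j, P j \ C j := by
      rintro x ⟨hx, hxC⟩
      have hb : |σ x / (κ / 2)| ≤ N - 1 := by
        rw [abs_div, abs_of_pos (a := κ / 2) (by positivity)]
        refine (div_le_div_of_nonneg_right (hσB x) (by positivity)).trans ?_
        simp only [N, Nat.cast_add, Nat.cast_one, add_sub_cancel_right]
        exact Nat.le_ceil _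
      rw [abs_le] at hb
      have hmem : ⌊σ x / (κ / 2)⌋ ∈ Finset.Icc (-(N : ℤ)) N := by
        rw [Finset.mem_Icc, Int.le_floor]
        refine ⟨by push_cast; linarith, ?_⟩
        have : (⌊σ x / (κ / 2)⌋ : ℝ) ≤ N := (Int.floor_le _).trans (by linarith)
        exact_mod_cast this
      exact mem_iUnion.2 ⟨⟨_, hmem⟩, ⟨hx, rfl⟩, fun h => hxC (mem_iUnion.2 ⟨_, h⟩)⟩
    refine (measure_mono hsub).trans ((measure_iUnion_le _).trans ?_)
    exact (ENNReal.tsum_le_tsum fun j => (hCμ j).le).trans hη'.le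
  · intro x hx
    obtain ⟨j, hj⟩ := mem_iUnion.1 hx
    exact ⟨j, ha5 j x hj⟩

lemma sum_le_one_of_disjoint {ι : Type*} [Fintype ι] {a : ι → ℝ} (ha : ∀ j, a j ≤ 1)
    (had : ∀ i j, a i ≠ 0 → a j ≠ 0 → i = j) : ∑ j, a j ≤ 1 := by
  classical
  by_cases h : ∃ i, a i ≠ 0
  · obtain ⟨i, hi⟩ := h
    rw [Finset.sum_eq_single i (fun j _ hji => by_contra fun hj => hji (had j i hj hi)) (by simp)]
    exact ha i
  · push Not at h
    simp [h]

lemma tendsto_setIntegral_mul_cos {X : Type*} [NormedAddCommGroup X] [NormedSpace ℝ X]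
    [FiniteDimensional ℝ X] [MeasurableSpace X] [BorelSpace X] (μ : Measure X)
    [μ.IsAddHaarMeasure] {L : Set X} (hL : MeasurableSet L) {h : X → ℝ} (hh : IntegrableOn h L μ)
    {ξ : X →L[ℝ] ℝ} (hξ : ξ ≠ 0) :
    Tendsto (fun N : ℕ => ∫ x in L, h x * Real.cos (N * ξ x) ∂μ) atTop (𝓝 0) := by
  have hw : Tendsto (fun N : ℕ => ((N : ℝ) / (2 * Real.pi)) • ξ) atTop
      (cocompact (StrongDual ℝ X)) := by
    rw [← Metric.cobounded_eq_cocompact, ← tendsto_norm_atTop_iff_cobounded]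
    simp_rw [norm_smul, Real.norm_eq_abs]
    refine Tendsto.atTop_mul_const (norm_pos_iff.2 hξ) (tendsto_abs_atTop_atTop.comp ?_)
    exact tendsto_natCast_atTop_atTop.atTop_div_const (by positivity)
  have integrableOn_L : Integrable (L.indicator h) μ := (integrable_indicator_iff hL).2 hh
  have key := (tendsto_integral_exp_smul_cocompact (fun x => ((L.indicator h x : ℝ) : ℂ)) μ).comp hw
  have key2 := (Complex.continuous_re.tendsto 0).comp key
  rw [Complex.zero_re] at key2
  refine key2.congr fun N => ?_
  have hI : Integrable (fun x => Real.fourierChar (-(((N : ℝ) / (2 * Real.pi)) • ξ) x) •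
      ((L.indicator h x : ℝ) : ℂ)) μ := by
    have hc : Integrable (fun x => ((L.indicator h x : ℝ) : ℂ)) μ := integrableOn_L.ofReal
    refine Integrable.mono hc ?_ (Eventually.of_forall fun x => by rw [Circle.norm_smul])
    refine AEStronglyMeasurable.smul (Continuous.aestronglyMeasurable ?_) hc.aestronglyMeasurable
    fun_prop
  simp only [Function.comp_apply]
  rw [← integral_indicator hL]
  have := integral_re hI
  simp only [RCLike.re_to_complex] at this
  rw [← this]
  refine integral_congr_ae (Eventually.of_forall fun x => ?_)
  simp only [Circle.smul_def, Real.fourierChar_apply, smul_eq_mul, Complex.re_mul_ofReal,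
    Complex.exp_ofReal_mul_I_re]
  by_cases hx : x ∈ L
  · rw [indicator_of_mem hx, indicator_of_mem hx, mul_comm]
    congr 1
    rw [← Real.cos_neg]
    congr 1
    simp only [_root_.smul_apply, smul_eq_mul]
    field_simp
  · rw [indicator_of_notMem hx, indicator_of_notMem hx, mul_zero]

/-- Fast oscillations with amplitudes `r * a j` add at least `r ^ 2 / 2` of energy per unit of
volume where some `a j` equals one. -/
lemma eventually_energy_le {X : Type*} [NormedAddCommGroup X] [NormedSpace ℝ X]
    [FiniteDimensional ℝ X] [MeasurableSpace X] [BorelSpace X] (μ : Measure X)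
    [μ.IsAddHaarMeasure] {L G : Set X} (hL : IsCompact L) (hG : MeasurableSet G) {q : X → ℝ}
    (hq : Continuous q) {ι : Type*} [Fintype ι] {a : ι → X → ℝ} (ha : ∀ j, Continuous (a j))
    (ha01 : ∀ j x, a j x ∈ Icc (0 : ℝ) 1) (had : ∀ x i j, a i x ≠ 0 → a j x ≠ 0 → i = j)
    (haG : ∀ x ∈ G, ∃ j, a j x = 1) {g : ι → X →L[ℝ] ℝ} (hg : ∀ j, g j ≠ 0) {r : ℝ} (hr : 0 ≤ r)
    {p : ℕ → X → ℝ} (hp : ∀ N, Continuous (p N)) {R : ℝ}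
    (hpR : ∀ (N : ℕ) x, |p N x - r * ∑ j, a j x * Real.cos (N * g j x)| ≤ R / N)
    {ε : ℝ} (hε : 0 < ε) :
    ∀ᶠ N : ℕ in atTop, (∫ x in L, q x ^ 2 ∂μ) + r ^ 2 / 2 * μ.real (L ∩ G) - ε ≤
      ∫ x in L, (q x + p N x) ^ 2 ∂μ := by
  classical
  have integrableOn_L : ∀ {f : X → ℝ}, Continuous f → IntegrableOn f L μ := fun hf =>
    hf.continuousOn.integrableOn_compact hL
  obtain ⟨Q, hQ⟩ := hL.exists_bound_of_continuousOn hq.continuousOn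
  simp only [Real.norm_eq_abs] at hQ
  have hcos : ∀ (N : ℕ) j, Continuous fun x => Real.cos (N * g j x) := fun N j => by fun_prop
  have hcos2 : ∀ (N : ℕ) j, Continuous fun x => Real.cos (N * ((2 : ℝ) • g j) x) :=
    fun N j => by fun_prop
  set low : ℕ → ℝ := fun N => (∫ x in L, q x ^ 2 ∂μ) +
    2 * r * ∑ j, (∫ x in L, q x * a j x * Real.cos (N * g j x) ∂μ) +
    r ^ 2 / 2 * ∑ j, (∫ x in L, a j x ^ 2 ∂μ) +
    r ^ 2 / 2 * ∑ j, (∫ x in L, a j x ^ 2 * Real.cos (N * ((2 : ℝ) • g j) x) ∂μ) -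
    (2 * (Q + r) * R) * μ.real L / N with hlow
  have hlim : Tendsto low atTop (𝓝 ((∫ x in L, q x ^ 2 ∂μ) + 2 * r * ∑ _j : ι, 0 +
      r ^ 2 / 2 * ∑ j, (∫ x in L, a j x ^ 2 ∂μ) + r ^ 2 / 2 * ∑ _j : ι, 0 - 0)) := by
    refine Tendsto.sub (((Tendsto.const_add _ ?_).add tendsto_const_nhds).add ?_) ?_
    · refine (tendsto_finsetSum _ fun j _ => ?_).const_mul _
      exact tendsto_setIntegral_mul_cos μ hL.measurableSet (integrableOn_L (hq.mul (ha j))) (hg j)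
    · refine (tendsto_finsetSum _ fun j _ => ?_).const_mul _
      exact tendsto_setIntegral_mul_cos μ hL.measurableSet (integrableOn_L ((ha j).pow 2))
        (smul_ne_zero two_ne_zero (hg j))
    · exact tendsto_const_div_atTop_nhds_zero_nat _
  simp only [Finset.sum_const_zero, mul_zero, add_zero, sub_zero] at hlim
  have hGle : μ.real (L ∩ G) ≤ ∑ j, (∫ x in L, a j x ^ 2 ∂μ) := by
    have i3 : ∀ j ∈ Finset.univ, Integrable (fun x => a j x ^ 2) (μ.restrict L) := fun j _ =>
      integrableOn_L ((ha j).pow 2)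
    rw [← integral_finsetSum _ i3, ← setIntegral_one_eq_measureReal,
      ← setIntegral_indicator hG]
    refine integral_mono ?_ ?_ fun x => ?_
    · exact (integrable_indicator_iff hG).2 (by
        rw [IntegrableOn, Measure.restrict_restrict hG]
        exact integrableOn_const (measure_inter_lt_top_of_right_ne_top hL.measure_lt_top.ne).ne)
    · exact integrable_finsetSum _ fun j _ => integrableOn_L ((ha j).pow 2)
    · by_cases hx : x ∈ G
      · obtain ⟨j, hj⟩ := haG x hx
        rw [indicator_of_mem hx]
        calc (1 : ℝ) = a j x ^ 2 := by rw [hj, one_pow]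
          _ ≤ _ := Finset.single_le_sum (f := fun j => a j x ^ 2) (fun j _ => sq_nonneg _)
            (Finset.mem_univ j)
      · rw [indicator_of_notMem hx]
        exact Finset.sum_nonneg fun j _ => sq_nonneg _
  have hev := hlim.eventually_const_lt (u := (∫ x in L, q x ^ 2 ∂μ) +
    r ^ 2 / 2 * ∑ j, (∫ x in L, a j x ^ 2 ∂μ) - ε) (by linarith)
  filter_upwards [hev] with N hN
  have h1 := mul_le_mul_of_nonneg_left hGle (show 0 ≤ r ^ 2 / 2 by positivity)
  have hsum1 : ∀ x, ∑ j, a j x ≤ 1 := fun x => sum_le_one_of_disjoint (fun j => (ha01 j x).2)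
    (had x)
  have hsq : ∀ x, (∑ j, a j x * Real.cos (N * g j x)) ^ 2 =
      ∑ j, (a j x ^ 2 / 2 + a j x ^ 2 * Real.cos (N * ((2 : ℝ) • g j) x) / 2) := by
    intro x
    have hc : ∀ j, a j x ^ 2 / 2 + a j x ^ 2 * Real.cos (N * ((2 : ℝ) • g j) x) / 2 =
        (a j x * Real.cos (N * g j x)) ^ 2 := by
      intro j
      have : (N : ℝ) * ((2 : ℝ) • g j) x = 2 * (N * g j x) := by
        simp only [_root_.smul_apply, smul_eq_mul]; ring
      rw [this, Real.cos_two_mul]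
      ring
    simp_rw [hc]
    by_cases h : ∃ i, a i x ≠ 0
    · obtain ⟨i, hi⟩ := h
      have h0 : ∀ j, j ≠ i → a j x = 0 := fun j hji => by_contra fun hj => hji (had x j i hj hi)
      rw [Finset.sum_eq_single i (fun j _ hji => by rw [h0 j hji, zero_mul]) (by simp),
        Finset.sum_eq_single i (fun j _ hji => by rw [h0 j hji]; ring) (by simp)]
    · push Not at h
      simp [h]
  have hpt : ∀ x ∈ L, q x ^ 2 + 2 * r * ∑ j, q x * a j x * Real.cos (N * g j x) +
      r ^ 2 / 2 * ∑ j, a j x ^ 2 + r ^ 2 / 2 * ∑ j, a j x ^ 2 * Real.cos (N * ((2 : ℝ) • g j) x) -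
      (2 * (Q + r) * R) / N ≤ (q x + p N x) ^ 2 := by
    intro x hx
    have e1 : q x ^ 2 + 2 * r * ∑ j, q x * a j x * Real.cos (N * g j x) +
      r ^ 2 / 2 * ∑ j, a j x ^ 2 + r ^ 2 / 2 * ∑ j, a j x ^ 2 * Real.cos (N * ((2 : ℝ) • g j) x) =
      (q x + r * ∑ j, a j x * Real.cos (N * g j x)) ^ 2 := by
      have e2 : ∑ j, q x * a j x * Real.cos (N * g j x) =
          q x * ∑ j, a j x * Real.cos (N * g j x) := by
        rw [Finset.mul_sum]; exact Finset.sum_congr rfl fun j _ => by ring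
      rw [add_sq, mul_pow, hsq x, e2, Finset.sum_add_distrib, ← Finset.sum_div, ← Finset.sum_div]
      ring
    rw [e1]
    set t := ∑ j, a j x * Real.cos (N * g j x) with ht
    have ht1 : |t| ≤ 1 := by
      refine (Finset.abs_sum_le_sum_abs _ _).trans ((Finset.sum_le_sum fun j _ => ?_).trans (hsum1 x))
      rw [abs_mul, abs_of_nonneg (ha01 j x).1]
      exact mul_le_of_le_one_right (ha01 j x).1 (Real.abs_cos_le_one _)
    have hd := hpR N x
    rw [← ht] at hd
    have hqt : |q x + r * t| ≤ Q + r := by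
      refine (abs_add_le _ _).trans (add_le_add (hQ x hx) ?_)
      rw [abs_mul, abs_of_nonneg hr]
      exact mul_le_of_le_one_right hr ht1
    have hmul : |(q x + r * t) * (p N x - r * t)| ≤ (Q + r) * (R / N) := by
      rw [abs_mul]
      exact mul_le_mul hqt hd (abs_nonneg _) ((abs_nonneg _).trans hqt)
    have := (abs_le.1 hmul).1
    have e3 : 2 * (Q + r) * R / N = 2 * ((Q + r) * (R / N)) := by ring
    rw [e3]
    nlinarith [sq_nonneg (p N x - r * t)]
  have hlow_le : low N ≤ ∫ x in L, (q x + p N x) ^ 2 ∂μ := by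
    refine le_trans (le_of_eq ?_) (setIntegral_mono_on (integrableOn_L ?_) (integrableOn_L ?_) hL.measurableSet hpt)
    · have i1 : IntegrableOn (fun x => q x ^ 2) L μ := integrableOn_L (hq.pow 2)
      have i2 : ∀ j, IntegrableOn (fun x => q x * a j x * Real.cos (N * g j x)) L μ := fun j =>
        integrableOn_L ((hq.mul (ha j)).mul (hcos N j))
      have i3 : ∀ j, IntegrableOn (fun x => a j x ^ 2) L μ := fun j => integrableOn_L ((ha j).pow 2)
      have i4 : ∀ j, IntegrableOn (fun x => a j x ^ 2 * Real.cos (N * ((2 : ℝ) • g j) x)) L μ :=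
        fun j => integrableOn_L (((ha j).pow 2).mul (hcos2 N j))
      have s2 := (integrable_finsetSum Finset.univ fun j _ => i2 j).const_mul (2 * r)
      have s3 := (integrable_finsetSum Finset.univ fun j _ => i3 j).const_mul (r ^ 2 / 2)
      have s4 := (integrable_finsetSum Finset.univ fun j _ => i4 j).const_mul (r ^ 2 / 2)
      have s12 : Integrable (fun x => q x ^ 2 + 2 * r * ∑ j, q x * a j x * Real.cos (N * g j x))
        (μ.restrict L) := i1.add s2
      have s123 : Integrable (fun x => q x ^ 2 + 2 * r * ∑ j, q x * a j x * Real.cos (N * g j x) +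
        r ^ 2 / 2 * ∑ j, a j x ^ 2) (μ.restrict L) := s12.add s3
      have s1234 : Integrable (fun x => q x ^ 2 +
        2 * r * ∑ j, q x * a j x * Real.cos (N * g j x) + r ^ 2 / 2 * ∑ j, a j x ^ 2 +
        r ^ 2 / 2 * ∑ j, a j x ^ 2 * Real.cos (N * ((2 : ℝ) • g j) x)) (μ.restrict L) :=
        s123.add s4
      rw [integral_sub s1234 (integrableOn_L continuous_const),
        integral_add s123 s4, integral_add s12 s3, integral_add i1 s2,
        integral_const_mul, integral_const_mul, integral_const_mul,
        integral_finsetSum _ fun j _ => i2 j, integral_finsetSum _ fun j _ => i3 j,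
        integral_finsetSum _ fun j _ => i4 j, setIntegral_const, smul_eq_mul, hlow]
      ring
    · have := hcos N
      have := hcos2 N
      fun_prop
    · have := hp N
      fun_prop
  linarith

/-- A small perturbation whose derivative oscillates in the direction `f₁ + σ x • f₂` with
amplitude `r`, and which raises the energy in the direction `v` on compact sets. -/
lemma exists_perturbation {X : Type*} [NormedAddCommGroup X] [NormedSpace ℝ X]
    [FiniteDimensional ℝ X] [MeasurableSpace X] [BorelSpace X] (μ : Measure X)
    [μ.IsAddHaarMeasure] {Ω O : Set X} (hO : IsOpen O) (hOΩ : O ⊆ Ω) {b : X → ℝ}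
    (hb0 : ∀ x, 0 ≤ b x) (hb : ∀ K ⊆ Ω, IsCompact K → ∃ c > 0, ∀ x ∈ K, c ≤ b x)
    {L : ℕ → Set X} (hL : ∀ n, IsCompact (L n)) {f₁ f₂ : X →L[ℝ] ℝ} {v : X} (hv1 : f₁ v = 1)
    (hv2 : f₂ v = 0) {U : X → ℝ} (hU : ContDiff ℝ 1 U) {σ : X → ℝ} (hσ : Continuous σ) {B : ℝ}
    (hσB : ∀ x, |σ x| ≤ B) (n : ℕ) {r : ℝ} (hr : 0 < r) {ε : ℝ} (hε : 0 < ε) :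
    ∃ (u : X → ℝ) (G : Set X), ContDiff ℝ 1 u ∧ HasCompactSupport u ∧ tsupport u ⊆ O ∧
      (∀ x, 0 ≤ u x ∧ u x ≤ ε * b x) ∧
      (∀ x, ∃ t : ℝ, |t| ≤ r ∧ ‖fderiv ℝ u x - t • (f₁ + σ x • f₂)‖ ≤ ε) ∧
      MeasurableSet G ∧ G ⊆ L n ∧ μ ((O ∩ L n) \ G) ≤ ENNReal.ofReal ε ∧
      ∀ i ≤ n, (∫ x in L i, fderiv ℝ U x v ^ 2 ∂μ) + r ^ 2 / 2 * μ.real (L i ∩ G) - ε ≤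
        ∫ x in L i, (fderiv ℝ U x v + fderiv ℝ u x v) ^ 2 ∂μ := by
  classical
  have hκ : 0 < ε / (2 * r * (‖f₂‖ + 1)) := by positivity
  obtain ⟨ι, _, c, a, G, ha1, hac, haO, ha01, hcσ, had, hGm, hGL, hGμ, hG1⟩ :=
    exists_disjoint_bumps μ hO (hL n) hσ hσB hκ (ENNReal.ofReal_pos.2 hε)
  set κ := ε / (2 * r * (‖f₂‖ + 1)) with hκdef
  have hκf : r * κ * ‖f₂‖ ≤ ε / 2 := by
    have : r * κ * (‖f₂‖ + 1) = ε / 2 := by rw [hκdef]; field_simp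
    nlinarith [norm_nonneg f₂, mul_pos hr hκ]
  let g : ι → X →L[ℝ] ℝ := fun j => f₁ + c j • f₂
  have hgv : ∀ j, g j v = 1 := fun j => by simp [g, hv1, hv2]
  have hg0 : ∀ j, g j ≠ 0 := fun j h => by have := hgv j; simp [h] at this
  have hsum1 : ∀ x, ∑ j, a j x ≤ 1 := fun x => sum_le_one_of_disjoint (fun j => (ha01 j x).2)
    (had x)
  have hda : ∀ j, Continuous (fderiv ℝ (a j)) := fun j => (ha1 j).continuous_fderiv one_ne_zero
  have hDex : ∀ j, ∃ D, ∀ x, ‖fderiv ℝ (a j) x‖ ≤ D := fun j =>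
    ((hac j).fderiv ℝ).exists_bound_of_continuous (hda j)
  choose D hD using hDex
  let E : ℕ → X → X →L[ℝ] ℝ := fun N x =>
    ∑ j, (r * (N : ℝ)⁻¹ * (1 + Real.sin (N * g j x))) • fderiv ℝ (a j) x
  have hE : ∀ N x, ‖E N x‖ ≤ 2 * r * (∑ j, D j) / N := by
    intro N x
    have : 2 * r * (∑ j, D j) / N = ∑ j, r * (N : ℝ)⁻¹ * 2 * D j := by
      rw [← Finset.mul_sum]; ring
    rw [this]
    refine (norm_sum_le _ _).trans (Finset.sum_le_sum fun j _ => ?_)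
    have h1 := Real.neg_one_le_sin (N * g j x)
    have h2 := Real.sin_le_one (N * g j x)
    rw [norm_smul, Real.norm_eq_abs, abs_mul, abs_of_nonneg (by positivity : 0 ≤ r * (N : ℝ)⁻¹),
      abs_of_nonneg (by linarith : 0 ≤ 1 + Real.sin (N * g j x))]
    have h3 : 0 ≤ r * (N : ℝ)⁻¹ := by positivity
    gcongr
    · linarith
    · exact hD j x
  let u : ℕ → X → ℝ := fun N x => ∑ j, r * (N : ℝ)⁻¹ * (a j x * (1 + Real.sin (N * g j x)))
  let P : ℕ → X → X →L[ℝ] ℝ := fun N x => (∑ j, (r * (a j x * Real.cos (N * g j x))) • g j) + E N x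
  have hu1 : ∀ N, ContDiff ℝ 1 (u N) := fun N => ContDiff.sum fun j _ => by
    have := ha1 j
    have := Real.contDiff_sin (n := 1)
    fun_prop
  have hPu : ∀ N : ℕ, 1 ≤ N → ∀ x, fderiv ℝ (u N) x = P N x := by
    intro N hN x
    have hN0 : (N : ℝ) ≠ 0 := by positivity
    have : HasFDerivAt (u N) (∑ j, (r * (N : ℝ)⁻¹) • (a j x • (Real.cos (N * g j x) •
        ((N : ℝ) • g j)) + (1 + Real.sin (N * g j x)) • fderiv ℝ (a j) x)) x := by
      refine HasFDerivAt.fun_sum fun j _ => HasFDerivAt.const_mul ?_ _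
      refine HasFDerivAt.mul ((ha1 j).differentiable one_ne_zero x).hasFDerivAt ?_
      exact (((g j).hasFDerivAt.const_mul (N : ℝ)).sin).const_add 1
    rw [this.fderiv]
    simp only [P, E]
    rw [← Finset.sum_add_distrib]
    refine Finset.sum_congr rfl fun j _ => ?_
    rw [smul_add, smul_smul, smul_smul, smul_smul, smul_smul]
    congr 2
    field_simp
  have hPv : ∀ N x, P N x v = r * ∑ j, a j x * Real.cos (N * g j x) + E N x v := by
    intro N x
    simp only [P, add_apply, sum_apply, _root_.smul_apply, hgv, smul_eq_mul,
      mul_one, Finset.mul_sum]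
  have hEc : ∀ N, Continuous (E N) := fun N => continuous_finsetSum _ fun j _ => by
    have := hda j
    fun_prop
  have hPc : ∀ N, Continuous fun x => P N x v := by
    intro N
    simp_rw [hPv]
    have := hEc N
    have := fun j => (ha1 j).continuous
    fun_prop
  have hR : ∀ (N : ℕ) x, |P N x v - r * ∑ j, a j x * Real.cos (N * g j x)| ≤
      2 * r * (∑ j, D j) * ‖v‖ / N := by
    intro N x
    rw [hPv, add_sub_cancel_left]
    calc |E N x v| ≤ ‖E N x‖ * ‖v‖ := (E N x).le_opNorm v
      _ ≤ 2 * r * (∑ j, D j) / N * ‖v‖ := by gcongr; exact hE N x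
      _ = _ := by ring
  have hen : ∀ i, ∀ᶠ N : ℕ in atTop, (∫ x in L i, fderiv ℝ U x v ^ 2 ∂μ) +
      r ^ 2 / 2 * μ.real (L i ∩ G) - ε ≤ ∫ x in L i, (fderiv ℝ U x v + P N x v) ^ 2 ∂μ := fun i =>
    eventually_energy_le μ (hL i) hGm (q := fun x => fderiv ℝ U x v)
      ((hU.continuous_fderiv one_ne_zero).clm_apply continuous_const)
      (fun j => (ha1 j).continuous) ha01 had hG1 hg0 hr.le hPc hR hε
  obtain ⟨c₀, hc₀, hbc⟩ := hb (⋃ j, tsupport (a j)) (iUnion_subset fun j => (haO j).trans hOΩ)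
    (isCompact_iUnion fun j => hac j)
  have hsmall1 : ∀ᶠ N : ℕ in atTop, 2 * r / (N : ℝ) < ε * c₀ :=
    (tendsto_const_div_atTop_nhds_zero_nat _).eventually_lt_const (by positivity)
  have hsmall2 : ∀ᶠ N : ℕ in atTop, 2 * r * (∑ j, D j) / (N : ℝ) < ε / 2 :=
    (tendsto_const_div_atTop_nhds_zero_nat _).eventually_lt_const (by positivity)
  obtain ⟨N, hNen, hN1, hN2, hN⟩ := (((Set.finite_Iic n).eventually_all.2
    fun i _ => hen i).and (hsmall1.and (hsmall2.and (eventually_ge_atTop 1)))).exists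
  have hterm : ∀ j x, 0 ≤ 1 + Real.sin (N * g j x) := fun j x => by
    linarith [Real.neg_one_le_sin (N * g j x)]
  have hu0 : ∀ x, (∀ j, a j x = 0) → u N x = 0 := fun x hx => by simp [u, hx]
  have hsupp : tsupport (u N) ⊆ ⋃ j, tsupport (a j) := by
    refine closure_minimal (fun x hx => ?_) (isCompact_iUnion fun j => hac j).isClosed
    by_contra hx'
    simp only [mem_iUnion, not_exists] at hx'
    exact hx (hu0 x fun j => image_eq_zero_of_notMem_tsupport (hx' j))
  refine ⟨u N, G, hu1 N, (isCompact_iUnion fun j => hac j).of_isClosed_subset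
    (isClosed_tsupport _) hsupp, hsupp.trans (iUnion_subset haO), fun x => ⟨?_, ?_⟩, fun x => ?_,
    hGm, hGL, hGμ, fun i hi => ?_⟩
  · refine Finset.sum_nonneg fun j _ => ?_
    have := hterm j x
    have := (ha01 j x).1
    positivity
  · by_cases hx : ∀ j, a j x = 0
    · rw [hu0 x hx]
      exact mul_nonneg hε.le (hb0 x)
    · push Not at hx
      obtain ⟨j, hj⟩ := hx
      have h1 : u N x ≤ ∑ j, 2 * r / N * a j x := by
        refine Finset.sum_le_sum fun j _ => ?_
        have h2 := Real.sin_le_one (N * g j x)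
        have h3 := mul_nonneg (mul_nonneg hr.le (inv_nonneg.2 (Nat.cast_nonneg N : (0 : ℝ) ≤ N)))
          (ha01 j x).1
        have h4 : 2 * r / N * a j x = r * (N : ℝ)⁻¹ * a j x * 2 := by ring
        rw [h4, ← mul_assoc]
        exact mul_le_mul_of_nonneg_left (by linarith) h3
      rw [← Finset.mul_sum] at h1
      have h2 : 2 * r / N * ∑ j, a j x ≤ 2 * r / N := mul_le_of_le_one_right (by positivity)
        (hsum1 x)
      have h3 := hbc x (mem_iUnion.2 ⟨j, subset_tsupport _ hj⟩)
      nlinarith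
  · refine ⟨r * ∑ j, a j x * Real.cos (N * g j x), ?_, ?_⟩
    · rw [abs_mul, abs_of_pos hr]
      refine mul_le_of_le_one_right hr.le ((Finset.abs_sum_le_sum_abs _ _).trans
        ((Finset.sum_le_sum fun j _ => ?_).trans (hsum1 x)))
      rw [abs_mul, abs_of_nonneg (ha01 j x).1]
      exact mul_le_of_le_one_right (ha01 j x).1 (Real.abs_cos_le_one _)
    · rw [hPu N hN x]
      have h1 : P N x - (r * ∑ j, a j x * Real.cos (N * g j x)) • (f₁ + σ x • f₂) =
          (∑ j, (r * (a j x * Real.cos (N * g j x)) * (c j - σ x)) • f₂) + E N x := by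
        simp only [P, g]
        rw [Finset.mul_sum, Finset.sum_smul, add_sub_right_comm, ← Finset.sum_sub_distrib]
        congr 1
        refine Finset.sum_congr rfl fun j _ => ?_
        module
      have h2 : ‖∑ j, (r * (a j x * Real.cos (N * g j x)) * (c j - σ x)) • f₂‖ ≤
          r * κ * ‖f₂‖ := by
        calc _ ≤ ∑ j, r * κ * ‖f₂‖ * a j x := by
              refine (norm_sum_le _ _).trans (Finset.sum_le_sum fun j _ => ?_)
              by_cases hj : a j x = 0
              · simp [hj]
              · have h3 := hcσ j x hj
                have h4 := (ha01 j x).1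
                have h5 := Real.abs_cos_le_one (N * g j x)
                rw [norm_smul, Real.norm_eq_abs, abs_mul, abs_mul, abs_mul, abs_of_pos hr,
                  abs_of_nonneg h4]
                calc _ ≤ r * (a j x * 1) * κ * ‖f₂‖ := by gcongr
                  _ = _ := by ring
          _ ≤ _ := by
            rw [← Finset.mul_sum]
            exact mul_le_of_le_one_right (by positivity) (hsum1 x)
      rw [h1]
      refine (norm_add_le _ _).trans ?_
      linarith [hE N x]
  · simp_rw [hPu N hN]
    exact hNen i hi

/-- An exhaustion of `Ω` by compact sets. -/
lemma exists_compact_exhaustion {X : Type*} [NormedAddCommGroup X] [ProperSpace X] {Ω : Set X}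
    (hΩ : IsOpen Ω) :
    ∃ L : ℕ → Set X, (∀ n, IsCompact (L n)) ∧ (∀ n, L n ⊆ Ω) ∧ Monotone L ∧
      (∀ K ⊆ Ω, IsCompact K → ∃ n, K ⊆ L n) ∧
      ∀ n, ∀ x ∈ L n, ∀ y ∉ Ω, 1 / ((n : ℝ) + 1) ≤ dist x y := by
  refine ⟨fun n => closedBall 0 n ∩ ⋂ y ∈ Ωᶜ, {x | 1 / ((n : ℝ) + 1) ≤ dist x y}, fun n => ?_,
    fun n x hx => ?_, fun m n hmn x hx => ?_, fun K hKΩ hK => ?_, fun n x hx y hy => ?_⟩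
  · exact (isCompact_closedBall _ _).inter_right
      (isClosed_biInter fun y _ => isClosed_le continuous_const (by fun_prop))
  · by_contra hxΩ
    have h1 := mem_iInter₂.1 hx.2 x hxΩ
    rw [mem_ofPred_eq, dist_self] at h1
    have : 0 < 1 / ((n : ℝ) + 1) := by positivity
    linarith
  · refine ⟨closedBall_subset_closedBall (Nat.cast_le.2 hmn) hx.1, mem_iInter₂.2 fun y hy => ?_⟩
    have h1 : 1 / ((m : ℝ) + 1) ≤ dist x y := mem_iInter₂.1 hx.2 y hy
    exact (Nat.one_div_le_one_div hmn).trans h1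
  · obtain ⟨δ, hδ, hKδ⟩ := hK.exists_thickening_subset_open hΩ hKΩ
    obtain ⟨R, hR⟩ := hK.isBounded.subset_closedBall 0
    obtain ⟨n₁, hn₁⟩ := exists_nat_one_div_lt hδ
    obtain ⟨n₂, hn₂⟩ := exists_nat_ge R
    refine ⟨max n₁ n₂, fun x hx => ⟨closedBall_subset_closedBall ?_ (hR hx),
      mem_iInter₂.2 fun y hy => ?_⟩⟩
    · exact hn₂.trans (Nat.cast_le.2 (le_max_right _ _))
    · refine ((Nat.one_div_le_one_div (le_max_left n₁ n₂)).trans hn₁.le).trans ?_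
      by_contra! h
      exact hy (hKδ (mem_thickening_iff.2 ⟨x, hx, by rwa [dist_comm]⟩))
  · exact mem_iInter₂.1 hx.2 y hy

lemma exists_pos_le_of_pos {γ : ℕ → ℝ} (hγ : ∀ j, 0 < γ j) (n : ℕ) :
    ∃ c > 0, ∀ j ≤ n, c ≤ γ j := by
  obtain ⟨j, _, hj⟩ := (Finset.range (n + 1)).exists_min_image γ ⟨0, by simp⟩
  exact ⟨γ j, hγ j, fun i hi => hj i (Finset.mem_range_succ_iff.2 hi)⟩

/-- A positive function on `Ω` that decays quadratically at the boundary and below which the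
coercivity of `F` is effective. -/
lemma exists_barrier {X : Type*} [NormedAddCommGroup X] [NormedSpace ℝ X] {Ω : Set X}
    {F : ℝ → X → (X →L[ℝ] ℝ) → ℝ} {L : ℕ → Set X} (hL : ∀ n, IsCompact (L n))
    (hLΩ : ∀ n, L n ⊆ Ω) (hLK : ∀ K ⊆ Ω, IsCompact K → ∃ n, K ⊆ L n)
    (hLd : ∀ n, ∀ x ∈ L n, ∀ y ∉ Ω, 1 / ((n : ℝ) + 1) ≤ dist x y)
    (hB : ∀ K ⊆ Ω, IsCompact K → ∃ α M : ℝ, 0 < α ∧ 0 < M ∧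
      ∀ x ∈ K, ∀ r ∈ Icc (0 : ℝ) α, ∀ φ : X →L[ℝ] ℝ, M ≤ ‖φ‖ → 0 < F r x φ)
    {ε : ℝ} (hε : 0 < ε) :
    ∃ b : X → ℝ, (∀ x, 0 ≤ b x) ∧ (∀ x ∉ Ω, b x = 0) ∧ (∀ x, b x ≤ ε) ∧ (∀ x, b x ≤ 1) ∧
      (∀ x, ∀ y ∉ Ω, b x ≤ dist x y ^ 2) ∧
      (∀ K ⊆ Ω, IsCompact K → ∃ c > 0, ∀ x ∈ K, c ≤ b x) ∧
      ∀ K ⊆ Ω, IsCompact K → ∃ M : ℝ, 0 < M ∧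
        ∀ x ∈ K, ∀ r ∈ Icc (0 : ℝ) (b x), ∀ φ : X →L[ℝ] ℝ, M ≤ ‖φ‖ → 0 < F r x φ := by
  classical
  choose α M hα hM hF using fun n => hB (L n) (hLΩ n) (hL n)
  have hex : ∀ x ∈ Ω, ∃ n, x ∈ L n := fun x hx => by
    obtain ⟨n, hn⟩ := hLK {x} (singleton_subset_iff.2 hx) isCompact_singleton
    exact ⟨n, hn rfl⟩
  let γ : ℕ → ℝ := fun j => min (min 1 ε) (min (α j) ((1 / ((j : ℝ) + 1)) ^ 2))
  have hγ : ∀ j, 0 < γ j := fun j => by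
    have := hα j
    simp only [γ, lt_min_iff]
    exact ⟨⟨one_pos, hε⟩, this, by positivity⟩
  let b : X → ℝ := fun x => if h : x ∈ Ω then γ (Nat.find (hex x h)) else 0
  have hb : ∀ x (h : x ∈ Ω), b x = γ (Nat.find (hex x h)) := fun x h => dif_pos h
  have hbn : ∀ x ∉ Ω, b x = 0 := fun x h => dif_neg h
  have hble : ∀ x, b x ≤ min 1 ε := fun x => by
    by_cases h : x ∈ Ω
    · rw [hb x h]; exact min_le_left _ _
    · rw [hbn x h]; exact (lt_min one_pos hε).le
  refine ⟨b, fun x => ?_, hbn, fun x => (hble x).trans (min_le_right _ _),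
    fun x => (hble x).trans (min_le_left _ _), fun x y hy => ?_, fun K hK hKc => ?_,
    fun K hK hKc => ?_⟩
  · by_cases h : x ∈ Ω
    · rw [hb x h]; exact (hγ _).le
    · rw [hbn x h]
  · by_cases h : x ∈ Ω
    · rw [hb x h]
      refine ((min_le_right _ _).trans (min_le_right _ _)).trans ?_
      exact pow_le_pow_left₀ (by positivity) (hLd _ x (Nat.find_spec (hex x h)) y hy) 2
    · rw [hbn x h]; positivity
  · obtain ⟨n, hn⟩ := hLK K hK hKc
    obtain ⟨c, hc, hcγ⟩ := exists_pos_le_of_pos hγ n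
    exact ⟨c, hc, fun x hx => by
      rw [hb x (hK hx)]; exact hcγ _ (Nat.find_min' _ (hn hx))⟩
  · obtain ⟨n, hn⟩ := hLK K hK hKc
    refine ⟨∑ j ∈ Finset.range (n + 1), M j, Finset.sum_pos (fun j _ => hM j) ⟨0, by simp⟩,
      fun x hx r hr φ hφ => ?_⟩
    rw [hb x (hK hx)] at hr
    refine hF _ x (Nat.find_spec (hex x (hK hx))) r
      ⟨hr.1, hr.2.trans ((min_le_right _ _).trans (min_le_left _ _))⟩ φ (le_trans ?_ hφ)
    exact Finset.single_le_sum (fun j _ => (hM j).le)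
      (Finset.mem_range_succ_iff.2 (Nat.find_min' _ (hn hx)))

lemma exists_seq_of_exists_succ {α : Type*} {P : ℕ → α → Prop} {R : ℕ → α → α → Prop} {s₀ : α}
    (h₀ : P 0 s₀) (h : ∀ n s, P n s → ∃ t, P (n + 1) t ∧ R n s t) :
    ∃ f : ℕ → α, f 0 = s₀ ∧ (∀ n, P n (f n)) ∧ ∀ n, R n (f n) (f (n + 1)) := by
  choose! g hg hR using h
  let f : ℕ → α := fun n => Nat.rec s₀ g n
  have hf : ∀ n, P n (f n) := fun n => by
    induction n with
    | zero => exact h₀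
    | succ n ih => exact hg n _ ih
  exact ⟨f, rfl, hf, fun n => hR n _ (hf n)⟩

/-- Rational affine functions detect all nondegenerate intervals. -/
lemma exists_affine_family :
    ∃ w a c : ℚ × ℚ → ℝ, (∀ i, 0 < w i) ∧ Summable (fun i => w i * |a i|) ∧
      Summable (fun i => w i * |c i|) ∧
      ∀ l r : ℝ, l < r → ∃ i, (∀ z ≤ l, a i * z + c i ≤ -2) ∧ ∀ z, r ≤ z → 2 ≤ a i * z + c i := by
  have hs : Summable fun i : ℚ × ℚ => ((1 : ℝ) / 2) ^ Encodable.encode i :=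
    summable_geometric_two_encode
  refine ⟨fun i => (1 / 2) ^ Encodable.encode i / (1 + |(i.1 : ℝ)| + |(i.2 : ℝ)|),
    fun i => i.1, fun i => i.2, fun i => by positivity,
    hs.of_nonneg_of_le (fun i => by positivity) fun i => ?_,
    hs.of_nonneg_of_le (fun i => by positivity) fun i => ?_, fun l r hlr => ?_⟩
  · rw [div_mul_eq_mul_div, div_le_iff₀ (by positivity)]
    gcongr
    linarith [abs_nonneg (i.2 : ℝ)]
  · rw [div_mul_eq_mul_div, div_le_iff₀ (by positivity)]
    gcongr
    linarith [abs_nonneg (i.1 : ℝ)]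
  · obtain ⟨l', hl, hlr'⟩ := exists_rat_btwn hlr
    obtain ⟨r', hr', hr⟩ := exists_rat_btwn hlr'
    have hpos : (0 : ℝ) < r' - l' := sub_pos.2 hr'
    have ha : (0 : ℝ) < 4 / (r' - l') := by positivity
    refine ⟨(4 / (r' - l'), -2 - 4 / (r' - l') * l'), fun z hz => ?_, fun z hz => ?_⟩
    · push_cast
      nlinarith
    · push_cast
      have : 4 / ((r' : ℝ) - l') * (r' - l') = 4 := by field_simp
      nlinarith

lemma exists_uniform_differentiability {X : Type*} [NormedAddCommGroup X] [NormedSpace ℝ X]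
    {U : X → ℝ} (hU : ContDiff ℝ 1 U) (hUc : HasCompactSupport U) {η : ℝ} (hη : 0 < η) :
    ∃ δ > 0, ∀ x h, ‖h‖ < δ → |U (x + h) - U x - fderiv ℝ U x h| ≤ η * ‖h‖ := by
  have huc : UniformContinuous (fderiv ℝ U) :=
    (hUc.fderiv ℝ).uniformContinuous_of_continuous (hU.continuous_fderiv one_ne_zero)
  obtain ⟨δ, hδ, h⟩ := Metric.uniformContinuous_iff.1 huc η hη
  refine ⟨δ, hδ, fun x k hk => ?_⟩
  have := (convex_ball x δ).norm_image_sub_le_of_norm_hasFDerivWithin_le' (f := U)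
    (f' := fderiv ℝ U) (φ := fderiv ℝ U x) (C := η) (x := x) (y := x + k)
    (fun y _ => (hU.differentiable one_ne_zero y).hasFDerivAt.hasFDerivWithinAt)
    (fun y hy => by
      rw [← dist_eq_norm]
      exact (h hy).le) (mem_ball_self hδ) (by simpa using hk)
  simpa using this

/-- The points at which `U` stays a strict subsolution after any perturbation of size `R`. -/
def slackSet {X : Type*} [NormedAddCommGroup X] [NormedSpace ℝ X] (Ω : Set X)
    (F : ℝ → X → (X →L[ℝ] ℝ) → ℝ) (U : X → ℝ) (R : ℝ) : Set X :=
  {x | x ∈ Ω ∧ ∀ q ∈ closedBall (0 : ℝ × (X →L[ℝ] ℝ)) R,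
    F (U x + q.1) x (fderiv ℝ U x + q.2) < 0}

lemma isOpen_slackSet {X : Type*} [NormedAddCommGroup X] [NormedSpace ℝ X]
    [FiniteDimensional ℝ X] {Ω : Set X} (hΩ : IsOpen Ω) {F : ℝ → X → (X →L[ℝ] ℝ) → ℝ}
    (hF : ContinuousOn (fun p : ℝ × X × (X →L[ℝ] ℝ) => F p.1 p.2.1 p.2.2)
      {p : ℝ × X × (X →L[ℝ] ℝ) | p.2.1 ∈ Ω}) {U : X → ℝ} (hU : ContDiff ℝ 1 U) (R : ℝ) :
    IsOpen (slackSet Ω F U R) := by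
  have hΩ' : IsOpen {p : ℝ × X × (X →L[ℝ] ℝ) | p.2.1 ∈ Ω} := hΩ.preimage (by fun_prop)
  have hD := hU.continuous_fderiv one_ne_zero
  have hUc := hU.continuous
  rw [isOpen_iff_mem_nhds]
  rintro x ⟨hx, hxF⟩
  have hprop : ProperSpace (ℝ × (X →L[ℝ] ℝ)) := FiniteDimensional.proper_real _
  have := (isCompact_closedBall (0 : ℝ × (X →L[ℝ] ℝ)) R).eventually_forall_of_forall_eventually
    (x₀ := x) (P := fun x q => F (U x + q.1) x (fderiv ℝ U x + q.2) < 0) fun q hq => by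
      have hmap : Continuous fun z : X × (ℝ × (X →L[ℝ] ℝ)) =>
        (U z.1 + z.2.1, z.1, fderiv ℝ U z.1 + z.2.2) := by fun_prop
      have hc : ContinuousAt (fun p : ℝ × X × (X →L[ℝ] ℝ) => F p.1 p.2.1 p.2.2)
        (U x + q.1, x, fderiv ℝ U x + q.2) := hF.continuousAt (hΩ'.mem_nhds hx)
      exact (hc.comp_of_eq hmap.continuousAt rfl : ContinuousAt _ (x, q)).eventually_lt
        continuousAt_const (hxF q hq)
  filter_upwards [this, hΩ.mem_nhds hx] with y h1 h2 using ⟨h2, h1⟩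

/-- The invariants of the approximating subsolutions: the function, its hysteresis variables, and a
scale at which it is well approximated by its linearization. -/
structure StageInv {X ι : Type*} [NormedAddCommGroup X] [NormedSpace ℝ X] (Ω : Set X)
    (F : ℝ → X → (X →L[ℝ] ℝ) → ℝ) (b : X → ℝ) (n : ℕ) (s : (X → ℝ) × (ι → X → ℝ) × ℝ) : Prop where
  contDiff : ContDiff ℝ 1 s.1
  compact : HasCompactSupport s.1
  nonneg : ∀ x, 0 ≤ s.1 x
  le_barrier : ∀ x, s.1 x ≤ (1 - (1 / 2) ^ n) * b x
  cont : ∀ i, Continuous (s.2.1 i)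
  abs_le : ∀ i x, |s.2.1 i x| ≤ 1
  sub : ∀ x ∈ Ω, F (s.1 x) x (fderiv ℝ s.1 x) ≤ 0
  scale_pos : 0 < s.2.2
  scale_le : s.2.2 ≤ 1
  modulus : ∀ x h, ‖h‖ < s.2.2 →
    |s.1 (x + h) - s.1 x - fderiv ℝ s.1 x h| ≤ (1 / 2) ^ n * ‖h‖

/-- The relation between consecutive approximating subsolutions, for oscillation amplitude `r`. -/
structure StageStep {X ι : Type*} [NormedAddCommGroup X] [NormedSpace ℝ X] [MeasurableSpace X]
    (μ : Measure X) (Ω : Set X) (F : ℝ → X → (X →L[ℝ] ℝ) → ℝ) (b : X → ℝ) (L : ℕ → Set X)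
    (f₁ f₂ : X →L[ℝ] ℝ) (v : X) (w a c : ι → ℝ) (C : ℝ) (n : ℕ) (r : ℝ)
    (s t : (X → ℝ) × (ι → X → ℝ) × ℝ) : Prop where
  scale : t.2.2 ≤ s.2.2 / 2
  le : ∀ x, s.1 x ≤ t.1 x
  ge : ∀ x, t.1 x ≤ s.1 x + (1 / 2) ^ (n + 1) * s.2.2 * b x
  lipschitz : ∀ x h, |(t.1 (x + h) - s.1 (x + h)) - (t.1 x - s.1 x)| ≤ C * r * ‖h‖
  hyst_eq : ∀ i x, t.2.1 i x = hyst (a i * fderiv ℝ t.1 x v + c i) (s.2.1 i x)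
  direction : ∀ x, ∃ τ : ℝ, ‖fderiv ℝ t.1 x - fderiv ℝ s.1 x -
    τ • (f₁ + (∑' i, w i * a i * s.2.1 i x) • f₂)‖ ≤ (1 / 2) ^ n
  energy : ∃ G, MeasurableSet G ∧
    μ ((slackSet Ω F s.1 (C * r) ∩ L n) \ G) ≤ ENNReal.ofReal ((1 / 2) ^ n) ∧
    ∀ i ≤ n, (∫ x in L i, fderiv ℝ s.1 x v ^ 2 ∂μ) + r ^ 2 / 2 * μ.real (L i ∩ G) - (1 / 2) ^ n ≤
      ∫ x in L i, fderiv ℝ t.1 x v ^ 2 ∂μ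

lemma stageInv_zero {X ι : Type*} [NormedAddCommGroup X] [NormedSpace ℝ X] {Ω : Set X}
    {F : ℝ → X → (X →L[ℝ] ℝ) → ℝ} {b : X → ℝ} (hA : ∀ x ∈ Ω, F 0 x 0 ≤ 0) :
    StageInv (ι := ι) Ω F b 0 (0, 0, 1) where
  contDiff := contDiff_const
  compact := HasCompactSupport.zero
  nonneg _ := le_rfl
  le_barrier _ := by simp
  cont _ := continuous_const
  abs_le _ _ := by simp
  sub x hx := by simpa using hA x hx
  scale_pos := one_pos
  scale_le := le_rfl
  modulus x h _ := by simp

lemma continuous_hyst {X : Type*} [TopologicalSpace X] {z s : X → ℝ} (hz : Continuous z)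
    (hs : Continuous s) : Continuous fun x => hyst (z x) (s x) := by
  unfold hyst
  fun_prop

lemma exists_stageStep {X ι : Type*} [NormedAddCommGroup X] [NormedSpace ℝ X]
    [FiniteDimensional ℝ X] [MeasurableSpace X] [BorelSpace X] (μ : Measure X)
    [μ.IsAddHaarMeasure] {Ω : Set X} (hΩ : IsOpen Ω) {F : ℝ → X → (X →L[ℝ] ℝ) → ℝ}
    (hF : ContinuousOn (fun p : ℝ × X × (X →L[ℝ] ℝ) => F p.1 p.2.1 p.2.2)
      {p : ℝ × X × (X →L[ℝ] ℝ) | p.2.1 ∈ Ω})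
    {b : X → ℝ} (hb0 : ∀ x, 0 ≤ b x) (hb1 : ∀ x, b x ≤ 1)
    (hb : ∀ K ⊆ Ω, IsCompact K → ∃ c > 0, ∀ x ∈ K, c ≤ b x)
    {L : ℕ → Set X} (hL : ∀ n, IsCompact (L n)) {f₁ f₂ : X →L[ℝ] ℝ} {v : X} (hv1 : f₁ v = 1)
    (hv2 : f₂ v = 0) {w a c : ι → ℝ} (hw : ∀ i, 0 < w i) (hwa : Summable fun i => w i * |a i|)
    {C : ℝ} (hC : ‖f₁‖ + (∑' i, w i * |a i|) * ‖f₂‖ + 1 ≤ C) (n : ℕ) {r : ℝ} (hr : 0 < r)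
    {s : (X → ℝ) × (ι → X → ℝ) × ℝ} (hs : StageInv Ω F b n s) :
    ∃ t, StageInv Ω F b (n + 1) t ∧ StageStep μ Ω F b L f₁ f₂ v w a c C n r s t := by
  obtain ⟨U, S, δ⟩ := s
  obtain ⟨hU, hUc, hU0, hUb, hS, hS1, hUF, hδ0, hδ1, -⟩ := hs
  dsimp only at hU hUc hU0 hUb hS hS1 hUF hδ0 hδ1
  have hterm : ∀ i x, ‖w i * a i * S i x‖ ≤ w i * |a i| := fun i x => by
    rw [Real.norm_eq_abs, abs_mul, abs_mul, abs_of_pos (hw i)]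
    exact mul_le_of_le_one_right (mul_nonneg (hw i).le (abs_nonneg _)) (hS1 i x)
  set σ : X → ℝ := fun x => ∑' i, w i * a i * S i x with hσdef
  have hσ : Continuous σ := continuous_tsum (fun i => continuous_const.mul (hS i)) hwa hterm
  have hσB : ∀ x, |σ x| ≤ ∑' i, w i * |a i| := fun x =>
    tsum_of_norm_bounded hwa.hasSum fun i => hterm i x
  have hB0 : 0 ≤ ∑' i, w i * |a i| := (abs_nonneg _).trans (hσB 0)
  have hC1 : 1 ≤ C := by nlinarith [norm_nonneg f₁, norm_nonneg f₂, mul_nonneg hB0 (norm_nonneg f₂)]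
  have hpow : (0 : ℝ) < (1 / 2) ^ (n + 1) := by positivity
  have hpow2 : ((1 : ℝ) / 2) ^ (n + 1) ≤ (1 / 2) ^ n := by
    rw [pow_succ]; nlinarith [show (0 : ℝ) < (1 / 2) ^ n by positivity]
  set ε := min ((1 / 2) ^ (n + 1) * δ) r with hεdef
  have hε : 0 < ε := lt_min (by positivity) hr
  have hεδ : ε ≤ (1 / 2) ^ (n + 1) * δ := min_le_left _ _
  have hεr : ε ≤ r := min_le_right _ _
  have hεn1 : ε ≤ (1 / 2) ^ (n + 1) := hεδ.trans (mul_le_of_le_one_right hpow.le hδ1)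
  have hεn : ε ≤ (1 / 2) ^ n := hεn1.trans hpow2
  obtain ⟨u, G, hu, huc, huO, hub, hudir, hGm, hGL, hGμ, hen⟩ := exists_perturbation μ
    (isOpen_slackSet hΩ hF hU (C * r)) (fun x hx => hx.1) hb0 hb hL hv1 hv2 hU hσ hσB n hr hε
  have hdf : ∀ x, fderiv ℝ (U + u) x = fderiv ℝ U x + fderiv ℝ u x := fun x =>
    fderiv_add (hU.differentiable one_ne_zero x) (hu.differentiable one_ne_zero x)
  have huC : ∀ x, ‖fderiv ℝ u x‖ ≤ C * r := by
    intro x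
    obtain ⟨τ, hτ, hτε⟩ := hudir x
    have h1 : ‖f₁ + σ x • f₂‖ ≤ ‖f₁‖ + (∑' i, w i * |a i|) * ‖f₂‖ := by
      refine (norm_add_le _ _).trans ?_
      rw [norm_smul, Real.norm_eq_abs]
      gcongr
      exact hσB x
    have h2 : ‖τ • (f₁ + σ x • f₂)‖ ≤ r * (‖f₁‖ + (∑' i, w i * |a i|) * ‖f₂‖) := by
      rw [norm_smul, Real.norm_eq_abs]
      gcongr
    have h3 := norm_sub_norm_le (fderiv ℝ u x) (τ • (f₁ + σ x • f₂))
    nlinarith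
  have hUu : ContDiff ℝ 1 (U + u) := hU.add hu
  have hUuc : HasCompactSupport (U + u) := hUc.add huc
  obtain ⟨δ', hδ'0, hδ'⟩ := exists_uniform_differentiability hUu hUuc hpow
  have hDv : Continuous fun x => fderiv ℝ (U + u) x v :=
    (hUu.continuous_fderiv one_ne_zero).clm_apply continuous_const
  refine ⟨(U + u, fun i x => hyst (a i * fderiv ℝ (U + u) x v + c i) (S i x), min δ' (δ / 2)),
    ⟨hUu, hUuc, fun x => add_nonneg (hU0 x) (hub x).1, fun x => ?_, fun i => ?_,
      fun i x => abs_hyst_le _ (hS1 i x), fun x hx => ?_, lt_min hδ'0 (half_pos hδ0), ?_,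
      fun x h hh => hδ' x h (hh.trans_le (min_le_left _ _))⟩,
    ⟨min_le_right _ _, fun x => le_add_of_nonneg_right (hub x).1, fun x => ?_, fun x h => ?_,
      fun i x => rfl, fun x => ?_, G, hGm, hGμ.trans (ENNReal.ofReal_le_ofReal hεn),
      fun i hi => ?_⟩⟩
  · have h1 := (hub x).2
    have h2 := hUb x
    have h3 := mul_le_mul_of_nonneg_right hεn1 (hb0 x)
    have h4 : ((1 : ℝ) / 2) ^ n = 2 * (1 / 2) ^ (n + 1) := by rw [pow_succ]; ring
    simp only [Pi.add_apply]
    rw [h4] at h2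
    nlinarith
  · exact continuous_hyst (by fun_prop) (hS i)
  · simp only [hdf, Pi.add_apply]
    by_cases hxu : x ∈ tsupport u
    · refine ((huO hxu).2 (u x, fderiv ℝ u x) ?_).le
      rw [mem_closedBall_zero_iff, Prod.norm_def, max_le_iff, Real.norm_eq_abs,
        abs_of_nonneg (hub x).1]
      refine ⟨?_, huC x⟩
      have h1 := (hub x).2.trans (mul_le_of_le_one_right hε.le (hb1 x))
      nlinarith
    · rw [fderiv_of_notMem_tsupport ℝ hxu, image_eq_zero_of_notMem_tsupport hxu, add_zero, add_zero]
      exact hUF x hx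
  · exact (min_le_right _ _).trans (by linarith)
  · simp only [Pi.add_apply]
    have := mul_le_mul_of_nonneg_right hεδ (hb0 x)
    linarith [(hub x).2]
  · simp only [Pi.add_apply, add_sub_cancel_left]
    have := convex_univ.norm_image_sub_le_of_norm_fderiv_le (f := u) (𝕜 := ℝ) (C := C * r) (x := x)
      (y := x + h) (fun y _ => hu.differentiable one_ne_zero y) (fun y _ => huC y) (mem_univ _)
      (mem_univ _)
    simpa using this
  · obtain ⟨τ, -, hτ⟩ := hudir x
    refine ⟨τ, ?_⟩
    simp only [hdf, add_sub_cancel_left]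
    exact hτ.trans hεn
  · have := hen i hi
    simp only [hdf, add_apply]
    linarith

lemma exists_tendsto_of_hyst_directions {X ι : Type*} [NormedAddCommGroup X] [NormedSpace ℝ X]
    {f₁ f₂ : X →L[ℝ] ℝ} {v₁ v₂ : X} (h11 : f₁ v₁ = 1) (h12 : f₁ v₂ = 0) (h21 : f₂ v₁ = 0)
    (h22 : f₂ v₂ = 1) {w a c : ι → ℝ} (hw : ∀ i, 0 < w i) (hwa : Summable fun i => w i * |a i|)
    (hwc : Summable fun i => w i * |c i|)
    (hac : ∀ l r : ℝ, l < r →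
      ∃ i, (∀ z ≤ l, a i * z + c i ≤ -2) ∧ ∀ z, r ≤ z → 2 ≤ a i * z + c i)
    {D : ℕ → X →L[ℝ] ℝ} {S : ℕ → ι → ℝ} (hS1 : ∀ n i, |S n i| ≤ 1)
    (hS : ∀ n i, S (n + 1) i = hyst (a i * D (n + 1) v₁ + c i) (S n i))
    (hD : ∀ n, ∃ τ : ℝ, ‖D (n + 1) - D n - τ • (f₁ + (∑' i, w i * a i * S n i) • f₂)‖ ≤ (1 / 2) ^ n)
    {M : ℝ} (hM : ∀ n, ‖D n‖ ≤ M) : ∃ p, Tendsto D atTop (𝓝 p) := by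
  choose τ hτ using hD
  set σ : ℕ → ℝ := fun n => ∑' i, w i * a i * S n i with hσ
  have hterm : ∀ n i, ‖w i * a i * S n i‖ ≤ w i * |a i| := fun n i => by
    rw [Real.norm_eq_abs, abs_mul, abs_mul, abs_of_pos (hw i)]
    exact mul_le_of_le_one_right (mul_nonneg (hw i).le (abs_nonneg _)) (hS1 n i)
  have hσB : ∀ n, |σ n| ≤ ∑' i, w i * |a i| := fun n =>
    tsum_of_norm_bounded hwa.hasSum (hterm n)
  set B := ∑' i, w i * |a i|
  have hB0 : 0 ≤ B := (abs_nonneg _).trans (hσB 0)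
  set e : ℕ → X →L[ℝ] ℝ := fun n => D (n + 1) - D n - τ n • (f₁ + σ n • f₂) with he
  have hev : ∀ n v, |e n v| ≤ (1 / 2) ^ n * ‖v‖ := fun n v =>
    ((e n).le_opNorm v).trans (mul_le_mul_of_nonneg_right (hτ n) (norm_nonneg v))
  have e1 : ∀ n, e n v₁ = D (n + 1) v₁ - D n v₁ - τ n := fun n => by simp [he, h11, h21]
  have e2 : ∀ n, e n v₂ = D (n + 1) v₂ - D n v₂ - τ n * σ n := fun n => by simp [he, h12, h22]
  have hgeo : Summable fun n : ℕ => ((1 : ℝ) / 2) ^ n := summable_geometric_two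
  have hDv : ∀ v n, |D n v| ≤ M * ‖v‖ := fun v n =>
    ((D n).le_opNorm v).trans (mul_le_mul_of_nonneg_right (hM n) (norm_nonneg v))
  obtain ⟨⟨x, hx⟩, y, hy⟩ := exists_tendsto_of_hyst hw hwa hwc hac (x := fun n => D n v₁)
    (y := fun n => D n v₂) (e := fun n => e n v₂ - σ n * e n v₁) (s := S) (hS1 0) hS
    (fun n => by
      rw [e1, e2]
      change _ = σ n * _ + _
      ring)
    (by
      refine (hgeo.mul_right (‖v₂‖ + B * ‖v₁‖)).of_norm_bounded fun n => ?_
      rw [Real.norm_eq_abs]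
      refine (abs_sub _ _).trans ?_
      rw [abs_mul]
      have := mul_le_mul (hσB n) (hev n v₁) (abs_nonneg _) hB0
      have := hev n v₂
      linarith)
    (B := M * ‖v₁‖ + M * ‖v₂‖)
    (fun n => (hDv v₁ n).trans (le_add_of_nonneg_right ((abs_nonneg _).trans (hDv v₂ n))))
    (fun n => (hDv v₂ n).trans (le_add_of_nonneg_left ((abs_nonneg _).trans (hDv v₁ n))))
  have hZ : CauchySeq fun n => D n - D n v₁ • f₁ - D n v₂ • f₂ := by
    refine cauchySeq_of_summable_dist
      ((hgeo.mul_right (1 + ‖v₁‖ * ‖f₁‖ + ‖v₂‖ * ‖f₂‖)).of_nonneg_of_le (fun _ => dist_nonneg)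
        fun n => ?_)
    have h1 : D n.succ - D n.succ v₁ • f₁ - D n.succ v₂ • f₂ -
        (D n - D n v₁ • f₁ - D n v₂ • f₂) = e n - e n v₁ • f₁ - e n v₂ • f₂ := by
      rw [e1, e2]
      simp only [he, Nat.succ_eq_add_one]
      module
    rw [dist_comm, dist_eq_norm, h1]
    have h2 : ‖e n v₁ • f₁‖ ≤ (1 / 2) ^ n * ‖v₁‖ * ‖f₁‖ := by
      rw [norm_smul]
      exact mul_le_mul_of_nonneg_right (hev n v₁) (norm_nonneg _)
    have h3 : ‖e n v₂ • f₂‖ ≤ (1 / 2) ^ n * ‖v₂‖ * ‖f₂‖ := by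
      rw [norm_smul]
      exact mul_le_mul_of_nonneg_right (hev n v₂) (norm_nonneg _)
    have h4 := norm_sub_le (e n - e n v₁ • f₁) (e n v₂ • f₂)
    have h5 := norm_sub_le (e n) (e n v₁ • f₁)
    have h6 := hτ n
    linarith
  obtain ⟨Z, hZ⟩ := cauchySeq_tendsto_of_complete hZ
  refine ⟨Z + x • f₁ + y • f₂, ((hZ.add (hx.smul_const f₁)).add (hy.smul_const f₂)).congr
    fun n => ?_⟩
  abel

lemma hasFDerivAt_of_scales {X : Type*} [NormedAddCommGroup X] [NormedSpace ℝ X] {u : X → ℝ}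
    {x : X} {p : X →L[ℝ] ℝ} {δ η : ℕ → ℝ} (hδ : ∀ n, 0 < δ n) (hδa : Antitone δ)
    (hδ0 : Tendsto δ atTop (𝓝 0)) (hη : Tendsto η atTop (𝓝 0))
    (h : ∀ n k, δ (n + 1) ≤ ‖k‖ → ‖k‖ < δ n → |u (x + k) - u x - p k| ≤ η n * ‖k‖) :
    HasFDerivAt u p x := by
  classical
  rw [hasFDerivAt_iff_isLittleO_nhds_zero, Asymptotics.isLittleO_iff]
  intro ε hε
  obtain ⟨N, hN⟩ := eventually_atTop.1 (hη.eventually_le_const hε)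
  filter_upwards [ball_mem_nhds (0 : X) (hδ N)] with k hk
  rw [mem_ball_zero_iff] at hk
  rcases eq_or_ne k 0 with rfl | hk0
  · simp
  have hex : ∃ n, δ n ≤ ‖k‖ := (hδ0.eventually_le_const (norm_pos_iff.2 hk0)).exists
  have hNm : N < Nat.find hex := by
    by_contra! hle
    exact absurd ((hδa hle).trans (Nat.find_spec hex)) (not_le.2 hk)
  obtain ⟨m, hm⟩ := Nat.exists_eq_add_one_of_ne_zero (Nat.ne_zero_of_lt hNm)
  refine (h m k (hm ▸ Nat.find_spec hex) ?_).trans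
    (mul_le_mul_of_nonneg_right (hN m (by omega)) (norm_nonneg _))
  exact not_le.1 (Nat.find_min hex (by omega))

lemma hasFDerivAt_zero_of_le_sq {X : Type*} [NormedAddCommGroup X] [NormedSpace ℝ X] {u : X → ℝ}
    {x : X} (h0 : ∀ y, 0 ≤ u y) (h : ∀ y, u y ≤ dist y x ^ 2) :
    HasFDerivAt u (0 : X →L[ℝ] ℝ) x := by
  have hux : u x = 0 := le_antisymm (by simpa using h x) (h0 x)
  rw [hasFDerivAt_iff_isLittleO_nhds_zero, Asymptotics.isLittleO_iff]
  intro ε hε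
  filter_upwards [ball_mem_nhds (0 : X) hε] with k hk
  rw [mem_ball_zero_iff] at hk
  rw [hux, zero_apply, sub_zero, sub_zero, Real.norm_eq_abs, abs_of_nonneg (h0 _)]
  have := h (x + k)
  rw [dist_eq_norm, add_sub_cancel_left] at this
  nlinarith [norm_nonneg k]

lemma ae_not_eventually_mem {X : Type*} [MeasurableSpace X] {μ : Measure X} {A G : ℕ → Set X}
    (hG : ∀ n, MeasurableSet (G n)) {L : Set X} (hL : μ L ≠ ⊤)
    (hA : ∀ n, μ (A n \ G n) ≤ ENNReal.ofReal ((1 / 2) ^ n)) {r : ℕ → ℝ}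
    (hr : ¬ Summable fun n => r n ^ 2) (hs : Summable fun n => r n ^ 2 * μ.real (L ∩ G n)) :
    ∀ᵐ x ∂μ.restrict L, ¬ ∀ᶠ n in atTop, x ∈ A n := by
  have h1 : ∀ᵐ x ∂μ.restrict L, ∀ᶠ n in atTop, x ∉ A n \ G n := by
    refine ae_mono Measure.restrict_le_self (ae_eventually_notMem ?_)
    refine ne_top_of_le_ne_top ?_ (ENNReal.tsum_le_tsum hA)
    exact summable_geometric_two.tsum_ofReal_ne_top
  have h2 : ∀ᵐ x ∂μ.restrict L,
      ∑' n, (G n).indicator (fun _ => ENNReal.ofReal (r n ^ 2)) x < ⊤ := by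
    refine ae_lt_top (Measurable.tsum fun n => measurable_const.indicator (hG n)) ?_
    rw [lintegral_tsum fun n => (measurable_const.indicator (hG n)).aemeasurable]
    convert hs.tsum_ofReal_ne_top using 4 with n
    rw [lintegral_indicator_const (hG n), Measure.restrict_apply (hG n), inter_comm,
      ENNReal.ofReal_mul (sq_nonneg _), ofReal_measureReal
        (measure_ne_top_of_subset inter_subset_left hL)]
  filter_upwards [h1, h2] with x hx1 hx2 hx
  refine hr ((ENNReal.summable_toReal hx2.ne).congr_atTop ?_)
  filter_upwards [hx1, hx] with n hn1 hn2
  have hxG : x ∈ G n := by_contra fun h => hn1 ⟨hn2, h⟩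
  rw [indicator_of_mem hxG, ENNReal.toReal_ofReal (sq_nonneg _)]

lemma exists_tendsto_of_le_add_scale {U δ : ℕ → ℝ} {β : ℝ} (hδ : ∀ n, 0 ≤ δ n) (hδa : Antitone δ)
    (hβ : β ≤ 1) (hU : Monotone U) (hUδ : ∀ n, U (n + 1) ≤ U n + (1 / 2) ^ (n + 1) * δ n * β) :
    ∃ l, Tendsto U atTop (𝓝 l) ∧ ∀ n, U n ≤ l ∧ l ≤ U n + (1 / 2) ^ n * δ n := by
  have hV : Antitone fun n => U n + (1 / 2) ^ n * δ n := antitone_nat_of_succ_le fun n => by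
    have h1 : (0 : ℝ) < (1 / 2) ^ (n + 1) := by positivity
    have h2 : ((1 : ℝ) / 2) ^ n = 2 * (1 / 2) ^ (n + 1) := by rw [pow_succ]; ring
    have h3 := mul_le_mul_of_nonneg_left hβ (mul_nonneg h1.le (hδ n))
    have h4 := mul_le_mul_of_nonneg_left (hδa (Nat.le_add_right n 1)) h1.le
    have h5 := hUδ n
    rw [h2]
    linarith
  have hUV : ∀ n m, U m ≤ U n + (1 / 2) ^ n * δ n := fun n m => by
    have h1 : U (max n m) ≤ U (max n m) + (1 / 2) ^ (max n m) * δ (max n m) :=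
      le_add_of_nonneg_right (mul_nonneg (by positivity) (hδ _))
    exact (hU (le_max_right n m)).trans (h1.trans (hV (le_max_left n m)))
  have hb : BddAbove (range U) := ⟨_, forall_mem_range.2 (hUV 0)⟩
  exact ⟨⨆ n, U n, tendsto_atTop_ciSup hU hb, fun n => ⟨le_ciSup hb n, ciSup_le (hUV n)⟩⟩

lemma summable_of_energy_le {E q : ℕ → ℝ} {K : ℝ} {i : ℕ} (hE0 : ∀ n, 0 ≤ E n) (hEK : ∀ n, E n ≤ K)
    (hq : ∀ n, 0 ≤ q n) (h : ∀ n, i ≤ n → E n + q n - (1 / 2) ^ n ≤ E (n + 1)) : Summable q := by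
  rw [← summable_nat_add_iff i]
  refine summable_of_sum_range_le (c := K + 2) (fun n => hq _) fun N => ?_
  have h1 : ∑ k ∈ Finset.range N, q (k + i) ≤
      ∑ k ∈ Finset.range N, (E (k + 1 + i) - E (k + i) + (1 / 2) ^ k) := by
    refine Finset.sum_le_sum fun k _ => ?_
    have h2 := h (k + i) (by omega)
    have h3 : ((1 : ℝ) / 2) ^ (k + i) ≤ (1 / 2) ^ k :=
      pow_le_pow_of_le_one (by norm_num) (by norm_num) (by omega)
    rw [show k + 1 + i = k + i + 1 by omega]
    linarith
  rw [Finset.sum_add_distrib, Finset.sum_range_sub fun k => E (k + i)] at h1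
  have h4 : ∑ k ∈ Finset.range N, ((1 : ℝ) / 2) ^ k ≤ 2 := by
    exact (summable_geometric_two.sum_le_tsum _ fun k _ => by positivity).trans_eq
      tsum_geometric_two
  linarith [hEK (N + i), hE0 (0 + i)]

lemma eventually_mem_slackSet {X : Type*} [NormedAddCommGroup X] [NormedSpace ℝ X] {Ω : Set X}
    (hΩ : IsOpen Ω) {F : ℝ → X → (X →L[ℝ] ℝ) → ℝ}
    (hF : ContinuousOn (fun p : ℝ × X × (X →L[ℝ] ℝ) => F p.1 p.2.1 p.2.2)
      {p : ℝ × X × (X →L[ℝ] ℝ) | p.2.1 ∈ Ω}) {U : ℕ → X → ℝ} {R : ℕ → ℝ}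
    (hR : Tendsto R atTop (𝓝 0)) {x : X} (hx : x ∈ Ω) {y : ℝ} {p : X →L[ℝ] ℝ}
    (hU : Tendsto (fun n => U n x) atTop (𝓝 y))
    (hD : Tendsto (fun n => fderiv ℝ (U n) x) atTop (𝓝 p)) (hlt : F y x p < 0) :
    ∀ᶠ n in atTop, x ∈ slackSet Ω F (U n) (R n) := by
  have hΩ' : IsOpen {p : ℝ × X × (X →L[ℝ] ℝ) | p.2.1 ∈ Ω} := hΩ.preimage (by fun_prop)
  have hc : ContinuousAt (fun p : ℝ × X × (X →L[ℝ] ℝ) => F p.1 p.2.1 p.2.2) (y, x, p) :=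
    hF.continuousAt (hΩ'.mem_nhds hx)
  have hc2 : ContinuousAt (fun q : ℝ × (X →L[ℝ] ℝ) => F q.1 x q.2) (y, p) :=
    hc.comp_of_eq (f := fun q : ℝ × (X →L[ℝ] ℝ) => (q.1, x, q.2)) (by fun_prop) rfl
  obtain ⟨ρ, hρ, hball⟩ := Metric.eventually_nhds_iff_ball.1
    (hc2.eventually_lt continuousAt_const hlt)
  have hUD : Tendsto (fun n => (U n x, fderiv ℝ (U n) x)) atTop (𝓝 (y, p)) := hU.prodMk_nhds hD
  filter_upwards [hUD (ball_mem_nhds _ (half_pos hρ)), hR.eventually_lt_const (half_pos hρ)]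
    with n h1 h2
  refine ⟨hx, fun q hq => hball ((U n x, fderiv ℝ (U n) x) + q) ?_⟩
  rw [mem_preimage, mem_ball] at h1
  rw [mem_ball]
  rw [mem_closedBall_zero_iff] at hq
  calc dist ((U n x, fderiv ℝ (U n) x) + q) (y, p)
      ≤ dist ((U n x, fderiv ℝ (U n) x) + q) (U n x, fderiv ℝ (U n) x) +
        dist (U n x, fderiv ℝ (U n) x) (y, p) := dist_triangle _ _ _
    _ < ρ := by
      rw [dist_eq_norm, add_sub_cancel_left]
      linarith

lemma exists_dual_pair {X : Type*} [NormedAddCommGroup X] [NormedSpace ℝ X]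
    [FiniteDimensional ℝ X] (hdim : 2 ≤ Module.finrank ℝ X) :
    ∃ (f₁ f₂ : X →L[ℝ] ℝ) (v₁ v₂ : X), f₁ v₁ = 1 ∧ f₁ v₂ = 0 ∧ f₂ v₁ = 0 ∧ f₂ v₂ = 1 := by
  let B := Module.finBasis ℝ X
  refine ⟨(B.coord ⟨0, by omega⟩).toContinuousLinearMap,
    (B.coord ⟨1, by omega⟩).toContinuousLinearMap, B ⟨0, by omega⟩, B ⟨1, by omega⟩, ?_⟩
  simp

/-- Existence of almost classical solutions with small supremum norm of
`F(u(x), x, Du(x)) = 0` with homogeneous Dirichlet condition, on an open subset of a finite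
dimensional normed space of dimension ≥ 2. Moreover the extension of `u` by `0` outside `Ω`
(here, the function `u` itself, required to vanish off `Ω`) is differentiable everywhere. -/
theorem stmt_16 {X : Type*} [NormedAddCommGroup X] [NormedSpace ℝ X] [FiniteDimensional ℝ X]
    [MeasurableSpace X] [BorelSpace X] (μ : Measure X) [μ.IsAddHaarMeasure]
    (hdim : 2 ≤ Module.finrank ℝ X)
    (Ω : Set X) (hΩ : IsOpen Ω)
    (F : ℝ → X → (X →L[ℝ] ℝ) → ℝ)
    (hFcont : ContinuousOn (fun p : ℝ × X × (X →L[ℝ] ℝ) => F p.1 p.2.1 p.2.2)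
      {p : ℝ × X × (X →L[ℝ] ℝ) | p.2.1 ∈ Ω})
    (hA : ∀ x ∈ Ω, F 0 x 0 ≤ 0)
    (hB : ∀ K ⊆ Ω, IsCompact K → ∃ α M : ℝ, 0 < α ∧ 0 < M ∧
      ∀ x ∈ K, ∀ r ∈ Icc (0 : ℝ) α, ∀ φ : X →L[ℝ] ℝ, M ≤ ‖φ‖ → 0 < F r x φ)
    (ε : ℝ) (hε : 0 < ε) :
    ∃ u : X → ℝ,
      (∀ x, x ∉ Ω → u x = 0) ∧
      (∀ x ∈ closure Ω, 0 ≤ u x ∧ u x ≤ ε) ∧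
      (∀ x ∈ frontier Ω, u x = 0) ∧
      (∀ x, DifferentiableAt ℝ u x) ∧
      (∀ x ∈ Ω, F (u x) x (fderiv ℝ u x) ≤ 0) ∧
      (∀ᵐ x ∂(μ.restrict Ω), F (u x) x (fderiv ℝ u x) = 0) := by
  classical
  obtain ⟨f₁, f₂, v₁, v₂, h11, h12, h21, h22⟩ := exists_dual_pair hdim
  obtain ⟨w, a, c, hw, hwa, hwc, hac⟩ := exists_affine_family
  obtain ⟨L, hL, hLΩ, hLmono, hLK, hLd⟩ := exists_compact_exhaustion hΩ
  obtain ⟨b, hb0, hbΩ, hbε, hb1, hbd, hbK, hbM⟩ := exists_barrier hL hLΩ hLK hLd hB hε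
  set C : ℝ := ‖f₁‖ + (∑' i, w i * |a i|) * ‖f₂‖ + 1 with hC
  let r : ℕ → ℝ := fun n => (√((n : ℝ) + 1))⁻¹
  have hr : ∀ n, 0 < r n := fun n => by positivity
  have hr2 : ∀ n, r n ^ 2 = 1 / ((n : ℝ) + 1) := fun n => by
    rw [inv_pow, Real.sq_sqrt (by positivity), one_div]
  have hr0 : Tendsto r atTop (𝓝 0) := tendsto_inv_atTop_zero.comp
    (Real.tendsto_sqrt_atTop.comp (tendsto_natCast_atTop_atTop.atTop_add tendsto_const_nhds))
  have hrs : ¬ Summable fun n => r n ^ 2 := by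
    simp_rw [hr2]
    exact_mod_cast (summable_nat_add_iff 1).not.2 Real.not_summable_one_div_natCast
  obtain ⟨s, hs0, hI, hR⟩ := exists_seq_of_exists_succ (stageInv_zero (ι := ℚ × ℚ) (b := b) hA)
    fun n s hs => exists_stageStep μ hΩ hFcont hb0 hb1 hbK hL h11 h21 hw hwa hC.le n (hr n) hs
  set U : ℕ → X → ℝ := fun n => (s n).1 with hU
  set δ : ℕ → ℝ := fun n => (s n).2.2 with hδ
  have hδpos : ∀ n, 0 < δ n := fun n => (hI n).scale_pos
  have hδhalf : ∀ n, δ (n + 1) ≤ δ n / 2 := fun n => (hR n).scale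
  have hδa : Antitone δ := antitone_nat_of_succ_le fun n => by linarith [hδhalf n, hδpos n]
  have hδpow : ∀ n, δ n ≤ (1 / 2) ^ n := fun n => by
    induction n with
    | zero => simpa using (hI 0).scale_le
    | succ n ih => rw [pow_succ]; linarith [hδhalf n]
  have hgeo : Tendsto (fun n : ℕ => ((1 : ℝ) / 2) ^ n) atTop (𝓝 0) :=
    tendsto_pow_atTop_nhds_zero_of_lt_one (by norm_num) (by norm_num)
  have hδ0 : Tendsto δ atTop (𝓝 0) := squeeze_zero (fun n => (hδpos n).le) hδpow hgeo
  choose u hu huU using fun x => exists_tendsto_of_le_add_scale (U := fun n => U n x)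
    (fun n => (hδpos n).le) hδa (hb1 x) (monotone_nat_of_le_succ fun n => (hR n).le x)
    fun n => (hR n).ge x
  have hUb : ∀ n x, U n x ≤ b x := fun n x => ((hI n).le_barrier x).trans
    (mul_le_of_le_one_left (hb0 x) (sub_le_self _ (by positivity)))
  have hu0 : ∀ x, 0 ≤ u x := fun x => ((hI 0).nonneg x).trans (huU x 0).1
  have hub : ∀ x, u x ≤ b x := fun x => le_of_tendsto' (hu x) fun n => hUb n x
  have hbound : ∀ K ⊆ Ω, IsCompact K → ∃ M : ℝ, ∀ n, ∀ x ∈ K, ‖fderiv ℝ (U n) x‖ ≤ M := by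
    intro K hK hKc
    obtain ⟨M, -, hM⟩ := hbM K hK hKc
    refine ⟨M, fun n x hx => ?_⟩
    by_contra! h
    exact absurd (hM x hx (U n x) ⟨(hI n).nonneg x, hUb n x⟩ _ h.le)
      (not_lt.2 ((hI n).sub x (hK hx)))
  have hlim : ∀ x ∈ Ω, ∃ p, Tendsto (fun n => fderiv ℝ (U n) x) atTop (𝓝 p) := by
    intro x hx
    obtain ⟨M, hM⟩ := hbound {x} (singleton_subset_iff.2 hx) isCompact_singleton
    exact exists_tendsto_of_hyst_directions h11 h12 h21 h22 hw hwa hwc hac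
      (S := fun n i => (s n).2.1 i x) (fun n i => (hI n).abs_le i x)
      (fun n i => (hR n).hyst_eq i x) (fun n => (hR n).direction x) fun n => hM n x rfl
  choose! p hp using hlim
  have hderiv : ∀ x ∈ Ω, HasFDerivAt u (p x) x := by
    intro x hx
    refine hasFDerivAt_of_scales (δ := δ) (η := fun n => (1 / 2) ^ n + ‖fderiv ℝ (U n) x - p x‖ +
      C * r n + (1 / 2) ^ (n + 1)) hδpos hδa hδ0 ?_ fun n k hk1 hk2 => ?_
    · have h1 := ((hp x hx).sub_const (p x)).norm
      rw [sub_self, norm_zero] at h1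
      simpa using ((hgeo.add h1).add (hr0.const_mul C)).add (hgeo.comp (tendsto_add_atTop_nat 1))
    · have h1 := (hI n).modulus x k hk2
      have h2 := (hR n).lipschitz x k
      have h3 : |(fderiv ℝ (U n) x - p x) k| ≤ ‖fderiv ℝ (U n) x - p x‖ * ‖k‖ :=
        (fderiv ℝ (U n) x - p x).le_opNorm k
      rw [sub_apply] at h3
      have h4 := huU (x + k) (n + 1)
      have h5 := huU x (n + 1)
      have h6 : (1 / 2) ^ (n + 1) * δ (n + 1) ≤ (1 / 2) ^ (n + 1) * ‖k‖ := by gcongr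
      simp only [hU] at h1 h3 h4 h5 ⊢
      rw [abs_le] at h1 h2 h3 ⊢
      constructor <;> linarith [h1.1, h1.2, h2.1, h2.2, h3.1, h3.2, h4.1, h4.2, h5.1, h5.2]
  have huΩ : ∀ x, x ∉ Ω → u x = 0 := fun x hx =>
    le_antisymm ((hub x).trans (hbΩ x hx).le) (hu0 x)
  have hΩ' : IsOpen {p : ℝ × X × (X →L[ℝ] ℝ) | p.2.1 ∈ Ω} := hΩ.preimage (by fun_prop)
  have hsub : ∀ x ∈ Ω, F (u x) x (p x) ≤ 0 := by
    intro x hx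
    have hc : ContinuousAt (fun p : ℝ × X × (X →L[ℝ] ℝ) => F p.1 p.2.1 p.2.2) (u x, x, p x) :=
      hFcont.continuousAt (hΩ'.mem_nhds hx)
    have ht : Tendsto (fun n => (U n x, x, fderiv ℝ (U n) x)) atTop (𝓝 (u x, x, p x)) :=
      (hu x).prodMk_nhds (tendsto_const_nhds.prodMk_nhds (hp x hx))
    exact le_of_tendsto' (hc.tendsto.comp ht) fun n => (hI n).sub x hx
  refine ⟨u, huΩ, fun x _ => ⟨hu0 x, (hub x).trans (hbε x)⟩, fun x hx => huΩ x fun hxΩ => ?_,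
    fun x => ?_, fun x hx => by rw [(hderiv x hx).fderiv]; exact hsub x hx, ?_⟩
  · rw [hΩ.frontier_eq] at hx
    exact hx.2 hxΩ
  · by_cases hx : x ∈ Ω
    · exact (hderiv x hx).differentiableAt
    · exact (hasFDerivAt_zero_of_le_sq hu0
        fun y => (hub y).trans (hbd y x hx)).differentiableAt
  · choose G hGm hGμ hGe using fun n => (hR n).energy
    have hΩL : Ω = ⋃ i, L i := subset_antisymm (fun x hx => by
      obtain ⟨n, hn⟩ := hLK {x} (singleton_subset_iff.2 hx) isCompact_singleton
      exact mem_iUnion.2 ⟨n, hn rfl⟩) (iUnion_subset hLΩ)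
    have hkey : ∀ i, ∀ᵐ x ∂μ.restrict (L i), F (u x) x (fderiv ℝ u x) = 0 := by
      intro i
      obtain ⟨M, hM⟩ := hbound (L i) (hLΩ i) (hL i)
      have hcont : ∀ n, Continuous fun x => fderiv ℝ (U n) x v₁ := fun n =>
        ((hI n).contDiff.continuous_fderiv one_ne_zero).clm_apply continuous_const
      have hq : Summable fun n => r n ^ 2 / 2 * μ.real (L i ∩ G n) := by
        refine summable_of_energy_le (E := fun n => ∫ x in L i, fderiv ℝ (U n) x v₁ ^ 2 ∂μ)
          (K := ∫ _ in L i, (M * ‖v₁‖) ^ 2 ∂μ) (i := i)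
          (fun n => integral_nonneg fun x => sq_nonneg _) (fun n => ?_) (fun n => by positivity)
          fun n hn => hGe n i hn
        refine setIntegral_mono_on (((hcont n).pow 2).continuousOn.integrableOn_compact (hL i))
          (continuousOn_const.integrableOn_compact (hL i)) (hL i).measurableSet fun x hx => ?_
        refine sq_le_sq' (neg_le_of_abs_le ?_) (le_of_abs_le ?_) <;>
        exact ((fderiv ℝ (U n) x).le_opNorm v₁).trans
          (mul_le_mul_of_nonneg_right (hM n x hx) (norm_nonneg _))
      have hq2 : Summable fun n => r n ^ 2 * μ.real (L i ∩ G n) :=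
        (hq.mul_left 2).congr fun n => by ring
      have hmem : ∀ᵐ x ∂μ.restrict (L i), x ∈ L i := ae_restrict_mem (hL i).measurableSet
      filter_upwards [hmem, ae_not_eventually_mem hGm (hL i).measure_lt_top.ne hGμ hrs hq2]
        with x hx hnot
      have hxΩ := hLΩ i hx
      rw [(hderiv x hxΩ).fderiv]
      refine le_antisymm (hsub x hxΩ) (not_lt.1 fun hlt => hnot ?_)
      have hCr : Tendsto (fun n => C * r n) atTop (𝓝 0) := by simpa using hr0.const_mul C
      filter_upwards [eventually_mem_slackSet hΩ hFcont hCr hxΩ (hu x) (hp x hxΩ) hlt,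
        eventually_ge_atTop i] with n h1 h2 using ⟨h1, hLmono h2 hx⟩
    rw [hΩL, ae_restrict_iUnion_iff]
    exact hkey
end

section
/- Let Ω ⊂ ℝ² be an open subset (with the euclidean norm) and let u₀ : ∂Ω → ℝ be a 1-Lipschitz function for the euclidean distance. Then there exists a 1-Lipschitz function w : cl(Ω) → ℝ which is differentiable at every point of Ω, satisfies |∇w(x)| = 1 for almost every x ∈ Ω (with respect to Lebesgue measure), and satisfies w = u₀ on ∂Ω; i.e., there exists an almost classical solution of the Eikonal equation |∇w| = 1 on Ω with boundary value u₀. -/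
open Metric Set MeasureTheory

open Filter Topology InnerProductSpace Gradient

/-- The weight attached to the `k`-th reference point. -/
noncomputable def refWeight (k : ℕ) : ℝ := (1 / 2) / 2 / 2 ^ k

/-- Replace the `k`-th reference point by `a` whenever it is at distance at least `2⁻ᵏ` of `a`. -/
noncomputable def refUpdate {E : Type*} [NormedAddCommGroup E] (a : E) (b : ℕ → E) (k : ℕ) : E :=
  if (1 / 2) ^ k ≤ ‖a - b k‖ then a else b k

/-- The potential associated with a sequence of reference points. -/
noncomputable def refPot {E : Type*} [NormedAddCommGroup E] (b : ℕ → E) (a : E) : ℝ :=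
  ‖a‖ ^ 2 - ∑' k, refWeight k * ‖a - b k‖ ^ 2

/-- Half of the gradient of `refPot b` at `a`. -/
noncomputable def refPotGrad {E : Type*} [NormedAddCommGroup E] [NormedSpace ℝ E]
    (b : ℕ → E) (a : E) : E :=
  a - ∑' k, refWeight k • (a - b k)

theorem refWeight_pos (k : ℕ) : 0 < refWeight k := by unfold refWeight; positivity

theorem hasSum_refWeight : HasSum refWeight (1 / 2) := hasSum_geometric_two' (1 / 2)

theorem summable_refWeight_mul {c : ℕ → ℝ} {C : ℝ} (hc : ∀ k, |c k| ≤ C) :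
    Summable fun k => refWeight k * c k := by
  refine Summable.of_norm_bounded (hasSum_refWeight.summable.mul_right C) fun k => ?_
  rw [norm_mul, Real.norm_of_nonneg (refWeight_pos k).le]
  exact mul_le_mul_of_nonneg_left (hc k) (refWeight_pos k).le

section Potential

variable {E : Type*} [NormedAddCommGroup E]

theorem norm_refUpdate_le {a : E} {b : ℕ → E} {C : ℝ} (ha : ‖a‖ ≤ C) (hb : ∀ k, ‖b k‖ ≤ C) (k : ℕ) :
    ‖refUpdate a b k‖ ≤ C := by
  unfold refUpdate
  split_ifs
  · exact ha
  · exact hb k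

theorem norm_sub_refUpdate_lt (a : E) (b : ℕ → E) (k : ℕ) :
    ‖a - refUpdate a b k‖ < (1 / 2) ^ k := by
  unfold refUpdate
  split_ifs with h
  · simp
  · exact not_le.1 h

theorem summable_refPot {b : ℕ → E} (hb : ∀ k, ‖b k‖ ≤ 1) (a : E) :
    Summable fun k => refWeight k * ‖a - b k‖ ^ 2 := by
  refine summable_refWeight_mul (C := (‖a‖ + 1) ^ 2) fun k => ?_
  rw [abs_of_nonneg (by positivity)]
  gcongr
  exact (norm_sub_le _ _).trans (by gcongr; exact hb k)

theorem refPot_le (b : ℕ → E) {a : E} (ha : ‖a‖ ≤ 1) : refPot b a ≤ 1 := by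
  have : 0 ≤ ∑' k, refWeight k * ‖a - b k‖ ^ 2 :=
    tsum_nonneg fun k => mul_nonneg (refWeight_pos k).le (by positivity)
  have h2 : ‖a‖ ^ 2 ≤ 1 := pow_le_one₀ (norm_nonneg _) ha
  unfold refPot
  linarith

theorem neg_two_le_refPot {b : ℕ → E} (hb : ∀ k, ‖b k‖ ≤ 1) {a : E} (ha : ‖a‖ ≤ 1) :
    -2 ≤ refPot b a := by
  have : ∑' k, refWeight k * ‖a - b k‖ ^ 2 ≤ 1 / 2 * 4 := by
    rw [← hasSum_refWeight.tsum_eq, ← tsum_mul_right]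
    refine (summable_refPot hb a).tsum_le_tsum (fun k => ?_) (hasSum_refWeight.summable.mul_right 4)
    have h1 : ‖a - b k‖ ≤ 2 := (norm_sub_le _ _).trans (by linarith [hb k])
    have := refWeight_pos k
    gcongr
    nlinarith [norm_nonneg (a - b k)]
  unfold refPot
  nlinarith [sq_nonneg ‖a‖]

theorem refPot_le_refPot_refUpdate {b : ℕ → E} (hb : ∀ k, ‖b k‖ ≤ 1) {a : E} (ha : ‖a‖ ≤ 1) :
    refPot b a ≤ refPot (refUpdate a b) a := by
  unfold refPot
  gcongr with k
  · exact summable_refPot (norm_refUpdate_le ha hb) a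
  · exact summable_refPot hb a
  · exact (refWeight_pos k).le
  · unfold refUpdate
    split_ifs <;> simp

theorem refPot_add_le_refPot_refUpdate {b : ℕ → E} (hb : ∀ k, ‖b k‖ ≤ 1) {a : E} (ha : ‖a‖ ≤ 1)
    {k : ℕ} (hk : (1 / 2) ^ k ≤ ‖a - b k‖) :
    refPot b a + refWeight k * ((1 / 2) ^ k) ^ 2 ≤ refPot (refUpdate a b) a := by
  have h1 := summable_refPot (norm_refUpdate_le ha hb) a
  have h2 : Summable (Pi.single k (refWeight k * ((1 / 2) ^ k) ^ 2) : ℕ → ℝ) :=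
    (hasSum_pi_single k _).summable
  have h3 : ∑' j, (refWeight j * ‖a - refUpdate a b j‖ ^ 2
      + (Pi.single k (refWeight k * ((1 / 2) ^ k) ^ 2) : ℕ → ℝ) j)
      ≤ ∑' j, refWeight j * ‖a - b j‖ ^ 2 := by
    refine (h1.add h2).tsum_le_tsum (fun j => ?_) (summable_refPot hb a)
    have := (refWeight_pos j).le
    rcases eq_or_ne j k with rfl | hj
    · simp only [Pi.single_eq_same, refUpdate, if_pos hk]
      simp only [sub_self, norm_zero]
      have : ((1 / 2 : ℝ) ^ j) ^ 2 ≤ ‖a - b j‖ ^ 2 := by gcongr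
      nlinarith
    · rw [Pi.single_eq_of_ne hj, add_zero]
      gcongr
      unfold refUpdate
      split_ifs <;> simp
  rw [h1.tsum_add h2, (hasSum_pi_single k _).tsum_eq] at h3
  unfold refPot
  linarith

variable [InnerProductSpace ℝ E]

theorem refPot_add [CompleteSpace E] {b : ℕ → E} (hb : ∀ k, ‖b k‖ ≤ 1) (a d : E) :
    refPot b (a + d) = refPot b a + 2 * inner ℝ d (refPotGrad b a) + 1 / 2 * ‖d‖ ^ 2 := by
  have hs : Summable fun k => refWeight k • (a - b k) := by
    refine Summable.of_norm_bounded (hasSum_refWeight.summable.mul_right (‖a‖ + 1)) fun k => ?_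
    rw [norm_smul, Real.norm_of_nonneg (refWeight_pos k).le]
    have := refWeight_pos k
    gcongr
    exact (norm_sub_le _ _).trans (by gcongr; exact hb k)
  have h1 : HasSum (fun k => refWeight k * ‖a + d - b k‖ ^ 2)
      ((∑' k, refWeight k * ‖a - b k‖ ^ 2) + 2 * inner ℝ d (∑' k, refWeight k • (a - b k))
        + 1 / 2 * ‖d‖ ^ 2) := by
    have h2 := ((innerSL ℝ d).hasSum hs.hasSum).mul_left 2
    have h3 := ((summable_refPot hb a).hasSum.add h2).add (hasSum_refWeight.mul_right (‖d‖ ^ 2))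
    convert h3 using 2 with k
    · have h4 : a + d - b k = (a - b k) + d := by abel
      rw [h4, norm_add_sq_real, innerSL_apply_apply, inner_smul_right, real_inner_comm]
      ring
    · rfl
  unfold refPot refPotGrad
  rw [h1.tsum_eq, norm_add_sq_real, inner_sub_right, real_inner_comm]
  ring

theorem norm_refPotGrad_le {b : ℕ → E} (hb : ∀ k, ‖b k‖ ≤ 1) {a : E} (ha : ‖a‖ ≤ 1) :
    ‖refPotGrad b a‖ ≤ 2 := by
  have h : ‖∑' k, refWeight k • (a - b k)‖ ≤ 1 / 2 * 2 := by
    refine tsum_of_norm_bounded (hasSum_refWeight.mul_right 2) fun k => ?_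
    rw [norm_smul, Real.norm_of_nonneg (refWeight_pos k).le]
    have := refWeight_pos k
    gcongr
    exact (norm_sub_le _ _).trans (by linarith [hb k])
  unfold refPotGrad
  exact (norm_sub_le _ _).trans (by linarith)

theorem refPot_add_sq_le [CompleteSpace E] {b : ℕ → E} (hb : ∀ k, ‖b k‖ ≤ 1) {a a' u : E} {s e : ℝ}
    (ha : ‖a‖ ≤ 1) (hu : ‖u‖ = 1) (hug : inner ℝ u (refPotGrad b a) = 0) (he : e ≤ 2)
    (h : ‖a' - a - s • u‖ ≤ e) : refPot b a + s ^ 2 / 4 - 5 * e ≤ refPot b a' := by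
  set q := a' - a - s • u with hq
  have ha' : a' = a + (s • u + q) := by rw [hq]; abel
  have h0 : 0 ≤ e := (norm_nonneg _).trans h
  rw [ha', refPot_add hb, inner_add_left, inner_smul_left, hug]
  have h1 : |inner ℝ q (refPotGrad b a)| ≤ e * 2 :=
    (abs_real_inner_le_norm _ _).trans (by gcongr; exact norm_refPotGrad_le hb ha)
  have h2 : |s| ≤ ‖s • u + q‖ + e := by
    have : ‖s • u‖ ≤ ‖s • u + q‖ + ‖q‖ := by
      simpa using norm_sub_le (s • u + q) q
    rw [norm_smul, hu, mul_one, Real.norm_eq_abs] at this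
    linarith
  have h3 : s ^ 2 ≤ (‖s • u + q‖ + e) ^ 2 := by
    rw [← sq_abs]; gcongr
  have := abs_le.1 h1
  have h4 := sq_nonneg (‖s • u + q‖ - e)
  simp only [mul_zero, zero_add]
  nlinarith

/-- A sequence moving along directions prescribed by the potentials: the total energy of the moves
is bounded, and the sequence converges. -/
theorem refPot_game [CompleteSpace E] {a u : ℕ → E} {b : ℕ → ℕ → E} {s : ℕ → ℝ}
    (ha : ∀ n, ‖a n‖ ≤ 1) (hb0 : ∀ k, ‖b 0 k‖ ≤ 1) (hb : ∀ n, b (n + 1) = refUpdate (a n) (b n))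
    (hu : ∀ n, ‖u n‖ = 1) (hug : ∀ n, inner ℝ (u n) (refPotGrad (b (n + 1)) (a n)) = 0)
    (h : ∀ n, ‖a (n + 1) - a n - s n • u n‖ ≤ (1 / 2) ^ n) :
    (∀ N, ∑ n ∈ Finset.range N, s n ^ 2 ≤ 52) ∧ ∃ l, Tendsto a atTop (𝓝 l) := by
  have hbn : ∀ n k, ‖b n k‖ ≤ 1 := by
    intro n
    induction n with
    | zero => exact hb0
    | succ n ih => intro k; rw [hb]; exact norm_refUpdate_le (ha n) ih k
  set P : ℕ → ℝ := fun n => refPot (b n) (a n) - 10 * (1 / 2) ^ n with hP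
  have step : ∀ n, refPot (b (n + 1)) (a n) - 10 * (1 / 2) ^ n + s n ^ 2 / 4 ≤ P (n + 1) := by
    intro n
    have h1 := refPot_add_sq_le (hbn (n + 1)) (ha n) (hu n) (hug n)
      ((pow_le_one₀ (by norm_num) (by norm_num)).trans one_le_two) (h n)
    simp only [hP, pow_succ]
    linarith
  have step0 : ∀ n, P n + s n ^ 2 / 4 ≤ P (n + 1) := by
    intro n
    have h1 := refPot_le_refPot_refUpdate (hbn n) (ha n)
    rw [← hb] at h1
    have := step n
    simp only [hP] at this ⊢
    linarith
  have stepk : ∀ n k, b (n + 1) k ≠ b n k → P n + refWeight k * ((1 / 2) ^ k) ^ 2 ≤ P (n + 1) := by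
    intro n k hne
    have hk : (1 / 2) ^ k ≤ ‖a n - b n k‖ := by
      by_contra hk
      exact hne (by rw [hb, refUpdate, if_neg hk])
    have h1 := refPot_add_le_refPot_refUpdate (hbn n) (ha n) hk
    rw [← hb] at h1
    have := step n
    simp only [hP] at this ⊢
    nlinarith [sq_nonneg (s n)]
  have hPle : ∀ n, P n ≤ 1 := fun n => by
    have := refPot_le (b n) (ha n)
    have : (0 : ℝ) ≤ (1 / 2) ^ n := by positivity
    simp only [hP]; linarith
  constructor
  · intro N
    have h1 : ∀ N, P 0 + (∑ n ∈ Finset.range N, s n ^ 2) / 4 ≤ P N := by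
      intro N
      induction N with
      | zero => simp
      | succ N ih => rw [Finset.sum_range_succ]; linarith [step0 N]
    have h2 := neg_two_le_refPot hb0 (ha 0)
    have h3 : -12 ≤ P 0 := by simp only [hP]; linarith
    linarith [h1 N, hPle N]
  · have hmono : Monotone P := monotone_nat_of_le_succ fun n => by
      nlinarith [step0 n, sq_nonneg (s n)]
    obtain ⟨l, hl⟩ : ∃ l, Tendsto P atTop (𝓝 l) :=
      ⟨_, tendsto_atTop_ciSup hmono ⟨1, by rintro _ ⟨n, rfl⟩; exact hPle n⟩⟩
    have hd : Tendsto (fun n => P (n + 1) - P n) atTop (𝓝 0) := by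
      simpa using (hl.comp (tendsto_add_atTop_nat 1)).sub hl
    have hev : ∀ k, ∃ N, ∀ n ≥ N, b (n + 1) k = b n k := by
      intro k
      have hpos : 0 < refWeight k * ((1 / 2) ^ k) ^ 2 := mul_pos (refWeight_pos k) (by positivity)
      obtain ⟨N, hN⟩ := eventually_atTop.1 (hd.eventually_lt_const hpos)
      refine ⟨N, fun n hn => ?_⟩
      by_contra hne
      linarith [hN n hn, stepk n k hne]
    refine cauchySeq_tendsto_of_complete (Metric.cauchySeq_iff'.2 fun ε hε => ?_)
    obtain ⟨k, hk⟩ := exists_pow_lt_of_lt_one (half_pos hε) (show (1 / 2 : ℝ) < 1 by norm_num)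
    obtain ⟨N, hN⟩ := hev k
    have hconst : ∀ n ≥ N, b (n + 1) k = b (N + 1) k := by
      intro n hn
      induction n, hn using Nat.le_induction with
      | base => rfl
      | succ n hn ih => rw [hN (n + 1) (by omega), ih]
    have hclose : ∀ n ≥ N, ‖a n - b (N + 1) k‖ < ε / 2 := by
      intro n hn
      rw [← hconst n hn, hb]
      exact (norm_sub_refUpdate_lt _ _ _).trans hk
    refine ⟨N, fun n hn => ?_⟩
    rw [dist_eq_norm]
    calc ‖a n - a N‖ = ‖(a n - b (N + 1) k) - (a N - b (N + 1) k)‖ := by congr 1; abel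
      _ ≤ _ := norm_sub_le _ _
      _ < ε := by linarith [hclose n hn, hclose N le_rfl]

end Potential

/-- The Euclidean plane. -/
abbrev Plane := EuclideanSpace ℝ (Fin 2)

theorem exists_unit_inner_eq_zero (g : Plane) : ∃ u : Plane, ‖u‖ = 1 ∧ inner ℝ u g = 0 := by
  have : ∃ v : Plane, v ≠ 0 ∧ inner ℝ v g = 0 := by
    rcases eq_or_ne g 0 with rfl | hg
    · obtain ⟨v, hv⟩ := exists_ne (0 : Plane)
      exact ⟨v, hv, inner_zero_right v⟩
    · refine ⟨!₂[- g 1, g 0], fun h => hg ?_, ?_⟩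
      · have h0 := congrArg (fun v : Plane => v 0) h
        have h1 := congrArg (fun v : Plane => v 1) h
        ext i
        fin_cases i <;> simp_all
      · simp [PiLp.inner_apply, Fin.sum_univ_two]
        ring
  obtain ⟨v, hv, hvg⟩ := this
  refine ⟨‖v‖⁻¹ • v, ?_, ?_⟩
  · rw [norm_smul, norm_inv, norm_norm, inv_mul_cancel₀ (norm_ne_zero_iff.2 hv)]
  · rw [inner_smul_left, hvg, mul_zero]

/-- Up to a null set, an open set is a countable disjoint union of small open balls. -/
theorem exists_ball_decomposition {O : Set Plane} (hO : IsOpen O) {R : Plane → ℝ}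
    (hR : ∀ x ∈ O, 0 < R x) :
    ∃ (T : Set Plane) (r : Plane → ℝ), T.Countable ∧ T ⊆ O ∧ (∀ x ∈ T, 0 < r x ∧ r x < R x) ∧
      (∀ x ∈ T, ball x (r x) ⊆ O) ∧ volume (O \ ⋃ x ∈ T, ball x (r x)) = 0 ∧
      T.PairwiseDisjoint fun x => ball x (r x) := by
  have hd : ∀ x ∈ O, ∃ d > 0, ball x d ⊆ O := fun x hx => Metric.isOpen_iff.1 hO x hx
  choose! d hd0 hdO using hd
  obtain ⟨T, r, hT, hTO, hr, hnull, hdisj⟩ := Besicovitch.exists_disjoint_closedBall_covering_ae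
    (volume : Measure Plane) (fun _ => univ) O (fun x _ δ hδ => by simpa using hδ)
    (fun x => min (R x) (d x)) (fun x hx => lt_min (hR x hx) (hd0 x hx))
  refine ⟨T, r, hT, hTO, fun x hx => ⟨(hr x hx).2.1, (hr x hx).2.2.trans_le (min_le_left _ _)⟩,
    fun x hx => (ball_subset_ball ((hr x hx).2.2.le.trans (min_le_right _ _))).trans
      (hdO x (hTO hx)), ?_, hdisj.mono fun x => ball_subset_closedBall⟩
  have hS : volume (⋃ x ∈ T, sphere x (r x)) = 0 :=
    (measure_biUnion_null_iff hT).2 fun x _ => Measure.addHaar_sphere _ _ _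
  refine measure_mono_null ?_ (measure_union_null hnull hS)
  rintro y ⟨hyO, hy⟩
  by_cases h : y ∈ ⋃ x ∈ T, closedBall x (r x)
  · right
    simp only [mem_iUnion, mem_closedBall, mem_ball, not_exists, not_lt, mem_sphere] at h hy ⊢
    obtain ⟨x, hx, hxy⟩ := h
    exact ⟨x, hx, le_antisymm hxy (hy x hx)⟩
  · exact Or.inl ⟨hyO, h⟩

theorem exists_bump (x : Plane) {r : ℝ} (hr : 0 < r) :
    ∃ (χ : Plane → ℝ) (C : ℝ), ContDiff ℝ 1 χ ∧ (∀ z, 0 ≤ χ z) ∧ (∀ z, χ z ≤ 1) ∧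
      (∀ z ∈ ball x (r / 4), χ z = 1) ∧ (∀ z, r / 2 ≤ dist z x → χ z = 0) ∧ 0 < C ∧
      ∀ z, ‖∇ χ z‖ ≤ C := by
  let χ : ContDiffBump x := ⟨r / 4, r / 2, by positivity, by linarith⟩
  have hc : Continuous (fderiv ℝ χ) := (χ.contDiff (n := 1)).continuous_fderiv one_ne_zero
  obtain ⟨C, hC⟩ := hc.bounded_above_of_compact_support (χ.hasCompactSupport.fderiv (𝕜 := ℝ))
  refine ⟨χ, max C 1, χ.contDiff, fun z => χ.nonneg, fun z => χ.le_one,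
    fun z hz => χ.one_of_mem_closedBall (ball_subset_closedBall hz),
    fun z hz => χ.zero_of_le_dist hz,
    by positivity, fun z => ?_⟩
  rw [gradient, LinearIsometryEquiv.norm_map]
  exact (hC z).trans (le_max_left _ _)

/-- A small oscillating function supported in a ball, whose gradient is almost parallel to `u`. -/
theorem exists_oscillation (x u : Plane) {r t η : ℝ} (hr : 0 < r) (ht : 0 ≤ t)
    (ht1 : t ≤ 1) (hη : 0 < η) :
    ∃ h s : Plane → ℝ, ContDiff ℝ 1 h ∧ Continuous s ∧ (∀ z, |s z| ≤ t) ∧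
      (∀ z, ‖∇ h z - s z • u‖ ≤ η) ∧ (∀ z, |h z| ≤ η) ∧ (∀ z, r / 2 ≤ dist z x → h z = 0) ∧
      ∫⁻ _ in ball x r, ENNReal.ofReal (t ^ 2) ≤
        32 * ∫⁻ z in ball x r, ENNReal.ofReal (s z ^ 2) := by
  obtain ⟨χ, C, hχ, hχ0, hχ1, hχin, hχout, hC, hχC⟩ := exists_bump x hr
  set ε : ℝ := min η (η / C) with hεdef
  have hε : 0 < ε := lt_min hη (div_pos hη hC)
  let phase : ℝ → Plane → ℝ := fun φ z => inner ℝ u z / ε + φ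
  have hphase : ∀ φ, ContDiff ℝ 1 (phase φ) := fun φ => by
    have : ContDiff ℝ 1 (fun z : Plane => inner ℝ u z) := contDiff_const.inner ℝ contDiff_id
    exact (this.div_const ε).add contDiff_const
  have key : ∀ φ : ℝ, ∫⁻ _ in ball x r, ENNReal.ofReal (t ^ 2) ≤
        32 * ∫⁻ z in ball x r, ENNReal.ofReal ((t * Real.cos (phase φ z) * χ z) ^ 2) →
      ∃ h s : Plane → ℝ, ContDiff ℝ 1 h ∧ Continuous s ∧ (∀ z, |s z| ≤ t) ∧
      (∀ z, ‖∇ h z - s z • u‖ ≤ η) ∧ (∀ z, |h z| ≤ η) ∧ (∀ z, r / 2 ≤ dist z x → h z = 0) ∧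
      ∫⁻ _ in ball x r, ENNReal.ofReal (t ^ 2) ≤
        32 * ∫⁻ z in ball x r, ENNReal.ofReal (s z ^ 2) := by
    intro φ hφ
    refine ⟨fun z => ε * t * Real.sin (phase φ z) * χ z, fun z => t * Real.cos (phase φ z) * χ z,
      (contDiff_const.mul (hphase φ).sin).mul hχ, ?_, fun z => ?_, fun z => ?_, fun z => ?_,
      fun z hz => by simp [hχout z hz], hφ⟩
    · exact (continuous_const.mul (Real.continuous_cos.comp (hphase φ).continuous)).mul
        hχ.continuous
    · rw [abs_mul, abs_mul, abs_of_nonneg ht, abs_of_nonneg (hχ0 z)]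
      have := Real.abs_cos_le_one (phase φ z)
      calc t * |Real.cos (phase φ z)| * χ z ≤ t * 1 * 1 := by
            have h0 := hχ0 z
            have h1 := hχ1 z
            gcongr
        _ = t := by ring
    · have h1 : HasFDerivAt (phase φ) (ε⁻¹ • innerSL ℝ u) z := by
        have := ((innerSL ℝ u).hasFDerivAt (x := z)).const_mul ε⁻¹ |>.add_const φ
        refine this.congr_of_eventuallyEq (Eventually.of_forall fun y => ?_)
        simp [phase, div_eq_inv_mul]
      have h2 : HasFDerivAt χ (fderiv ℝ χ z) z :=
        (hχ.differentiable one_ne_zero z).hasFDerivAt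
      have h3 := ((h1.sin).const_mul (ε * t)).mul h2
      have h4 : ∇ (fun z => ε * t * Real.sin (phase φ z) * χ z) z
          = (t * Real.cos (phase φ z) * χ z) • u + (ε * t * Real.sin (phase φ z)) • ∇ χ z := by
        apply HasGradientAt.gradient
        rw [hasGradientAt_iff_hasFDerivAt]
        refine h3.congr_fderiv ?_
        ext v
        simp
        field_simp
        ring
      rw [h4, add_sub_cancel_left, norm_smul, Real.norm_eq_abs, abs_mul, abs_mul, abs_of_pos hε,
        abs_of_nonneg ht]
      have := Real.abs_sin_le_one (phase φ z)
      calc ε * t * |Real.sin (phase φ z)| * ‖∇ χ z‖ ≤ (η / C) * 1 * 1 * C := by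
            gcongr
            · exact min_le_right _ _
            · exact hχC z
        _ = η := by field_simp
    · rw [abs_mul, abs_mul, abs_mul, abs_of_nonneg ht, abs_of_nonneg (hχ0 z), abs_of_pos hε]
      have := Real.abs_sin_le_one (phase φ z)
      calc ε * t * |Real.sin (phase φ z)| * χ z ≤ η * 1 * 1 * 1 := by
            have h0 := hχ0 z
            have h1 := hχ1 z
            gcongr
            exact min_le_left _ _
        _ = η := by ring
  have hmeas : ∀ φ, Measurable fun z => ENNReal.ofReal ((t * Real.cos (phase φ z) * χ z) ^ 2) := by
    intro φ
    apply Measurable.ennreal_ofReal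
    exact (((continuous_const.mul (Real.continuous_cos.comp (hphase φ).continuous)).mul
        hχ.continuous).pow 2).measurable
  have hsum : ∫⁻ _ in ball x r, ENNReal.ofReal (t ^ 2) ≤
      16 * (∫⁻ z in ball x r, ENNReal.ofReal ((t * Real.cos (phase 0 z) * χ z) ^ 2)) +
      16 * ∫⁻ z in ball x r, ENNReal.ofReal ((t * Real.cos (phase (Real.pi / 2) z) * χ z) ^ 2) := by
    rw [← mul_add, ← lintegral_add_left (hmeas 0)]
    have h1 : ∫⁻ _ in ball x (r / 4), ENNReal.ofReal (t ^ 2) ≤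
        ∫⁻ z in ball x r, (ENNReal.ofReal ((t * Real.cos (phase 0 z) * χ z) ^ 2) +
          ENNReal.ofReal ((t * Real.cos (phase (Real.pi / 2) z) * χ z) ^ 2)) := by
      refine (setLIntegral_mono' measurableSet_ball fun z hz => ?_).trans
        (lintegral_mono_set (ball_subset_ball (by linarith)))
      rw [← ENNReal.ofReal_add (by positivity) (by positivity), hχin z hz]
      apply ENNReal.ofReal_le_ofReal
      simp only [phase, add_zero, Real.cos_add_pi_div_two]
      nlinarith [Real.sin_sq_add_cos_sq (inner ℝ u z / ε)]
    refine le_trans ?_ (mul_le_mul_right h1 16)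
    rw [setLIntegral_const, setLIntegral_const, EuclideanSpace.volume_ball,
      EuclideanSpace.volume_ball]
    have h2 : ENNReal.ofReal r ^ 2 = 16 * ENNReal.ofReal (r / 4) ^ 2 := by
      have : (16 : ENNReal) = ENNReal.ofReal 16 := by norm_num
      rw [this, ← ENNReal.ofReal_pow hr.le, ← ENNReal.ofReal_pow (by positivity),
        ← ENNReal.ofReal_mul (by norm_num)]
      congr 1; ring
    simp only [Fintype.card_fin]
    rw [h2]
    apply le_of_eq
    ring
  rcases le_total
    (∫⁻ z in ball x r, ENNReal.ofReal ((t * Real.cos (phase 0 z) * χ z) ^ 2))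
    (∫⁻ z in ball x r, ENNReal.ofReal ((t * Real.cos (phase (Real.pi / 2) z) * χ z) ^ 2))
    with h | h
  · refine key (Real.pi / 2) (hsum.trans ?_)
    calc _ ≤ _ := add_le_add_left (mul_le_mul_right h 16) _
      _ = _ := by rw [← add_mul]; norm_num
  · refine key 0 (hsum.trans ?_)
    calc _ ≤ _ := add_le_add_right (mul_le_mul_right h 16) _
      _ = _ := by rw [← add_mul]; norm_num

/-- A stage of the construction: a function together with a family of reference points, both
considered on an open set. -/
structure Stage where
  dom : Set Plane
  fn : Plane → ℝ
  ref : Plane → ℕ → Plane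

/-- The requirements on a stage: the function is a `C¹` strict subsolution on the domain, and the
reference points are locally constant there. -/
structure Stage.Admissible (S : Stage) (U : Set Plane) : Prop where
  isOpen : IsOpen S.dom
  subset : S.dom ⊆ U
  contDiffOn : ContDiffOn ℝ 1 S.fn S.dom
  norm_lt : ∀ y ∈ S.dom, ‖∇ S.fn y‖ < 1
  ref_eq : ∀ y ∈ S.dom, ∀ᶠ z in 𝓝 y, S.ref z = S.ref y
  ref_le : ∀ y ∈ S.dom, ∀ k, ‖S.ref y k‖ ≤ 1

/-- The largest move of the gradient allowed at step `n` when the gradient is close to `a`. -/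
noncomputable def stepSize (n : ℕ) (a : Plane) : ℝ := min (1 / √(n + 1)) ((1 - ‖a‖) / 4)

/-- The stage `S'` is obtained from `S` by adding a small function oscillating in direction `u`. -/
structure IsStep (n : ℕ) (κ : Plane → ℝ) (S S' : Stage) (a u : Plane → Plane) (s : Plane → ℝ) :
    Prop where
  dom_subset : S'.dom ⊆ S.dom
  null : volume (S.dom \ S'.dom) = 0
  eq_off : ∀ y ∉ S'.dom, S'.fn y = S.fn y
  close : ∀ y ∈ S'.dom, |S'.fn y - S.fn y| ≤ κ y / 2 / 2 ^ n
  close_dist : ∀ y, ∀ z ∉ S'.dom, |S'.fn y - S.fn y| ≤ dist y z ^ 2 / 2 / 2 ^ n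
  norm_le : ∀ y ∈ S'.dom, ‖a y‖ ≤ 1
  grad_old : ∀ y ∈ S'.dom, ‖∇ S.fn y - a y‖ ≤ (1 / 2) ^ n / 2
  grad_new : ∀ y ∈ S'.dom, ‖∇ S'.fn y - a y - s y • u y‖ ≤ (1 / 2) ^ n / 2
  norm_dir : ∀ y ∈ S'.dom, ‖u y‖ = 1
  ref_update : ∀ y ∈ S'.dom, S'.ref y = refUpdate (a y) (S.ref y)
  ortho : ∀ y ∈ S'.dom, inner ℝ (u y) (refPotGrad (S'.ref y) (a y)) = 0
  amp_le : ∀ y ∈ S'.dom, |s y| ≤ stepSize n (a y)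
  grad_eq : ∀ y ∈ S'.dom, ∀ᶠ z in 𝓝 y, a z = a y
  continuousOn : ContinuousOn s S'.dom
  energy : ∀ R : ℝ, ∫⁻ z in S'.dom ∩ ball 0 R, ENNReal.ofReal (stepSize n (a z) ^ 2) ≤
    32 * ∫⁻ z in S'.dom ∩ ball 0 (R + 2), ENNReal.ofReal (s z ^ 2)

theorem gradient_add {f g : Plane → ℝ} {x : Plane} (hf : DifferentiableAt ℝ f x)
    (hg : DifferentiableAt ℝ g x) : ∇ (fun z => f z + g z) x = ∇ f x + ∇ g x := by
  simp only [gradient]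
  rw [fderiv_fun_add hf hg, map_add]

theorem ContDiffOn.continuousOn_gradient {f : Plane → ℝ} {O : Set Plane} (hf : ContDiffOn ℝ 1 f O)
    (hO : IsOpen O) : ContinuousOn (∇ f) O :=
  (LinearIsometryEquiv.continuous _).comp_continuousOn
    (hf.continuousOn_fderiv_of_isOpen hO le_rfl)

theorem stepSize_nonneg (n : ℕ) {a : Plane} (ha : ‖a‖ ≤ 1) : 0 ≤ stepSize n a :=
  le_min (by positivity) (by linarith)

theorem stepSize_le_one (n : ℕ) (a : Plane) : stepSize n a ≤ 1 := by
  have := norm_nonneg a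
  exact (min_le_right _ _).trans (by linarith)

theorem Stage.Admissible.exists_step {U : Set Plane} {κ : Plane → ℝ} (hκ : ContinuousOn κ U)
    (hκ0 : ∀ x ∈ U, 0 < κ x) {S : Stage} (hS : S.Admissible U) (n : ℕ) :
    ∃ S' : Stage, S'.Admissible U ∧ ∃ a u s, IsStep n κ S S' a u s := by
  classical
  set a : Plane → Plane := ∇ S.fn with ha
  set β : Plane → ℕ → Plane := fun x => refUpdate (a x) (S.ref x) with hβ
  choose u hu hug using fun x => exists_unit_inner_eq_zero (refPotGrad (β x) (a x))
  have ha1 : ∀ x ∈ S.dom, 0 < 1 - ‖a x‖ := fun x hx => sub_pos.2 (hS.norm_lt x hx)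
  have hac := hS.contDiffOn.continuousOn_gradient hS.isOpen
  set η : Plane → ℝ := fun x => min ((1 / 2) ^ n / 4) ((1 - ‖a x‖) / 8) with hη
  have hη0 : ∀ x ∈ S.dom, 0 < η x := fun x hx =>
    lt_min (by positivity) (div_pos (ha1 x hx) (by norm_num))
  have hR : ∀ x ∈ S.dom, ∃ R > 0, R ≤ 1 ∧ ∀ z ∈ ball x R, S.ref z = S.ref x ∧
      ‖a z - a x‖ ≤ η x ∧ κ x / 2 ≤ κ z := by
    intro x hx
    have hnx := hS.isOpen.mem_nhds hx
    have e1 : ∀ᶠ z in 𝓝 x, ‖a z - a x‖ < η x := by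
      have h2 : Tendsto (fun z => ‖a z - a x‖) (𝓝 x) (𝓝 0) :=
        tendsto_iff_norm_sub_tendsto_zero.1 (hac.continuousAt hnx)
      exact h2.eventually_lt_const (hη0 x hx)
    have e2 : ∀ᶠ z in 𝓝 x, κ x / 2 < κ z := by
      have hU := mem_of_superset hnx hS.subset
      have h1 : Tendsto κ (𝓝 x) (𝓝 (κ x)) := hκ.continuousAt hU
      exact h1.eventually_const_lt (half_lt_self (hκ0 x (hS.subset hx)))
    obtain ⟨R, hR, h⟩ := Metric.eventually_nhds_iff_ball.1 ((hS.ref_eq x hx).and (e1.and e2))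
    refine ⟨min R 1, lt_min hR one_pos, min_le_right _ _, fun z hz => ?_⟩
    obtain ⟨h1, h2, h3⟩ := h z (ball_subset_ball (min_le_left _ _) hz)
    exact ⟨h1, h2.le, h3.le⟩
  choose! R hR0 hR1 hRz using hR
  obtain ⟨T, r, hTc, hTO, hr, hrO, hnull, hdisj⟩ := exists_ball_decomposition hS.isOpen hR0
  set O' : Set Plane := ⋃ x ∈ T, ball x (r x) with hO'
  have hO'open : IsOpen O' := isOpen_biUnion fun _ _ => isOpen_ball
  set ω : Plane → ℝ := fun x => min (η x) (min (κ x / 2 / 2 / 2 ^ n) ((r x / 2) ^ 2 / 2 / 2 ^ n))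
    with hω
  have hω0 : ∀ x ∈ T, 0 < ω x := fun x hx => by
    have h1 := hκ0 x (hS.subset (hTO hx))
    have h2 := (hr x hx).1
    exact lt_min (hη0 x (hTO hx)) (lt_min (by positivity) (by positivity))
  have hosc : ∀ x ∈ T, _ := fun x hx => exists_oscillation x (u x) (hr x hx).1
    (stepSize_nonneg n (sub_nonneg.1 (ha1 x (hTO hx)).le)) (stepSize_le_one n _) (hω0 x hx)
  choose! h σ hh hσ hσt hgrad hsmall hzero henergy using hosc
  have hcex : ∀ y ∈ O', ∃ x ∈ T, y ∈ ball x (r x) := fun y hy => by simpa [hO'] using hy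
  choose! c hcT hcb using hcex
  have hc : ∀ x ∈ T, ∀ y ∈ ball x (r x), c y = x := by
    intro x hx y hy
    have hyO : y ∈ O' := mem_biUnion hx hy
    by_contra hne
    exact (disjoint_left.1 (hdisj (hcT y hyO) hx hne)) (hcb y hyO) hy
  have hcnhds : ∀ y ∈ O', ∀ᶠ z in 𝓝 y, z ∈ O' ∧ c z = c y := by
    intro y hy
    filter_upwards [isOpen_ball.mem_nhds (hcb y hy)] with z hz
    exact ⟨mem_biUnion (hcT y hy) hz, hc _ (hcT y hy) z hz⟩
  set f' : Plane → ℝ := fun y => if y ∈ O' then S.fn y + h (c y) y else S.fn y with hf'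
  have hO'O : O' ⊆ S.dom := iUnion₂_subset hrO
  have hf'ev : ∀ y ∈ O', f' =ᶠ[𝓝 y] fun z => S.fn z + h (c y) z := by
    intro y hy
    filter_upwards [hcnhds y hy] with z hz
    simp only [hf', if_pos hz.1, hz.2]
  have hSd : ∀ y ∈ O', DifferentiableAt ℝ S.fn y := fun y hy =>
    (hS.contDiffOn.differentiableOn one_ne_zero).differentiableAt (hS.isOpen.mem_nhds (hO'O hy))
  have hgf' : ∀ y ∈ O', ∇ f' y = ∇ S.fn y + ∇ (h (c y)) y := by
    intro y hy
    rw [(hf'ev y hy).gradient_eq]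
    exact gradient_add (hSd y hy) ((hh _ (hcT y hy)).differentiable one_ne_zero y)
  have hcR : ∀ y ∈ O', S.ref y = S.ref (c y) ∧ ‖a y - a (c y)‖ ≤ η (c y) ∧ κ (c y) / 2 ≤ κ y :=
    fun y hy => hRz _ (hTO (hcT y hy)) y (ball_subset_ball (hr _ (hcT y hy)).2.le (hcb y hy))
  have hdiff : ∀ y ∈ O', f' y - S.fn y = h (c y) y := fun y hy => by
    simp only [hf', if_pos hy]; ring
  have hoff : ∀ y ∉ O', f' y = S.fn y := fun y hy => by simp only [hf', if_neg hy]
  refine ⟨⟨O', f', fun y => β (c y)⟩, ⟨hO'open, hO'O.trans hS.subset, ?_, ?_, ?_, ?_⟩,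
    fun y => a (c y), fun y => u (c y), fun y => σ (c y) y,
    ⟨hO'O, hnull, hoff, ?_, ?_, ?_, ?_, ?_, ?_, ?_, ?_, ?_, ?_, ?_, ?_⟩⟩
  · intro y hy
    have : ContDiffAt ℝ 1 (fun z => S.fn z + h (c y) z) y :=
      (hS.contDiffOn.contDiffAt (hS.isOpen.mem_nhds (hO'O hy))).add (hh _ (hcT y hy)).contDiffAt
    exact (this.congr_of_eventuallyEq (hf'ev y hy)).contDiffWithinAt
  · intro y hy
    change ‖∇ f' y‖ < 1
    have h1 := (hcR y hy).2.1
    have h2 := hgrad _ (hcT y hy) y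
    have h3 := hσt _ (hcT y hy) y
    have h4 : ω (c y) ≤ (1 - ‖a (c y)‖) / 8 := (min_le_left _ _).trans (min_le_right _ _)
    have h5 : η (c y) ≤ (1 - ‖a (c y)‖) / 8 := min_le_right _ _
    have h6 : stepSize n (a (c y)) ≤ (1 - ‖a (c y)‖) / 4 := min_le_right _ _
    have h7 := ha1 _ (hTO (hcT y hy))
    have h8 : ∇ f' y = (a y - a (c y)) + (∇ (h (c y)) y - σ (c y) y • u (c y))
        + σ (c y) y • u (c y) + a (c y) := by
      rw [hgf' y hy]; simp only [ha]; abel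
    have h9 : ‖σ (c y) y • u (c y)‖ ≤ stepSize n (a (c y)) := by
      rw [norm_smul, hu, mul_one]; exact h3
    rw [h8]
    refine (norm_add_le _ _).trans_lt ?_
    have h10 := norm_add₃_le (a := a y - a (c y)) (b := ∇ (h (c y)) y - σ (c y) y • u (c y))
      (c := σ (c y) y • u (c y))
    linarith
  · intro y hy
    filter_upwards [hcnhds y hy] with z hz
    simp only [hz.2]
  · intro y hy k
    have h0 := hTO (hcT y hy)
    exact norm_refUpdate_le (hS.norm_lt _ h0).le (hS.ref_le _ h0) k
  · intro y hy
    change |f' y - S.fn y| ≤ _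
    rw [hdiff y hy]
    refine (hsmall _ (hcT y hy) y).trans (((min_le_right _ _).trans (min_le_left _ _)).trans ?_)
    have := (hcR y hy).2.2
    gcongr
  · intro y z hz
    change |f' y - S.fn y| ≤ _
    by_cases hy : y ∈ O'
    · rw [hdiff y hy]
      rcases le_or_gt (r (c y) / 2) (dist y (c y)) with hd | hd
      · rw [hzero _ (hcT y hy) y hd, abs_zero]; positivity
      · refine (hsmall _ (hcT y hy) y).trans
          (((min_le_right _ _).trans (min_le_right _ _)).trans ?_)
        have h1 : r (c y) ≤ dist z (c y) := by
          by_contra hlt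
          exact hz (mem_biUnion (hcT y hy) (mem_ball.2 (not_le.1 hlt)))
        have h2 : r (c y) / 2 ≤ dist y z := by
          have := dist_triangle z y (c y)
          rw [dist_comm z y] at this
          linarith
        have := (hr _ (hcT y hy)).1
        gcongr
    · rw [hoff y hy, sub_self, abs_zero]; positivity
  · exact fun y hy => (hS.norm_lt _ (hTO (hcT y hy))).le
  · intro y hy
    refine ((hcR y hy).2.1.trans (min_le_left _ _)).trans ?_
    gcongr
    norm_num
  · intro y hy
    change ‖∇ f' y - a (c y) - σ (c y) y • u (c y)‖ ≤ _
    have h1 := (hcR y hy).2.1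
    have h2 := hgrad _ (hcT y hy) y
    have h4 : ω (c y) ≤ (1 / 2) ^ n / 4 := (min_le_left _ _).trans (min_le_left _ _)
    have h5 : η (c y) ≤ (1 / 2) ^ n / 4 := min_le_left _ _
    have h8 : ∇ f' y - a (c y) - σ (c y) y • u (c y) =
        (a y - a (c y)) + (∇ (h (c y)) y - σ (c y) y • u (c y)) := by
      rw [hgf' y hy]; simp only [ha]; abel
    rw [h8]
    refine (norm_add_le _ _).trans ?_
    linarith
  · exact fun y _ => hu _
  · intro y hy
    simp only [hβ, (hcR y hy).1]
  · exact fun y _ => hug _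
  · exact fun y hy => hσt _ (hcT y hy) y
  · intro y hy
    filter_upwards [hcnhds y hy] with z hz
    simp only [hz.2]
  · intro y hy
    have : ContinuousAt (fun z => σ (c z) z) y := by
      refine ((hσ _ (hcT y hy)).continuousAt).congr ?_
      filter_upwards [hcnhds y hy] with z hz
      simp only [hz.2]
    exact this.continuousWithinAt
  · intro ρ
    set T' : Set Plane := {x ∈ T | (ball x (r x) ∩ ball 0 ρ).Nonempty} with hT'
    have hT'T : T' ⊆ T := fun x hx => hx.1
    set G : Set Plane := ⋃ x ∈ T', ball x (r x) with hG
    have h1 : O' ∩ ball 0 ρ ⊆ G := by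
      rintro y ⟨hy, hyρ⟩
      exact mem_biUnion (show c y ∈ T' from ⟨hcT y hy, y, hcb y hy, hyρ⟩) (hcb y hy)
    have h2 : G ⊆ O' ∩ ball 0 (ρ + 2) := by
      intro y hy
      obtain ⟨x, hx, hyx⟩ := mem_iUnion₂.1 hy
      refine ⟨mem_biUnion (hT'T hx) hyx, ?_⟩
      obtain ⟨z, hzx, hzρ⟩ := hx.2
      have h3 := hR1 x (hTO hx.1)
      have h4 := (hr x hx.1).2
      rw [mem_ball] at *
      have h5 := dist_triangle4_right y z x 0
      have h6 := dist_triangle y x 0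
      have h7 := dist_triangle x z 0
      rw [dist_comm x z] at h7
      linarith
    have hm : ∀ x ∈ T', MeasurableSet (ball x (r x)) := fun _ _ => measurableSet_ball
    calc ∫⁻ z in O' ∩ ball 0 ρ, ENNReal.ofReal (stepSize n (a (c z)) ^ 2)
        ≤ ∫⁻ z in G, ENNReal.ofReal (stepSize n (a (c z)) ^ 2) := lintegral_mono_set h1
      _ = ∑' x : T', ∫⁻ z in ball (x : Plane) (r x), ENNReal.ofReal (stepSize n (a (c z)) ^ 2) :=
          lintegral_biUnion (hTc.mono hT'T) hm (hdisj.subset hT'T) _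
      _ ≤ ∑' x : T', 32 * ∫⁻ z in ball (x : Plane) (r x), ENNReal.ofReal (σ (c z) z ^ 2) := by
          refine ENNReal.tsum_le_tsum fun x => ?_
          have hx := hT'T x.2
          have e1 : ∫⁻ z in ball (x : Plane) (r x), ENNReal.ofReal (stepSize n (a (c z)) ^ 2) =
              ∫⁻ _ in ball (x : Plane) (r x), ENNReal.ofReal (stepSize n (a x) ^ 2) :=
            setLIntegral_congr_fun measurableSet_ball fun z hz => by simp only [hc _ hx z hz]
          have e2 : ∫⁻ z in ball (x : Plane) (r x), ENNReal.ofReal (σ (c z) z ^ 2) =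
              ∫⁻ z in ball (x : Plane) (r x), ENNReal.ofReal (σ x z ^ 2) :=
            setLIntegral_congr_fun measurableSet_ball fun z hz => by simp only [hc _ hx z hz]
          rw [e1, e2]
          exact henergy _ hx
      _ = 32 * ∫⁻ z in G, ENNReal.ofReal (σ (c z) z ^ 2) := by
          rw [ENNReal.tsum_mul_left, lintegral_biUnion (hTc.mono hT'T) hm (hdisj.subset hT'T)]
      _ ≤ _ := mul_le_mul_right (lintegral_mono_set h2) _

/-- An infinite sequence of construction steps. -/
structure IsStepSequence (U : Set Plane) (κ : Plane → ℝ) (S : ℕ → Stage) (a u : ℕ → Plane → Plane)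
    (s : ℕ → Plane → ℝ) : Prop where
  admissible : ∀ n, (S n).Admissible U
  isStep : ∀ n, IsStep n κ (S n) (S (n + 1)) (a n) (u n) (s n)

theorem Stage.Admissible.exists_isStepSequence {U : Set Plane} {κ : Plane → ℝ}
    (hκ : ContinuousOn κ U) (hκ0 : ∀ x ∈ U, 0 < κ x) {S₀ : Stage} (hS₀ : S₀.Admissible U) :
    ∃ S a u s, S 0 = S₀ ∧ IsStepSequence U κ S a u s := by
  choose next hnext a u s hstep using
    fun (T : {S : Stage // S.Admissible U}) (n : ℕ) => T.2.exists_step hκ hκ0 n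
  let T : ℕ → {S : Stage // S.Admissible U} :=
    fun n => Nat.rec ⟨S₀, hS₀⟩ (fun n T => ⟨next T n, hnext T n⟩) n
  exact ⟨fun n => (T n).1, fun n => a (T n) n, fun n => u (T n) n, fun n => s (T n) n, rfl,
    fun n => (T n).2, fun n => hstep (T n) n⟩

theorem HasGradientAt.of_abs_sub_le_sq {f g : Plane → ℝ} {l y : Plane} {C : ℝ}
    (hf : HasGradientAt f l y) (h : ∀ᶠ z in 𝓝 y, |g z - f z| ≤ C * dist z y ^ 2) :
    HasGradientAt g l y := by
  have h1 : HasFDerivAt (fun z => g z - f z) (0 : Plane →L[ℝ] ℝ) y := by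
    have hO : (fun z => g z - f z) =O[𝓝 y] fun z => ‖z - y‖ ^ 2 := by
      refine Asymptotics.IsBigO.of_bound C ?_
      filter_upwards [h] with z hz
      simpa [dist_eq_norm] using hz
    exact hO.hasFDerivAt one_lt_two
  rw [hasGradientAt_iff_hasFDerivAt] at hf ⊢
  simpa using h1.fun_add hf

theorem hasGradientAt_of_forall_pos {g : Plane → ℝ} {l y : Plane}
    (h : ∀ ε > 0, ∀ᶠ z in 𝓝 y, |g z - g y - inner ℝ l (z - y)| ≤ ε * dist z y) :
    HasGradientAt g l y := by
  rw [hasGradientAt_iff_isLittleO, Asymptotics.isLittleO_iff]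
  intro ε hε
  filter_upwards [h ε hε] with z hz
  simpa [dist_eq_norm] using hz

theorem IsPreconnected.eq_of_eventually_eq {α β : Type*} [TopologicalSpace α] {f : α → β}
    {t : Set α} (ht : IsPreconnected t) (h : ∀ x ∈ t, ∀ᶠ z in 𝓝 x, f z = f x) {x y : α}
    (hx : x ∈ t) (hy : y ∈ t) : f x = f y := by
  let _ : TopologicalSpace β := ⊥
  have : DiscreteTopology β := ⟨rfl⟩
  refine ht.constant (fun z hz => ?_) hx hy
  have h1 : ContinuousAt f z := tendsto_nhds_of_eventually_eq (h z hz)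
  exact h1.continuousWithinAt

theorem abs_sub_sub_inner_le {f : Plane → ℝ} {O : Set Plane} (hO : IsOpen O)
    (hf : ContDiffOn ℝ 1 f O) {y z b : Plane} {r C : ℝ} (hr : closedBall y r ⊆ O)
    (hz : z ∈ closedBall y r) (hC : ∀ x ∈ closedBall y r, ‖∇ f x - b‖ ≤ C) :
    |f z - f y - inner ℝ b (z - y)| ≤ C * dist z y := by
  have h := (convex_closedBall y r).norm_image_sub_le_of_norm_hasFDerivWithin_le' (f := f)
    (f' := fderiv ℝ f) (φ := toDual ℝ Plane b) (C := C) (x := y) (y := z)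
    (fun x hx => (((hf.differentiableOn one_ne_zero).differentiableAt
      (hO.mem_nhds (hr hx))).hasFDerivAt).hasFDerivWithinAt) (fun x hx => ?_)
    (mem_closedBall_self (dist_nonneg.trans hz)) hz
  · simpa [dist_eq_norm] using h
  · have h1 : fderiv ℝ f x - toDual ℝ Plane b = toDual ℝ Plane (∇ f x - b) := by
      rw [map_sub, gradient, LinearIsometryEquiv.apply_symm_apply]
    rw [h1, LinearIsometryEquiv.norm_map]
    exact hC x hx

namespace IsStepSequence

variable {U : Set Plane} {κ : Plane → ℝ} {S : ℕ → Stage} {a u : ℕ → Plane → Plane}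
  {s : ℕ → Plane → ℝ}

theorem dom_anti (h : IsStepSequence U κ S a u s) : Antitone fun n => (S n).dom :=
  antitone_nat_of_succ_le fun n => (h.isStep n).dom_subset

theorem dist_fn_le (h : IsStepSequence U κ S a u s) (hκ0 : ∀ x ∈ U, 0 < κ x) {y : Plane}
    (hy : y ∈ U) (n : ℕ) : dist ((S n).fn y) ((S (n + 1)).fn y) ≤ κ y / 2 / 2 ^ n := by
  rw [dist_comm, Real.dist_eq]
  by_cases hyn : y ∈ (S (n + 1)).dom
  · exact (h.isStep n).close y hyn
  · rw [(h.isStep n).eq_off y hyn, sub_self, abs_zero]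
    have := hκ0 y hy
    positivity

theorem fn_eq (h : IsStepSequence U κ S a u s) {y : Plane} {m n : ℕ} (hy : y ∉ (S m).dom)
    (hmn : m ≤ n) : (S n).fn y = (S m).fn y := by
  induction n, hmn using Nat.le_induction with
  | base => rfl
  | succ n hmn ih =>
    rw [(h.isStep n).eq_off y fun h' => hy (h.dom_anti (hmn.trans n.le_succ) h'), ih]

theorem exists_tendsto (h : IsStepSequence U κ S a u s) (hκ0 : ∀ x ∈ U, 0 < κ x) :
    ∃ w : Plane → ℝ, ∀ y, Tendsto (fun n => (S n).fn y) atTop (𝓝 (w y)) := by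
  refine ⟨fun y => limUnder atTop fun n => (S n).fn y, fun y => ?_⟩
  refine CauchySeq.tendsto_limUnder ?_
  by_cases hy : y ∈ U
  · exact cauchySeq_of_le_geometric_two (C := κ y) (h.dist_fn_le hκ0 hy)
  · have : (fun n => (S n).fn y) = fun _ => (S 0).fn y := by
      funext n
      exact h.fn_eq (fun h' => hy ((h.admissible 0).subset h')) n.zero_le
    rw [this]
    exact cauchySeq_const _

section Limit

variable {w : Plane → ℝ}

theorem abs_lim_sub_le (hw : ∀ y, Tendsto (fun n => (S n).fn y) atTop (𝓝 (w y)))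
    (h : IsStepSequence U κ S a u s) (hκ0 : ∀ x ∈ U, 0 < κ x) {y : Plane}
    (hy : y ∈ U) : |w y - (S 0).fn y| ≤ κ y := by
  rw [← Real.dist_eq, dist_comm]
  exact dist_le_of_le_geometric_two_of_tendsto₀ (h.dist_fn_le hκ0 hy) (hw y)

theorem lim_eq (hw : ∀ y, Tendsto (fun n => (S n).fn y) atTop (𝓝 (w y)))
    (h : IsStepSequence U κ S a u s) {y : Plane} {n : ℕ} (hy : y ∉ (S n).dom) :
    w y = (S n).fn y := by
  refine tendsto_nhds_unique (hw y) (tendsto_const_nhds.congr' ?_)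
  filter_upwards [eventually_ge_atTop n] with m hm
  exact (h.fn_eq hy hm).symm

theorem abs_lim_sub_le_sq (hw : ∀ y, Tendsto (fun n => (S n).fn y) atTop (𝓝 (w y)))
    (h : IsStepSequence U κ S a u s) (y : Plane) {p : Plane} {n : ℕ}
    (hp : p ∉ (S (n + 1)).dom) : |w y - (S n).fn y| ≤ dist y p ^ 2 := by
  rw [← Real.dist_eq, dist_comm]
  refine dist_le_of_le_geometric_two_of_tendsto₀ (f := fun k => (S (k + n)).fn y) (fun k => ?_)
    ((tendsto_add_atTop_iff_nat n).2 (hw y)) |>.trans_eq' (by simp)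
  have h1 := (h.isStep (k + n)).close_dist y p fun h' => hp (h.dom_anti (by lia) h')
  rw [dist_comm, Real.dist_eq]
  rw [show k + 1 + n = k + n + 1 by ring]
  refine h1.trans ?_
  gcongr
  · norm_num
  · lia

theorem hasGradientAt_of_notMem (hw : ∀ y, Tendsto (fun n => (S n).fn y) atTop (𝓝 (w y)))
    (h : IsStepSequence U κ S a u s) {y : Plane} {n : ℕ}
    (hy : y ∈ (S n).dom) (hy' : y ∉ (S (n + 1)).dom) : HasGradientAt w (∇ (S n).fn y) y := by
  have hd : DifferentiableAt ℝ (S n).fn y :=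
    ((h.admissible n).contDiffOn.differentiableOn one_ne_zero).differentiableAt
      ((h.admissible n).isOpen.mem_nhds hy)
  refine hd.hasGradientAt.of_abs_sub_le_sq (C := 1) (Eventually.of_forall fun z => ?_)
  rw [one_mul]
  exact h.abs_lim_sub_le_sq hw z hy'

end Limit

theorem game (h : IsStepSequence U κ S a u s) {y : Plane} (hy : ∀ n, y ∈ (S n).dom) :
    (∀ N, ∑ n ∈ Finset.range N, s n y ^ 2 ≤ 52) ∧
      ∃ l, Tendsto (fun n => a n y) atTop (𝓝 l) := by
  refine refPot_game (u := fun n => u n y) (b := fun n => (S n).ref y)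
    (fun n => (h.isStep n).norm_le y (hy _)) ((h.admissible 0).ref_le y (hy 0))
    (fun n => (h.isStep n).ref_update y (hy _)) (fun n => (h.isStep n).norm_dir y (hy _))
    (fun n => (h.isStep n).ortho y (hy _)) fun n => ?_
  have h1 := (h.isStep n).grad_new y (hy _)
  have h2 := (h.isStep (n + 1)).grad_old y (hy _)
  have h3 : a (n + 1) y - a n y - s n y • u n y =
      (∇ (S (n + 1)).fn y - a n y - s n y • u n y) - (∇ (S (n + 1)).fn y - a (n + 1) y) := by abel
  rw [h3]
  refine (norm_sub_le _ _).trans ?_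
  rw [pow_succ] at h2
  have : (0 : ℝ) < (1 / 2) ^ n := by positivity
  linarith

theorem eq_of_closedBall_subset (h : IsStepSequence U κ S a u s) {n : ℕ} {y z : Plane} {r : ℝ}
    (hr : closedBall y r ⊆ (S (n + 1)).dom) (hz : z ∈ closedBall y r) : a n z = a n y := by
  exact (convex_closedBall y r).isPreconnected.eq_of_eventually_eq
    (fun x hx => (h.isStep n).grad_eq x (hr hx)) hz (mem_closedBall_self (dist_nonneg.trans hz))

theorem abs_fn_sub_le (h : IsStepSequence U κ S a u s) {n : ℕ} {y z : Plane}
    (hr : closedBall y (dist z y) ⊆ (S (n + 1)).dom) :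
    |(S (n + 1)).fn z - (S (n + 1)).fn y - inner ℝ (a n y) (z - y)| ≤
      (1 / √(n + 1) + (1 / 2) ^ n / 2) * dist z y := by
  refine abs_sub_sub_inner_le (h.admissible (n + 1)).isOpen (h.admissible (n + 1)).contDiffOn hr
    (mem_closedBall.2 le_rfl) fun x hx => ?_
  have h1 := (h.isStep n).grad_new x (hr hx)
  have h2 := ((h.isStep n).amp_le x (hr hx)).trans (min_le_left _ _)
  have h3 := (h.isStep n).norm_dir x (hr hx)
  rw [h.eq_of_closedBall_subset hr hx] at h1
  have h4 : ∇ (S (n + 1)).fn x - a n y =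
      s n x • u n x + (∇ (S (n + 1)).fn x - a n y - s n x • u n x) := by abel
  rw [h4]
  refine (norm_add_le _ _).trans (add_le_add ?_ h1)
  rwa [norm_smul, h3, mul_one]

theorem hasGradientAt_of_forall_mem (h : IsStepSequence U κ S a u s) {w : Plane → ℝ}
    (hw : ∀ y, Tendsto (fun n => (S n).fn y) atTop (𝓝 (w y))) {y l : Plane}
    (hy : ∀ n, y ∈ (S n).dom) (hl : Tendsto (fun n => a n y) atTop (𝓝 l)) :
    HasGradientAt w l y := by
  refine hasGradientAt_of_forall_pos fun ε hε => ?_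
  have ht : Tendsto (fun n : ℕ => 1 / √((n : ℝ) + 1) + (1 / 2 : ℝ) ^ n / 2) atTop
      (𝓝 (0 + 0 / 2)) := by
    refine Tendsto.add ?_
      ((tendsto_pow_atTop_nhds_zero_of_lt_one (by norm_num) (by norm_num)).div_const _)
    simp only [one_div]
    exact (Real.tendsto_sqrt_atTop.comp
      (tendsto_atTop_add_const_right _ 1 tendsto_natCast_atTop_atTop)).inv_tendsto_atTop
  have h1 := ht.eventually_lt_const (u := ε / 4) (by linarith)
  have h2 := (tendsto_iff_norm_sub_tendsto_zero.1 hl).eventually_lt_const (u := ε / 4) (by linarith)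
  obtain ⟨N, hN⟩ := eventually_atTop.1 (h1.and h2)
  have hmain : ∀ z, ∀ n ≥ N, closedBall y (dist z y) ⊆ (S (n + 1)).dom →
      |(S (n + 1)).fn z - (S (n + 1)).fn y - inner ℝ l (z - y)| ≤ ε / 2 * dist z y := by
    intro z n hn hr
    have h3 := h.abs_fn_sub_le hr
    obtain ⟨h4, h5⟩ := hN n hn
    have h6 : |inner ℝ (a n y - l) (z - y)| ≤ ε / 4 * dist z y := by
      refine (abs_real_inner_le_norm _ _).trans ?_
      rw [dist_eq_norm]
      gcongr
    rw [inner_sub_left] at h6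
    have h7 : (1 / √((n : ℝ) + 1) + (1 / 2 : ℝ) ^ n / 2) * dist z y ≤ ε / 4 * dist z y := by
      gcongr
    rw [abs_le] at *
    constructor <;> linarith [h3.1, h3.2, h6.1, h6.2]
  obtain ⟨ρ, hρ, hball⟩ := Metric.isOpen_iff.1 (h.admissible (N + 1)).isOpen y (hy _)
  filter_upwards [ball_mem_nhds y (lt_min hρ (show 0 < ε / 10 by linarith))] with z hz
  have hzρ : dist z y < ρ := (mem_ball.1 hz).trans_le (min_le_left _ _)
  have hzε : dist z y < ε / 10 := (mem_ball.1 hz).trans_le (min_le_right _ _)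
  by_cases hall : ∀ n, closedBall y (dist z y) ⊆ (S n).dom
  · have h3 : Tendsto (fun n => |(S (n + 1)).fn z - (S (n + 1)).fn y - inner ℝ l (z - y)|) atTop
        (𝓝 |w z - w y - inner ℝ l (z - y)|) :=
      ((((tendsto_add_atTop_iff_nat 1).2 (hw z)).sub
        ((tendsto_add_atTop_iff_nat 1).2 (hw y))).sub_const _).abs
    refine (le_of_tendsto h3 (eventually_atTop.2 ⟨N, fun n hn => hmain z n hn (hall _)⟩)).trans ?_
    gcongr
    linarith
  · classical
    push Not at hall
    obtain ⟨k, hk, hmin⟩ := Nat.findX hall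
    have hk2 : N + 1 < k := by
      by_contra! hlt
      exact hk (((closedBall_subset_ball hzρ).trans hball).trans (h.dom_anti hlt))
    obtain ⟨n, rfl⟩ : ∃ n, k = n + 1 + 1 := ⟨k - 2, by lia⟩
    have h3 := hmain z n (by lia) (not_not.1 (hmin (n + 1) (by lia)))
    obtain ⟨p, hpb, hp⟩ := not_subset.1 hk
    have h4 := h.abs_lim_sub_le_sq hw z hp
    have h5 := h.abs_lim_sub_le_sq hw y hp
    have h6 : dist z p ≤ 2 * dist z y := by
      have := dist_triangle_right z p y
      rw [mem_closedBall] at hpb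
      linarith
    have h7 : dist y p ≤ dist z y := by rwa [mem_closedBall, dist_comm] at hpb
    have h8 : dist z p ^ 2 ≤ (2 * dist z y) ^ 2 := by gcongr
    have h9 : dist y p ^ 2 ≤ dist z y ^ 2 := by gcongr
    have h10 := dist_nonneg (x := z) (y := y)
    have h11 : 5 * dist z y ^ 2 ≤ ε / 2 * dist z y := by nlinarith
    rw [abs_le] at *
    constructor <;> nlinarith [h3.1, h3.2, h4.1, h4.2, h5.1, h5.2]

end IsStepSequence

theorem summable_of_tsum_ofReal_ne_top {f : ℕ → ℝ} (hf : ∀ n, 0 ≤ f n)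
    (h : ∑' n, ENNReal.ofReal (f n) ≠ ⊤) : Summable f := by
  have h1 := ENNReal.summable_toReal h
  simpa [ENNReal.toReal_ofReal (hf _)] using h1

theorem norm_lim_eq_one {a : ℕ → Plane} {l : Plane} (ha : ∀ n, ‖a n‖ ≤ 1)
    (hl : Tendsto a atTop (𝓝 l)) (h : Summable fun n => stepSize n (a n) ^ 2) : ‖l‖ = 1 := by
  refine le_antisymm (le_of_tendsto' hl.norm ha) (not_lt.1 fun hlt => ?_)
  have h1 : Tendsto (fun n => (1 - ‖a n‖) / 4) atTop (𝓝 ((1 - ‖l‖) / 4)) :=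
    (hl.norm.const_sub 1).div_const 4
  have h2 : Tendsto (fun n : ℕ => 1 / √((n : ℝ) + 1)) atTop (𝓝 0) := by
    simp only [one_div]
    exact (Real.tendsto_sqrt_atTop.comp
      (tendsto_atTop_add_const_right _ 1 tendsto_natCast_atTop_atTop)).inv_tendsto_atTop
  have hev := h2.eventually_lt h1 (by linarith)
  have h3 : Summable fun n : ℕ => 1 / ((n : ℝ) + 1) := by
    refine (summable_congr_atTop ?_).1 h
    filter_upwards [hev] with n hn
    rw [stepSize, min_eq_left hn.le, div_pow, one_pow, Real.sq_sqrt (by positivity)]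
  have h4 := (summable_nat_add_iff (f := fun n : ℕ => 1 / (n : ℝ)) 1).1 (by simpa using h3)
  exact Real.not_summable_one_div_natCast h4

namespace IsStepSequence

variable {U : Set Plane} {κ : Plane → ℝ} {S : ℕ → Stage} {a u : ℕ → Plane → Plane}
  {s : ℕ → Plane → ℝ}

theorem volume_diff (h : IsStepSequence U κ S a u s) (m : ℕ) :
    volume ((S m).dom \ ⋂ n, (S n).dom) = 0 := by
  have h1 : (S m).dom \ ⋂ n, (S n).dom ⊆ ⋃ n, (S n).dom \ (S (n + 1)).dom := by
    rintro y ⟨hy, hy'⟩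
    classical
    simp only [mem_iInter, not_forall] at hy'
    obtain ⟨k, hk, hmin⟩ := Nat.findX hy'
    have hmk : m < k := by
      by_contra! hlt
      exact hk (h.dom_anti hlt hy)
    obtain ⟨n, rfl⟩ : ∃ n, k = n + 1 := ⟨k - 1, by lia⟩
    exact mem_iUnion.2 ⟨n, not_not.1 (hmin n n.lt_succ_self), hk⟩
  exact measure_mono_null h1 (measure_iUnion_null fun n => (h.isStep n).null)

theorem ae_summable (h : IsStepSequence U κ S a u s) (R : ℝ) :
    ∀ᵐ y ∂volume.restrict ((⋂ n, (S n).dom) ∩ ball 0 R),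
      Summable fun n => stepSize n (a n y) ^ 2 := by
  set O : Set Plane := ⋂ n, (S n).dom with hO
  have hOm : MeasurableSet O := MeasurableSet.iInter fun n => (h.admissible n).isOpen.measurableSet
  have hOn : ∀ n, O ⊆ (S n).dom := fun n => iInter_subset _ n
  have hae : ∀ n ρ, (((S n).dom ∩ ball 0 ρ : Set Plane)) =ᵐ[volume]
      ((O ∩ ball 0 ρ : Set Plane)) := by
    intro n ρ
    refine EventuallyEq.inter ?_ EventuallyEq.rfl
    exact (ae_le_set.2 (h.volume_diff n)).antisymm (LE.le.eventuallyLE (hOn n))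
  have hac : ∀ n, ContinuousOn (a n) (S (n + 1)).dom := fun n y hy =>
    ContinuousAt.continuousWithinAt (tendsto_nhds_of_eventually_eq ((h.isStep n).grad_eq y hy))
  have hstep : ∀ n, ContinuousOn (fun y => stepSize n (a n y)) (S (n + 1)).dom := fun n =>
    continuousOn_const.inf ((continuousOn_const.sub (hac n).norm).div_const 4)
  have hmeas : ∀ ρ n (g : Plane → ℝ), ContinuousOn g (S (n + 1)).dom →
      AEMeasurable (fun y => ENNReal.ofReal (g y ^ 2)) (volume.restrict (O ∩ ball 0 ρ)) := by
    intro ρ n g hg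
    exact (((hg.mono (inter_subset_left.trans (hOn (n + 1)))).pow 2).aemeasurable
      (hOm.inter measurableSet_ball)).ennreal_ofReal
  have hfin : ∫⁻ y in O ∩ ball 0 R, ∑' n, ENNReal.ofReal (stepSize n (a n y) ^ 2) ≠ ⊤ := by
    rw [lintegral_tsum fun n => hmeas R n _ (hstep n)]
    refine ne_top_of_le_ne_top (b := 32 * (52 * volume (O ∩ ball (0 : Plane) (R + 2)))) ?_ ?_
    · refine ENNReal.mul_ne_top (by norm_num) (ENNReal.mul_ne_top (by norm_num) ?_)
      exact ((measure_mono inter_subset_right).trans_lt measure_ball_lt_top).ne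
    calc ∑' n, ∫⁻ y in O ∩ ball 0 R, ENNReal.ofReal (stepSize n (a n y) ^ 2)
        ≤ ∑' n, 32 * ∫⁻ y in O ∩ ball 0 (R + 2), ENNReal.ofReal (s n y ^ 2) := by
          refine ENNReal.tsum_le_tsum fun n => ?_
          rw [← setLIntegral_congr (hae (n + 1) R), ← setLIntegral_congr (hae (n + 1) (R + 2))]
          exact (h.isStep n).energy R
      _ = 32 * ∫⁻ y in O ∩ ball 0 (R + 2), ∑' n, ENNReal.ofReal (s n y ^ 2) := by
          rw [ENNReal.tsum_mul_left, lintegral_tsum fun n =>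
            hmeas (R + 2) n _ (h.isStep n).continuousOn]
      _ ≤ 32 * ∫⁻ y in O ∩ ball (0 : Plane) (R + 2), 52 := by
          refine mul_le_mul_right (setLIntegral_mono' (hOm.inter measurableSet_ball) ?_) 32
          intro y hy
          refine ENNReal.tsum_le_of_sum_range_le fun N => ?_
          rw [← ENNReal.ofReal_sum_of_nonneg fun _ _ => sq_nonneg _]
          refine (ENNReal.ofReal_le_ofReal ((h.game (mem_iInter.1 hy.1)).1 N)).trans_eq ?_
          norm_num
      _ = _ := by rw [setLIntegral_const]
  have hmt : AEMeasurable (fun y => ∑' n, ENNReal.ofReal (stepSize n (a n y) ^ 2))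
      (volume.restrict (O ∩ ball 0 R)) := AEMeasurable.tsum fun n => hmeas R n _ (hstep n)
  filter_upwards [ae_lt_top' hmt hfin] with y hy
  exact summable_of_tsum_ofReal_ne_top (fun _ => sq_nonneg _) hy.ne

end IsStepSequence

/-- A `C¹` strict subsolution of the eikonal equation can be perturbed, by an arbitrarily small
amount, to an everywhere differentiable almost everywhere solution. -/
theorem exists_eikonal_perturbation {U : Set Plane} (hU : IsOpen U) {v κ : Plane → ℝ}
    (hv : ContDiffOn ℝ 1 v U) (hv1 : ∀ x ∈ U, ‖∇ v x‖ < 1) (hκ : ContinuousOn κ U)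
    (hκ0 : ∀ x ∈ U, 0 < κ x) :
    ∃ w : Plane → ℝ, (∀ x ∉ U, w x = v x) ∧ (∀ x ∈ U, |w x - v x| ≤ κ x) ∧
      (∀ x ∈ U, ∃ l : Plane, ‖l‖ ≤ 1 ∧ HasGradientAt w l x) ∧
      ∀ᵐ x ∂volume.restrict U, ‖∇ w x‖ = 1 := by
  have hS₀ : Stage.Admissible ⟨U, v, fun _ _ => 0⟩ U :=
    ⟨hU, Subset.rfl, hv, hv1, fun _ _ => Eventually.of_forall fun _ => rfl, by simp⟩
  obtain ⟨S, a, u, s, hS0, h⟩ := hS₀.exists_isStepSequence hκ hκ0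
  obtain ⟨w, hw⟩ := h.exists_tendsto hκ0
  have h0 : (S 0).dom = U := by rw [hS0]
  have h0v : (S 0).fn = v := by rw [hS0]
  refine ⟨w, fun x hx => ?_, fun x hx => ?_, fun x hx => ?_, ?_⟩
  · rw [h.lim_eq hw (n := 0) (by rwa [h0]), h0v]
  · rw [← h0v]
    exact h.abs_lim_sub_le hw hκ0 hx
  · by_cases hall : ∀ n, x ∈ (S n).dom
    · obtain ⟨l, hl⟩ := (h.game hall).2
      exact ⟨l, le_of_tendsto' hl.norm fun n => (h.isStep n).norm_le x (hall _),
        h.hasGradientAt_of_forall_mem hw hall hl⟩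
    · classical
      push Not at hall
      obtain ⟨k, hk, hmin⟩ := Nat.findX hall
      obtain ⟨n, rfl⟩ : ∃ n, k = n + 1 :=
        ⟨k - 1, by
          rcases k with - | k
          · exact absurd (h0 ▸ hx) hk
          · rfl⟩
      have hn := not_not.1 (hmin n n.lt_succ_self)
      exact ⟨_, ((h.admissible n).norm_lt x hn).le, h.hasGradientAt_of_notMem hw hn hk⟩
  · have h1 : ∀ᵐ y ∂volume.restrict (⋂ n, (S n).dom), ‖∇ w y‖ = 1 := by
      have hcov : (⋂ n, (S n).dom) = ⋃ R : ℕ, (⋂ n, (S n).dom) ∩ ball 0 (R : ℝ) := by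
        rw [← inter_iUnion, iUnion_ball_nat, inter_univ]
      rw [hcov, ae_restrict_iUnion_iff]
      intro R
      have hm : MeasurableSet ((⋂ n, (S n).dom) ∩ ball 0 (R : ℝ)) :=
        (MeasurableSet.iInter fun n => (h.admissible n).isOpen.measurableSet).inter
          measurableSet_ball
      filter_upwards [h.ae_summable R, ae_restrict_mem hm] with y hy hyO
      have hall := mem_iInter.1 hyO.1
      obtain ⟨l, hl⟩ := (h.game hall).2
      rw [(h.hasGradientAt_of_forall_mem hw hall hl).gradient]
      exact norm_lim_eq_one (fun n => (h.isStep n).norm_le y (hall _)) hl hy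
    have h2 : volume.restrict U ≤ volume.restrict (⋂ n, (S n).dom) := by
      refine Measure.restrict_mono_ae (ae_le_set.2 ?_)
      rw [← h0]
      exact h.volume_diff 0
    exact ae_mono h2 h1

/-- The largest `1`-Lipschitz extension of the restriction of `f` to `F`. -/
noncomputable def upperExt (F : Set Plane) (f : Plane → ℝ) (x : Plane) : ℝ :=
  ⨅ y : F, (f y + dist x y)

section upperExt

variable {F : Set Plane} {f : Plane → ℝ}

theorem upperExt_le (hf : ∀ x ∈ F, ∀ y ∈ F, f x - f y ≤ dist x y) (x : Plane) {y : Plane}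
    (hy : y ∈ F) : upperExt F f x ≤ f y + dist x y := by
  refine ciInf_le (f := fun y : F => f y + dist x y) ⟨f y - dist x y, ?_⟩ ⟨y, hy⟩
  rintro _ ⟨z, rfl⟩
  have h1 := hf y hy z z.2
  have h2 := dist_triangle_left y z x
  change f y - dist x y ≤ f z + dist x z
  linarith

theorem le_upperExt (hF : F.Nonempty) {x : Plane} {c : ℝ} (h : ∀ y ∈ F, c ≤ f y + dist x y) :
    c ≤ upperExt F f x :=
  have := hF.to_subtype
  le_ciInf fun y => h y y.2

theorem upperExt_le_add (hF : F.Nonempty) (hf : ∀ x ∈ F, ∀ y ∈ F, f x - f y ≤ dist x y)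
    (x z : Plane) : upperExt F f x ≤ upperExt F f z + dist x z := by
  rw [← sub_le_iff_le_add]
  refine le_upperExt hF fun y hy => ?_
  have h1 := upperExt_le hf x hy
  have h2 := dist_triangle x z y
  linarith

theorem upperExt_eq (hf : ∀ x ∈ F, ∀ y ∈ F, f x - f y ≤ dist x y) {x : Plane} (hx : x ∈ F) :
    upperExt F f x = f x := by
  refine le_antisymm ?_ (le_upperExt ⟨x, hx⟩ fun y hy => ?_)
  · simpa using upperExt_le hf x hx
  · linarith [hf x hx y hy]

theorem neg_upperExt_neg_le (hF : F.Nonempty) (hf : ∀ x ∈ F, ∀ y ∈ F, f x - f y ≤ dist x y)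
    (x : Plane) : -upperExt F (fun y => -f y) x ≤ upperExt F f x := by
  refine le_upperExt hF fun y hy => ?_
  rw [neg_le]
  refine le_upperExt hF fun z hz => ?_
  have h1 := hf z hz y hy
  have h2 := dist_triangle_left z y x
  linarith

theorem norm_add_le_add_inner_add_sq {p h : Plane} {d : ℝ} (hd : 0 < d) (hp : d ≤ ‖p‖) :
    ‖p + h‖ ≤ ‖p‖ + inner ℝ (‖p‖⁻¹ • p) h + 1 / (2 * d) * ‖h‖ ^ 2 := by
  have hp0 : 0 < ‖p‖ := hd.trans_le hp
  have h1 := norm_add_sq_real p h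
  have h2 : ‖p + h‖ ≤ ‖p‖ + ‖p‖⁻¹ * inner ℝ p h + 1 / (2 * ‖p‖) * ‖h‖ ^ 2 := by
    have h3 : ‖p‖ + ‖p‖⁻¹ * inner ℝ p h + 1 / (2 * ‖p‖) * ‖h‖ ^ 2 =
        (‖p‖ ^ 2 + ‖p + h‖ ^ 2) / (2 * ‖p‖) := by
      rw [h1]; field_simp; ring
    rw [h3, le_div_iff₀ (by positivity)]
    nlinarith [sq_nonneg (‖p‖ - ‖p + h‖)]
  rw [inner_smul_left]
  refine h2.trans ?_
  simp only [conj_trivial]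
  gcongr

theorem exists_upperExt_le_quadratic (hFc : IsClosed F) (hF : F.Nonempty)
    (hf : ∀ x ∈ F, ∀ y ∈ F, f x - f y ≤ dist x y) {x : Plane} (hx : x ∉ F) :
    ∃ (e : Plane) (C : ℝ), ‖e‖ = 1 ∧
      ∀ z, upperExt F f z ≤ upperExt F f x + inner ℝ e (z - x) + C * dist z x ^ 2 := by
  have := hF.to_subtype
  have hd : 0 < infDist x F := (hFc.notMem_iff_infDist_pos hF).1 hx
  have hy : ∀ n : ℕ, ∃ y ∈ F, f y + dist x y < upperExt F f x + 1 / ((n : ℝ) + 1) := by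
    intro n
    obtain ⟨y, hy⟩ := exists_lt_of_ciInf_lt (f := fun y : F => f y + dist x y)
      (show upperExt F f x < upperExt F f x + 1 / ((n : ℝ) + 1) from
        lt_add_of_pos_right _ (by positivity))
    exact ⟨y, y.2, hy⟩
  choose y hyF hy using hy
  have hdy : ∀ n, infDist x F ≤ ‖x - y n‖ := fun n => by
    rw [← dist_eq_norm]
    exact infDist_le_dist_of_mem (hyF n)
  have hmem : ∀ n, ‖x - y n‖⁻¹ • (x - y n) ∈ sphere (0 : Plane) 1 := fun n => by
    have := hd.trans_le (hdy n)
    rw [mem_sphere_zero_iff_norm, norm_smul, norm_inv, norm_norm, inv_mul_cancel₀ this.ne']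
  obtain ⟨e, he, φ, hφ, hlim⟩ := (isCompact_sphere (0 : Plane) 1).tendsto_subseq hmem
  refine ⟨e, 1 / (2 * infDist x F), mem_sphere_zero_iff_norm.1 he, fun z => ?_⟩
  have h1 : Tendsto (fun n => upperExt F f x + 1 / ((φ n : ℝ) + 1) +
      inner ℝ (‖x - y (φ n)‖⁻¹ • (x - y (φ n))) (z - x) + 1 / (2 * infDist x F) * dist z x ^ 2)
      atTop
      (𝓝 (upperExt F f x + 0 + inner ℝ e (z - x) + 1 / (2 * infDist x F) * dist z x ^ 2)) := by
    refine Tendsto.add_const _ (Tendsto.add (Tendsto.const_add _ ?_) ?_)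
    · exact tendsto_one_div_add_atTop_nhds_zero_nat.comp hφ.tendsto_atTop
    · exact hlim.inner tendsto_const_nhds
  rw [add_zero] at h1
  refine ge_of_tendsto' h1 fun n => ?_
  have h2 := upperExt_le hf z (hyF (φ n))
  have h3 := norm_add_le_add_inner_add_sq (h := z - x) hd (hdy (φ n))
  have h4 := hy (φ n)
  rw [show x - y (φ n) + (z - x) = z - y (φ n) by abel] at h3
  rw [dist_eq_norm] at h2 h4 ⊢
  linarith

end upperExt

theorem hasGradientAt_of_squeeze {m M w : Plane → ℝ} {x e e' : Plane} {C C' : ℝ}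
    (hM : ∀ z, M z ≤ M x + inner ℝ e (z - x) + C * dist z x ^ 2)
    (hm : ∀ z, -m z ≤ -m x + inner ℝ e' (z - x) + C' * dist z x ^ 2)
    (hx : m x = M x) (hmw : ∀ z, m z ≤ w z) (hwM : ∀ z, w z ≤ M z) : HasGradientAt w e x := by
  have hwx : w x = M x := le_antisymm (hwM x) (hx ▸ hmw x)
  have h0 : e + e' = 0 := by
    by_contra hne
    have hpos : 0 < ‖e + e'‖ ^ 2 := by have := norm_pos_iff.2 hne; positivity
    set t : ℝ := 1 / (2 * (|C + C'| + 1)) with ht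
    have ht0 : 0 < t := by positivity
    set z : Plane := x - t • (e + e') with hz
    have hzx : z - x = -(t • (e + e')) := by rw [hz]; abel
    have hd : dist z x ^ 2 = t ^ 2 * ‖e + e'‖ ^ 2 := by
      rw [dist_eq_norm, hzx, norm_neg, norm_smul, mul_pow, Real.norm_eq_abs, sq_abs]
    have h1 := hM z
    have h2 := hm z
    have h3 := (hmw z).trans (hwM z)
    have h4 : inner ℝ e (z - x) + inner ℝ e' (z - x) = -(t * ‖e + e'‖ ^ 2) := by
      rw [← inner_add_left, hzx, inner_neg_right, inner_smul_right, real_inner_self_eq_norm_sq]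
    have h5 : t * ‖e + e'‖ ^ 2 ≤ (C + C') * (t ^ 2 * ‖e + e'‖ ^ 2) := by
      rw [hd] at h1 h2
      linarith
    have h6 : (C + C') * t ≤ 1 / 2 := by
      have : t * (|C + C'| + 1) = 1 / 2 := by rw [ht]; field_simp
      nlinarith [le_abs_self (C + C')]
    have h7 : 0 < t * ‖e + e'‖ ^ 2 := by positivity
    nlinarith
  have he' : e' = -e := (neg_eq_of_add_eq_zero_right h0).symm
  have hlin : HasGradientAt (fun z => w x + inner ℝ e (z - x)) e x := by
    refine hasGradientAt_of_forall_pos fun ε hε => Eventually.of_forall fun z => ?_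
    simp
    positivity
  refine hlin.of_abs_sub_le_sq (C := |C| + |C'|) (Eventually.of_forall fun z => ?_)
  have h1 := hM z
  have h2 := hm z
  have h3 := hmw z
  have h4 := hwM z
  rw [he', inner_neg_left] at h2
  have h5 := mul_le_mul_of_nonneg_right (le_abs_self C) (sq_nonneg (dist z x))
  have h6 := mul_le_mul_of_nonneg_right (le_abs_self C') (sq_nonneg (dist z x))
  have h7 := mul_nonneg (abs_nonneg C) (sq_nonneg (dist z x))
  have h8 := mul_nonneg (abs_nonneg C') (sq_nonneg (dist z x))
  rw [abs_le]
  constructor <;> linarith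

theorem hasStrictDerivAt_log_one_add_exp (t : ℝ) :
    HasStrictDerivAt (fun t => Real.log (1 + Real.exp t)) (1 - (1 + Real.exp t)⁻¹) t := by
  have h := ((Real.hasStrictDerivAt_exp t).const_add 1).log (by positivity)
  refine h.congr_deriv ?_
  have := Real.exp_pos t
  field_simp
  ring

theorem HasStrictDerivAt.exists_abs_sub_le {A : ℝ → ℝ} {c C t : ℝ} (hA : HasStrictDerivAt A c t)
    (hc : 0 ≤ c) (hC : c < C) : ∃ ε > 0, ∀ s s', |s - t| < ε → |s' - t| < ε →
      |A s - A s'| ≤ C * |s - s'| := by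
  have h := hA.hasStrictFDerivAt.isLittleO.def (sub_pos.2 hC)
  obtain ⟨ε, hε, h⟩ := Metric.eventually_nhds_iff_ball.1 h
  refine ⟨ε, hε, fun s s' hs hs' => ?_⟩
  have h1 := h (s, s') (by simpa [Prod.dist_eq, Real.dist_eq] using ⟨hs, hs'⟩)
  simp only [Real.norm_eq_abs, ContinuousLinearMap.toSpanSingleton_apply, smul_eq_mul] at h1
  have h2 : |A s - A s'| ≤ |A s - A s' - (s - s') * c| + |(s - s') * c| := by
    simpa using abs_add_le (A s - A s' - (s - s') * c) ((s - s') * c)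
  rw [abs_mul, abs_of_nonneg hc] at h2
  nlinarith

theorem log_one_add_exp_lt {s t : ℝ} (h : s < t) :
    Real.log (1 + Real.exp s) < Real.log (1 + Real.exp t) :=
  Real.log_lt_log (by positivity) (by gcongr)

theorem sub_log_one_add_exp_lt {s t : ℝ} (h : s < t) :
    s - Real.log (1 + Real.exp s) < t - Real.log (1 + Real.exp t) := by
  have h1 : ∀ r, r - Real.log (1 + Real.exp r) = -Real.log (1 + Real.exp (-r)) := by
    intro r
    have : 1 + Real.exp r = Real.exp r * (1 + Real.exp (-r)) := by
      rw [mul_add, ← Real.exp_add]; simp; ring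
    rw [this, Real.log_mul (by positivity) (by positivity), Real.log_exp]
    ring
  rw [h1, h1, neg_lt_neg_iff]
  exact log_one_add_exp_lt (neg_lt_neg h)

/-- Between two `1`-Lipschitz functions there is a function which is locally a strict contraction
where they differ. -/
theorem exists_strict_between {m M : Plane → ℝ} (hm : ∀ x y, |m x - m y| ≤ dist x y)
    (hM : ∀ x y, |M x - M y| ≤ dist x y) :
    ∃ v : Plane → ℝ, Continuous v ∧ ∀ x, m x < M x → m x < v x ∧ v x < M x ∧
      ∃ κ > 0, ∀ y ∈ ball x κ, ∀ z ∈ ball x κ, |v y - v z| ≤ (1 - κ) * dist y z := by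
  have cont : ∀ f : Plane → ℝ, (∀ x y, |f x - f y| ≤ dist x y) → Continuous f := fun f hf =>
    (LipschitzWith.of_dist_le' (K := 1) fun x y => by simpa [Real.dist_eq] using hf x y).continuous
  set A : ℝ → ℝ := fun t => Real.log (1 + Real.exp t) with hA
  have hAc : Continuous A := continuous_iff_continuousAt.2 fun t =>
    (hasStrictDerivAt_log_one_add_exp t).hasDerivAt.continuousAt
  refine ⟨fun x => M x - A (M x) + A (m x),
    ((cont M hM).sub (hAc.comp (cont M hM))).add (hAc.comp (cont m hm)), fun x hx => ⟨?_, ?_, ?_⟩⟩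
  · have := sub_log_one_add_exp_lt hx
    simp only [hA]
    linarith
  · have := log_one_add_exp_lt hx
    simp only [hA]
    linarith
  · have ha := hasStrictDerivAt_log_one_add_exp (m x)
    have hb := (hasStrictDerivAt_id (M x)).sub (hasStrictDerivAt_log_one_add_exp (M x))
    set p : ℝ := (1 + Real.exp (m x))⁻¹ with hp
    set q : ℝ := (1 + Real.exp (M x))⁻¹ with hq
    have hqp : q < p := by rw [hp, hq]; gcongr
    have hp1 : p ≤ 1 := inv_le_one_of_one_le₀ (by linarith [Real.exp_pos (m x)])
    have hq0 : 0 < q := by positivity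
    obtain ⟨ε, hε, h1⟩ := ha.exists_abs_sub_le (C := 1 - p + (p - q) / 4)
      (by linarith) (by linarith)
    obtain ⟨ε', hε', h2⟩ := hb.exists_abs_sub_le (C := q + (p - q) / 4) (by linarith) (by linarith)
    refine ⟨min (min ε ε') ((p - q) / 2), by simp [hε, hε', hqp], fun y hy z hz => ?_⟩
    have hlt : ∀ y ∈ ball x (min (min ε ε') ((p - q) / 2)), ∀ f : Plane → ℝ,
        (∀ x y, |f x - f y| ≤ dist x y) → |f y - f x| < ε ∧ |f y - f x| < ε' := by
      intro y hy f hf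
      have := (hf y x).trans_lt (mem_ball.1 hy)
      simp only [lt_min_iff] at this
      exact this.1
    have h3 := h1 (m y) (m z) (hlt y hy m hm).1 (hlt z hz m hm).1
    have h4 := h2 (M y) (M z) (hlt y hy M hM).2 (hlt z hz M hM).2
    have h5 := mul_le_mul_of_nonneg_left (hm y z) (show 0 ≤ 1 - p + (p - q) / 4 by linarith)
    have h6 := mul_le_mul_of_nonneg_left (hM y z) (show 0 ≤ q + (p - q) / 4 by linarith)
    have h7 := mul_le_mul_of_nonneg_right (min_le_right (min ε ε') ((p - q) / 2))
      (dist_nonneg (x := y) (y := z))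
    simp only [Pi.sub_apply, id] at h4
    have h8 : M y - A (M y) + A (m y) - (M z - A (M z) + A (m z)) =
      (M y - A (M y) - (M z - A (M z))) + (A (m y) - A (m z)) := by ring
    rw [h8]
    refine (abs_add_le _ _).trans ?_
    simp only [hA] at *
    linarith

/-- A positive `C¹` function which is small, and has a small gradient, relatively to a locally
uniform scale. -/
theorem exists_small_scale {U : Set Plane} {P : Plane → ℝ → Prop}
    (hP : ∀ x ∈ U, ∃ κ > 0, κ ≤ 1 ∧ ∀ y ∈ ball x κ, P y κ) :
    ∃ ρ : Plane → ℝ, ContDiff ℝ 1 ρ ∧ (∀ y ∈ U, 0 < ρ y) ∧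
      ∀ y ∈ U, ∃ κ > 0, P y κ ∧ ρ y < κ ∧ ‖fderiv ℝ ρ y‖ ≤ κ := by
  rcases U.eq_empty_or_nonempty with rfl | hne
  · exact ⟨fun _ => 0, contDiff_const, by simp, by simp⟩
  choose! κ hκ0 hκ1 hP using hP
  choose! χ C hχ hχ0 hχ1 hχin hχout hC hχC using fun x (hx : x ∈ U) => exists_bump x (hκ0 x hx)
  obtain ⟨T, hTU, hTc, hcov⟩ := TopologicalSpace.countable_cover_nhdsWithin (s := U)
    (f := fun x => ball x (κ x / 4)) fun x hx =>
      mem_nhdsWithin_of_mem_nhds (ball_mem_nhds x (by have := hκ0 x hx; positivity))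
  have hTne : T.Nonempty := by
    obtain ⟨x, hx⟩ := hne
    obtain ⟨t, ht, _⟩ := mem_iUnion₂.1 (hcov hx)
    exact ⟨t, ht⟩
  obtain ⟨e, rfl⟩ := hTc.exists_eq_range hTne
  have heU : ∀ i, e i ∈ U := fun i => hTU (mem_range_self i)
  set c : ℕ → ℝ := fun i => refWeight i * (κ (e i) / (1 + C (e i))) with hc
  have hC1 : ∀ i, 0 < 1 + C (e i) := fun i => by linarith [hC _ (heU i)]
  have hc0 : ∀ i, 0 < c i := fun i =>
    mul_pos (refWeight_pos i) (div_pos (hκ0 _ (heU i)) (hC1 i))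
  set g : ℕ → Plane → ℝ := fun i z => c i * χ (e i) z with hg
  have hgd : ∀ i, ContDiff ℝ 1 (g i) := fun i => contDiff_const.mul (hχ _ (heU i))
  have hg0 : ∀ i z, 0 ≤ g i z := fun i z => mul_nonneg (hc0 i).le (hχ0 _ (heU i) z)
  have hgle : ∀ i z, g i z ≤ refWeight i * κ (e i) := by
    intro i z
    have h1 := hχ1 _ (heU i) z
    have h2 := hχ0 _ (heU i) z
    have h3 := refWeight_pos i
    have h4 := hκ0 _ (heU i)
    have h5 := hC _ (heU i)
    calc g i z ≤ refWeight i * (κ (e i) / 1) * 1 := by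
          simp only [hg, hc]
          gcongr
          linarith
      _ = _ := by ring
  have hgf : ∀ i z, ‖fderiv ℝ (g i) z‖ ≤ refWeight i * κ (e i) := by
    intro i z
    have h1 : fderiv ℝ (g i) z = c i • fderiv ℝ (χ (e i)) z :=
      fderiv_const_mul ((hχ _ (heU i)).differentiable one_ne_zero z) _
    have h2 := hχC _ (heU i) z
    rw [gradient, LinearIsometryEquiv.norm_map] at h2
    have h3 := hC1 i
    rw [h1, norm_smul, Real.norm_of_nonneg (hc0 i).le]
    have h4 := (refWeight_pos i).le
    have h5 := (hκ0 _ (heU i)).le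
    calc c i * ‖fderiv ℝ (χ (e i)) z‖ ≤ c i * (1 + C (e i)) := by
          have := (hc0 i).le
          gcongr
          linarith
      _ = _ := by simp only [hc]; field_simp
  have hout : ∀ i z, z ∉ ball (e i) (κ (e i)) → g i z = 0 ∧ fderiv ℝ (g i) z = 0 := by
    intro i z hz
    rw [mem_ball, not_lt] at hz
    have h1 := hκ0 _ (heU i)
    have h2 : g i =ᶠ[𝓝 z] fun _ => 0 := by
      have h3 : ∀ᶠ y in 𝓝 z, κ (e i) / 2 < dist y (e i) :=
        (continuous_id.dist continuous_const).continuousAt.eventually_const_lt (by simp; linarith)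
      filter_upwards [h3] with y hy
      simp only [hg, hχout _ (heU i) y hy.le, mul_zero]
    exact ⟨h2.self_of_nhds, by rw [h2.fderiv_eq]; simp⟩
  have hw1 : ∀ i, refWeight i * κ (e i) ≤ refWeight i := fun i =>
    mul_le_of_le_one_right (refWeight_pos i).le (hκ1 _ (heU i))
  have hsw := hasSum_refWeight.summable
  have hgs : ∀ z, Summable fun i => g i z := fun z =>
    Summable.of_nonneg_of_le (fun i => hg0 i z) (fun i => (hgle i z).trans (hw1 i)) hsw
  have hfs : ∀ z, Summable fun i => ‖fderiv ℝ (g i) z‖ := fun z =>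
    Summable.of_nonneg_of_le (fun i => norm_nonneg _) (fun i => (hgf i z).trans (hw1 i)) hsw
  refine ⟨fun z => ∑' i, g i z, ?_, fun y hy => ?_, fun y hy => ?_⟩
  · refine contDiff_tsum (v := fun _ => refWeight) hgd (fun _ _ => hsw) fun k i z hk => ?_
    have hk' : k ≤ 1 := by exact_mod_cast hk
    interval_cases k
    · rw [norm_iteratedFDeriv_zero, Real.norm_of_nonneg (hg0 i z)]
      exact (hgle i z).trans (hw1 i)
    · rw [norm_iteratedFDeriv_one]
      exact (hgf i z).trans (hw1 i)
  · obtain ⟨_, ⟨i, rfl⟩, hi⟩ := mem_iUnion₂.1 (hcov hy)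
    refine (hgs y).tsum_pos (fun j => hg0 j y) i ?_
    simp only [hg, hχin _ (heU i) y hi, mul_one]
    exact hc0 i
  · set Q : Set ℝ := {k | ∃ i, y ∈ ball (e i) (κ (e i)) ∧ k = κ (e i)} with hQ
    have hQb : BddAbove Q := ⟨1, by rintro _ ⟨i, _, rfl⟩; exact hκ1 _ (heU i)⟩
    have hQle : ∀ i, y ∈ ball (e i) (κ (e i)) → κ (e i) ≤ sSup Q := fun i hi =>
      le_csSup hQb ⟨i, hi, rfl⟩
    obtain ⟨_, ⟨i₀, rfl⟩, hi₀⟩ := mem_iUnion₂.1 (hcov hy)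
    have hi₀' : y ∈ ball (e i₀) (κ (e i₀)) :=
      ball_subset_ball (by linarith [hκ0 _ (heU i₀)]) hi₀
    have hK0 : 0 < sSup Q := (hκ0 _ (heU i₀)).trans_le (hQle i₀ hi₀')
    obtain ⟨_, ⟨i, hi, rfl⟩, hik⟩ := exists_lt_of_lt_csSup
      (show Q.Nonempty from ⟨_, i₀, hi₀', rfl⟩) (half_lt_self hK0)
    have hsK : HasSum (fun i => refWeight i * sSup Q) (sSup Q / 2) := by
      have := hasSum_refWeight.mul_right (sSup Q)
      rwa [one_div, inv_mul_eq_div] at this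
    have hb : ∀ j, g j y ≤ refWeight j * sSup Q ∧ ‖fderiv ℝ (g j) y‖ ≤ refWeight j * sSup Q := by
      intro j
      have h1 := (refWeight_pos j).le
      by_cases hj : y ∈ ball (e j) (κ (e j))
      · have h2 := mul_le_mul_of_nonneg_left (hQle j hj) h1
        exact ⟨(hgle j y).trans h2, (hgf j y).trans h2⟩
      · rw [(hout j y hj).1, (hout j y hj).2, norm_zero]
        have := mul_nonneg h1 hK0.le
        exact ⟨this, this⟩
    refine ⟨κ (e i), hκ0 _ (heU i), hP _ (heU i) y hi, ?_, ?_⟩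
    · exact (((hgs y).tsum_le_tsum (fun j => (hb j).1) hsK.summable).trans_eq
        hsK.tsum_eq).trans_lt hik
    · have h1 : fderiv ℝ (fun z => ∑' i, g i z) y = ∑' i, fderiv ℝ (g i) y :=
        fderiv_tsum_apply hsw (fun j => (hgd j).differentiable one_ne_zero)
          (fun j z => (hgf j z).trans (hw1 j)) (hgs y) y
      rw [h1]
      exact (tsum_of_norm_bounded hsK fun j => (hb j).2).trans hik.le

/-- A smooth probability density supported in the unit ball of the plane. -/
noncomputable def unitDensity : Plane → ℝ :=
  (⟨1 / 2, 1, by norm_num, by norm_num⟩ : ContDiffBump (0 : Plane)).normed volume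

theorem contDiff_unitDensity : ContDiff ℝ 1 unitDensity := by
  unfold unitDensity
  exact_mod_cast ContDiffBump.contDiff_normed (n := 1) _

theorem unitDensity_nonneg (z : Plane) : 0 ≤ unitDensity z := ContDiffBump.nonneg_normed _ _

theorem unitDensity_eq_zero {z : Plane} (hz : z ∉ ball (0 : Plane) 1) : unitDensity z = 0 := by
  unfold unitDensity
  rw [← Function.notMem_support, ContDiffBump.support_normed_eq]
  exact hz

theorem integrable_mul_unitDensity {f : Plane → ℝ} (hf : Continuous f) :
    Integrable fun z => f z * unitDensity z :=
  (hf.mul contDiff_unitDensity.continuous).integrable_of_hasCompactSupport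
    (ContDiffBump.hasCompactSupport_normed _).mul_left

theorem abs_integral_mul_unitDensity_sub_le {f g : Plane → ℝ} (hf : Continuous f)
    (hg : Continuous g) {c : ℝ} (h : ∀ z ∈ ball (0 : Plane) 1, |f z - g z| ≤ c) :
    |(∫ z, f z * unitDensity z) - ∫ z, g z * unitDensity z| ≤ c := by
  rw [← integral_sub (integrable_mul_unitDensity hf) (integrable_mul_unitDensity hg)]
  have h1 : ∫ z, c * unitDensity z = c := by
    rw [integral_const_mul, unitDensity, ContDiffBump.integral_normed, mul_one]
  rw [← Real.norm_eq_abs]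
  refine (norm_integral_le_of_norm_le (integrable_mul_unitDensity continuous_const)
    (Eventually.of_forall fun z => ?_)).trans_eq h1
  rw [← sub_mul, norm_mul, Real.norm_eq_abs, Real.norm_of_nonneg (unitDensity_nonneg z)]
  by_cases hz : z ∈ ball (0 : Plane) 1
  · exact mul_le_mul_of_nonneg_right (h z hz) (unitDensity_nonneg z)
  · simp [unitDensity_eq_zero hz]

/-- Averaging a continuous function at a `C¹` variable scale gives a `C¹` function. -/
theorem contDiffOn_integral_unitDensity {U : Set Plane} {v ρ : Plane → ℝ} (hv : Continuous v)
    (hρ : ContDiff ℝ 1 ρ) (hρU : ∀ x ∈ U, ρ x ∈ Ioo (0 : ℝ) 1) :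
    ContDiffOn ℝ 1 (fun x => ∫ z, v (x - ρ x • z) * unitDensity z) U := by
  set g : ℝ → Plane → ℝ := fun p z => (p ^ 2)⁻¹ * unitDensity (p⁻¹ • z) with hg
  have h1 := contDiffOn_convolution_right_with_param (𝕜 := ℝ) (n := 1) (μ := volume) (f := v)
    (g := g) (ContinuousLinearMap.mul ℝ ℝ) (isOpen_Ioo (a := (0 : ℝ)) (b := 1))
    (isCompact_closedBall (0 : Plane) 1) ?_ hv.locallyIntegrable ?_
  · have h2 : ContDiffOn ℝ 1 (fun x => (ρ x, x)) U := (hρ.prodMk contDiff_id).contDiffOn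
    refine (ContDiffOn.comp h1 h2 fun x hx => ⟨hρU x hx, mem_univ _⟩).congr fun x hx => ?_
    have h3 := (hρU x hx).1
    simp only [Function.comp_def, convolution_mul_swap, hg]
    have h4 := Measure.integral_comp_smul_of_nonneg (volume : Measure Plane)
      (fun t => v (x - t) * unitDensity ((ρ x)⁻¹ • t)) (ρ x) (hR := h3.le)
    simp only [smul_smul, inv_mul_cancel₀ h3.ne', one_smul, finrank_euclideanSpace,
      Fintype.card_fin, smul_eq_mul] at h4
    rw [h4, ← integral_const_mul]
    congr 1
    ext t
    ring
  · intro p z hp hz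
    simp only [hg]
    rw [unitDensity_eq_zero, mul_zero]
    rw [mem_closedBall_zero_iff, not_le] at hz
    rw [mem_ball_zero_iff, not_lt, norm_smul, norm_inv, Real.norm_of_nonneg hp.1.le,
      ← div_eq_inv_mul, one_le_div hp.1]
    exact (hp.2.trans hz).le
  · have h2 : ContDiffOn ℝ 1 (fun q : ℝ × Plane => (q.1)⁻¹) (Ioo 0 1 ×ˢ univ) :=
      contDiff_fst.contDiffOn.inv fun q hq => hq.1.1.ne'
    have h3 : ContDiffOn ℝ 1 (fun q : ℝ × Plane => (q.1 ^ 2)⁻¹) (Ioo 0 1 ×ˢ univ) :=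
      (contDiff_fst.pow 2).contDiffOn.inv fun q hq => (pow_pos hq.1.1 2).ne'
    have h4 := contDiff_unitDensity.comp_contDiffOn (h2.smul contDiff_snd.contDiffOn)
    exact h3.mul h4

theorem exists_contDiffOn_strict_approx {U : Set Plane} (hU : IsOpen U) {v δ : Plane → ℝ}
    (hvc : Continuous v)
    (hv : ∀ x ∈ U, ∃ κ > 0, ∀ y ∈ ball x κ, ∀ z ∈ ball x κ, |v y - v z| ≤ (1 - κ) * dist y z)
    (hδ : ContinuousOn δ U) (hδ0 : ∀ x ∈ U, 0 < δ x) :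
    ∃ V : Plane → ℝ, ContDiffOn ℝ 1 V U ∧ (∀ x ∈ U, ‖∇ V x‖ < 1) ∧
      ∀ x ∈ U, |V x - v x| < δ x := by
  obtain ⟨ρ, hρ, hρ0, hρP⟩ := exists_small_scale (U := U) (P := fun y κ => κ ≤ 1 ∧ κ ≤ δ y ∧
    ∀ z ∈ ball y κ, ∀ z' ∈ ball y κ, |v z - v z'| ≤ (1 - κ) * dist z z') (by
    intro x hx
    obtain ⟨κ, hκ, hκv⟩ := hv x hx
    have h1 : ∀ᶠ y in 𝓝 x, δ x / 2 < δ y :=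
      (hδ.continuousAt (hU.mem_nhds hx)).eventually_const_lt (half_lt_self (hδ0 x hx))
    obtain ⟨ε, hε, h1⟩ := Metric.eventually_nhds_iff_ball.1 h1
    have hδx := hδ0 x hx
    set k := min (min (κ / 2) 1) (min ε (δ x / 2)) with hk
    have hk1 : k ≤ κ / 2 := (min_le_left _ _).trans (min_le_left _ _)
    have hk2 : k ≤ 1 := (min_le_left _ _).trans (min_le_right _ _)
    have hk3 : k ≤ ε := (min_le_right _ _).trans (min_le_left _ _)
    have hk4 : k ≤ δ x / 2 := (min_le_right _ _).trans (min_le_right _ _)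
    have hk0 : 0 < k := by positivity
    refine ⟨k, hk0, hk2, fun y hy => ⟨hk2, hk4.trans (h1 y (ball_subset_ball hk3 hy)).le,
      fun z hz z' hz' => ?_⟩⟩
    have hsub : ball y k ⊆ ball x κ := ball_subset_ball' (by
      rw [mem_ball] at hy; linarith)
    refine (hκv z (hsub hz) z' (hsub hz')).trans ?_
    gcongr
    linarith)
  set V : Plane → ℝ := fun x => ∫ z, v (x - ρ x • z) * unitDensity z with hV
  have hVc : ContDiffOn ℝ 1 V U := contDiffOn_integral_unitDensity hvc hρ fun x hx => by
    obtain ⟨κ, _, ⟨hκ1, _⟩, hκ2, _⟩ := hρP x hx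
    exact ⟨hρ0 x hx, hκ2.trans_le hκ1⟩
  have hcont : ∀ x, Continuous fun z => v (x - ρ x • z) := fun x => by fun_prop
  refine ⟨V, hVc, fun x hx => ?_, fun x hx => ?_⟩
  · obtain ⟨κ, hκ0, ⟨hκ1, _, hκv⟩, hρκ, hρκ'⟩ := hρP x hx
    have hd : HasFDerivAt V (fderiv ℝ V x) x :=
      ((hVc.differentiableOn one_ne_zero).differentiableAt (hU.mem_nhds hx)).hasFDerivAt
    rw [gradient, LinearIsometryEquiv.norm_map]
    have hρd : ∀ᶠ y in 𝓝 x, |ρ y - ρ x| ≤ (κ + κ ^ 2 / 2) * dist y x := by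
      have h1 := (hρ.differentiable one_ne_zero x).hasFDerivAt.isLittleO.def
        (show 0 < κ ^ 2 / 2 by positivity)
      filter_upwards [h1] with y hy
      have h2 := (fderiv ℝ ρ x).le_of_opNorm_le hρκ' (y - x)
      have h3 := norm_add_le (ρ y - ρ x - fderiv ℝ ρ x (y - x)) (fderiv ℝ ρ x (y - x))
      rw [sub_add_cancel, Real.norm_eq_abs] at h3
      rw [dist_eq_norm]
      linarith
    have hnear : ∀ᶠ y in 𝓝 x, dist y x + ρ y < κ := by
      have h1 : ContinuousAt (fun y => dist y x + ρ y) x := by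
        have := hρ.continuous
        fun_prop
      refine h1.eventually_lt_const ?_
      simpa using hρκ
    have hC0 : 0 ≤ (1 - κ) * (1 + (κ + κ ^ 2 / 2)) :=
      mul_nonneg (by linarith) (by positivity)
    refine (hd.le_of_lip' hC0 ?_).trans_lt (by nlinarith [pow_pos hκ0 2, pow_pos hκ0 3])
    filter_upwards [hρd, hnear, hU.mem_nhds hx] with y h1 h2 hyU
    rw [Real.norm_eq_abs, ← dist_eq_norm]
    refine abs_integral_mul_unitDensity_sub_le (hcont y) (hcont x) fun z hz => ?_
    have hz' : ‖z‖ ≤ 1 := (mem_ball_zero_iff.1 hz).le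
    have h3 : ∀ p ∈ U, ‖ρ p • z‖ ≤ ρ p := fun p hp => by
      rw [norm_smul, Real.norm_of_nonneg (hρ0 p hp).le]
      exact mul_le_of_le_one_right (hρ0 p hp).le hz'
    have h4 : y - ρ y • z ∈ ball x κ := by
      rw [mem_ball, dist_eq_norm, sub_right_comm]
      refine (norm_sub_le _ _).trans_lt ?_
      rw [← dist_eq_norm]
      linarith [h3 y hyU]
    have h5 : x - ρ x • z ∈ ball x κ := by
      rw [mem_ball, dist_eq_norm, sub_right_comm, sub_self, zero_sub, norm_neg]
      exact (h3 x hx).trans_lt hρκ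
    refine (hκv _ h4 _ h5).trans ?_
    rw [mul_assoc]
    refine mul_le_mul_of_nonneg_left ?_ (by linarith)
    rw [dist_eq_norm, show y - ρ y • z - (x - ρ x • z) = (y - x) - (ρ y - ρ x) • z by
      rw [sub_smul]; abel]
    refine (norm_sub_le _ _).trans ?_
    rw [norm_smul, ← dist_eq_norm, Real.norm_eq_abs]
    have h6 := mul_le_of_le_one_right (abs_nonneg (ρ y - ρ x)) hz'
    linarith
  · obtain ⟨κ, hκ0, ⟨hκ1, hκδ, hκv⟩, hρκ, -⟩ := hρP x hx
    have h1 : ∫ z, v x * unitDensity z = v x := by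
      rw [integral_const_mul, unitDensity, ContDiffBump.integral_normed, mul_one]
    have h2 : |V x - v x| ≤ ρ x := by
      rw [← h1]
      refine abs_integral_mul_unitDensity_sub_le (hcont x) continuous_const fun z hz => ?_
      have h3 : ‖ρ x • z‖ ≤ ρ x := by
        rw [norm_smul, Real.norm_of_nonneg (hρ0 x hx).le]
        exact mul_le_of_le_one_right (hρ0 x hx).le (mem_ball_zero_iff.1 hz).le
      have h4 : dist (x - ρ x • z) x = ‖ρ x • z‖ := by
        rw [dist_eq_norm, sub_right_comm, sub_self, zero_sub, norm_neg]
      refine (hκv _ (by rw [mem_ball, h4]; exact h3.trans_lt hρκ) x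
        (mem_ball_self hκ0)).trans ?_
      rw [h4]
      have := norm_nonneg (ρ x • z)
      nlinarith
    exact (h2.trans_lt hρκ).trans_le hκδ

theorem abs_sub_le_dist_of_squeeze {m M w : Plane → ℝ} (hm : ∀ x y, |m x - m y| ≤ dist x y)
    (hM : ∀ x y, |M x - M y| ≤ dist x y) (hmw : ∀ z, m z ≤ w z) (hwM : ∀ z, w z ≤ M z)
    (h : ∀ x, m x = M x ∨ ∃ l : Plane, ‖l‖ ≤ 1 ∧ HasGradientAt w l x) (x y : Plane) :
    |w x - w y| ≤ dist x y := by
  have touch : ∀ z, m z = M z → ∀ p, |w p - w z| ≤ dist p z := by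
    intro z hz p
    have h1 := abs_le.1 (hm p z)
    have h2 := abs_le.1 (hM p z)
    rw [abs_le]
    constructor <;> linarith [hmw p, hwM p, hmw z, hwM z]
  have cont : Continuous w := by
    refine continuous_iff_continuousAt.2 fun z => ?_
    rcases h z with hz | ⟨l, -, hl⟩
    · rw [Metric.continuousAt_iff]
      exact fun ε hε => ⟨ε, hε, fun {p} hp => (touch z hz p).trans_lt hp⟩
    · exact hl.continuousAt
  have key : ∀ x y, w y ≤ w x + dist x y := by
    intro x y
    set d : Plane := y - x with hd
    have hdn : dist x y = ‖d‖ := by rw [dist_comm, dist_eq_norm]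
    have hline : ∀ t : ℝ, HasDerivAt (fun t : ℝ => x + t • d) d t := fun t => by
      simpa using ((hasDerivAt_id t).smul_const d).const_add x
    have := image_le_of_liminf_slope_right_le_deriv_boundary (f := fun t : ℝ => w (x + t • d))
      (a := 0) (b := 1) (B := fun t => w x + t * ‖d‖) (B' := fun _ => ‖d‖)
      (by fun_prop) (by simp) (by fun_prop)
      (fun t _ => by
        simpa using (((hasDerivAt_id t).mul_const ‖d‖).const_add (w x)).hasDerivWithinAt)
      (fun t _ r hr => by
        rcases h (x + t • d) with hz | ⟨l, hl1, hl⟩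
        · refine Eventually.frequently ?_
          filter_upwards [self_mem_nhdsWithin] with s (hs : t < s)
          rw [slope_def_field]
          refine lt_of_le_of_lt ?_ hr
          rw [div_le_iff₀ (sub_pos.2 hs)]
          refine (le_abs_self _).trans ((touch _ hz _).trans_eq ?_)
          rw [dist_add_left, dist_eq_norm, ← sub_smul, norm_smul, Real.norm_eq_abs,
            abs_of_pos (sub_pos.2 hs), mul_comm]
        · have hg : HasDerivAt (fun t : ℝ => w (x + t • d)) (inner ℝ l d) t := by
            simpa [Function.comp_def] using hl.hasFDerivAt.comp_hasDerivAt t (hline t)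
          refine hg.hasDerivWithinAt.liminf_right_slope_le (lt_of_le_of_lt ?_ hr)
          calc inner ℝ l d ≤ ‖l‖ * ‖d‖ := real_inner_le_norm l d
            _ ≤ 1 * ‖d‖ := by gcongr
            _ = ‖d‖ := one_mul _)
      (right_mem_Icc.2 zero_le_one)
    simp only [one_smul, one_mul, hd, add_sub_cancel] at this
    rwa [hdn]
  rw [abs_le]
  constructor
  · linarith [key x y]
  · linarith [key y x, dist_comm x y]

theorem exists_gradient_norm_eq_one_of_between {m M : Plane → ℝ}
    (hm : ∀ x y, |m x - m y| ≤ dist x y) (hM : ∀ x y, |M x - M y| ≤ dist x y)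
    (hmM : ∀ x, m x ≤ M x) :
    ∃ w : Plane → ℝ, (∀ x, m x ≤ w x) ∧ (∀ x, w x ≤ M x) ∧
      (∀ x, m x < M x → ∃ l : Plane, ‖l‖ ≤ 1 ∧ HasGradientAt w l x) ∧
      ∀ᵐ x ∂volume, m x < M x → ‖∇ w x‖ = 1 := by
  have cont : ∀ f : Plane → ℝ, (∀ x y, |f x - f y| ≤ dist x y) → Continuous f := fun f hf =>
    (LipschitzWith.of_dist_le' (K := 1) fun x y => by simpa [Real.dist_eq] using hf x y).continuous
  have hmc := cont m hm
  have hMc := cont M hM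
  set U : Set Plane := {x | m x < M x} with hUdef
  have hU : IsOpen U := isOpen_lt hmc hMc
  obtain ⟨v, hvc, hv⟩ := exists_strict_between hm hM
  obtain ⟨V, hV, hV1, hVv⟩ := exists_contDiffOn_strict_approx hU
    (δ := fun x => min (v x - m x) (M x - v x)) hvc (fun x hx => (hv x hx).2.2)
    (by fun_prop) (fun x hx => lt_min (sub_pos.2 (hv x hx).1) (sub_pos.2 (hv x hx).2.1))
  have hVm : ∀ x ∈ U, m x < V x ∧ V x < M x := by
    intro x hx
    have h1 := abs_lt.1 (hVv x hx)
    have h2 := min_le_left (v x - m x) (M x - v x)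
    have h3 := min_le_right (v x - m x) (M x - v x)
    constructor <;> linarith
  have hVc : ContinuousOn V U := hV.continuousOn
  obtain ⟨w, -, hwV, hwl, hw1⟩ := exists_eikonal_perturbation hU hV hV1
    (κ := fun x => min (V x - m x) (M x - V x)) (by fun_prop)
    (fun x hx => lt_min (sub_pos.2 (hVm x hx).1) (sub_pos.2 (hVm x hx).2))
  classical
  have heq : ∀ x ∈ U, U.piecewise w M =ᶠ[𝓝 x] w := fun x hx => by
    filter_upwards [hU.mem_nhds hx] with y hy using piecewise_eq_of_mem _ _ _ hy
  have hbd : ∀ x, m x ≤ U.piecewise w M x ∧ U.piecewise w M x ≤ M x := by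
    intro x
    by_cases hx : x ∈ U
    · rw [piecewise_eq_of_mem _ _ _ hx]
      have h1 := abs_le.1 (hwV x hx)
      have h2 := min_le_left (V x - m x) (M x - V x)
      have h3 := min_le_right (V x - m x) (M x - V x)
      constructor <;> linarith
    · rw [piecewise_eq_of_notMem _ _ _ hx]
      exact ⟨hmM x, le_rfl⟩
  refine ⟨U.piecewise w M, fun x => (hbd x).1, fun x => (hbd x).2, fun x hx => ?_, ?_⟩
  · obtain ⟨l, hl1, hl⟩ := hwl x hx
    exact ⟨l, hl1, hl.congr_of_eventuallyEq (heq x hx)⟩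
  · filter_upwards [(ae_restrict_iff' hU.measurableSet).1 hw1] with x hx hxU
    have : ∇ (U.piecewise w M) x = ∇ w x := by
      rw [gradient, gradient, (heq x hxU).fderiv_eq]
    rw [this]
    exact hx hxU

theorem exists_eikonal_extension {F : Set Plane} (hFc : IsClosed F) {f : Plane → ℝ}
    (hf : ∀ x ∈ F, ∀ y ∈ F, f x - f y ≤ dist x y) :
    ∃ w : Plane → ℝ, (∀ x y, |w x - w y| ≤ dist x y) ∧ (∀ x ∈ F, w x = f x) ∧
      (∀ x ∉ F, DifferentiableAt ℝ w x) ∧ ∀ᵐ x ∂volume, x ∉ F → ‖∇ w x‖ = 1 := by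
  rcases F.eq_empty_or_nonempty with rfl | hF
  · obtain ⟨e, he, -⟩ := exists_unit_inner_eq_zero 0
    have hg : ∀ x, HasGradientAt (fun x : Plane => inner ℝ e x) e x := fun x => by
      rw [hasGradientAt_iff_hasFDerivAt]
      exact (toDual ℝ Plane e).hasFDerivAt
    refine ⟨fun x => inner ℝ e x, fun x y => ?_, by simp, fun x _ => (hg x).differentiableAt,
      Eventually.of_forall fun x _ => by rw [(hg x).gradient, he]⟩
    rw [← inner_sub_right, dist_eq_norm]
    simpa [he] using abs_real_inner_le_norm e (x - y)
  have hf' : ∀ x ∈ F, ∀ y ∈ F, -f x - -f y ≤ dist x y := fun x hx y hy => by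
    linarith [hf y hy x hx, dist_comm x y]
  set M : Plane → ℝ := upperExt F f with hMdef
  set m : Plane → ℝ := fun x => -upperExt F (fun y => -f y) x with hmdef
  have hM : ∀ x y, |M x - M y| ≤ dist x y := fun x y => abs_le.2
    ⟨by linarith [upperExt_le_add hF hf y x, dist_comm x y],
      by linarith [upperExt_le_add hF hf x y]⟩
  have hm : ∀ x y, |m x - m y| ≤ dist x y := fun x y => abs_le.2
    ⟨by simp only [hmdef]; linarith [upperExt_le_add hF hf' x y],
      by simp only [hmdef]; linarith [upperExt_le_add hF hf' y x, dist_comm x y]⟩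
  have hmM : ∀ x, m x ≤ M x := neg_upperExt_neg_le hF hf
  obtain ⟨w, hmw, hwM, hwl, hw1⟩ := exists_gradient_norm_eq_one_of_between hm hM hmM
  have htouch : ∀ x ∉ F, m x = M x → ∃ e : Plane, ‖e‖ = 1 ∧ HasGradientAt w e x := by
    intro x hx hxe
    obtain ⟨e, C, he, hC⟩ := exists_upperExt_le_quadratic hFc hF hf hx
    obtain ⟨e', C', -, hC'⟩ := exists_upperExt_le_quadratic hFc hF hf' hx
    exact ⟨e, he, hasGradientAt_of_squeeze (m := m) hC
      (fun z => by simpa only [hmdef, neg_neg] using hC' z) hxe hmw hwM⟩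
  refine ⟨w, abs_sub_le_dist_of_squeeze hm hM hmw hwM fun x => ?_, fun x hx => ?_,
    fun x hx => ?_, ?_⟩
  · exact (hmM x).eq_or_lt.imp_right (hwl x)
  · refine le_antisymm ((hwM x).trans_eq (upperExt_eq hf hx)) (le_trans (le_of_eq ?_) (hmw x))
    simp only [hmdef, upperExt_eq hf' hx, neg_neg]
  · rcases (hmM x).eq_or_lt with h | h
    · exact (htouch x hx h).choose_spec.2.differentiableAt
    · exact (hwl x h).choose_spec.2.differentiableAt
  · filter_upwards [hw1] with x hx1 hx
    rcases (hmM x).eq_or_lt with h | h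
    · obtain ⟨e, he, hg⟩ := htouch x hx h
      rw [hg.gradient, he]
    · exact hx1 h

/-- Proposition: on an open subset of the euclidean plane, every 1-Lipschitz boundary datum
`u₀ : ∂Ω → ℝ` admits an almost classical solution of the Eikonal equation: a 1-Lipschitz
function `w` on `cl(Ω)`, differentiable on `Ω`, with `|∇w| = 1` a.e. on `Ω` and `w = u₀`
on `∂Ω`. -/
theorem stmt_18 (Ω : Set (EuclideanSpace ℝ (Fin 2))) (hΩ : IsOpen Ω)
    (u₀ : EuclideanSpace ℝ (Fin 2) → ℝ) (hu₀ : IsLipschitzWithOn 1 u₀ (frontier Ω)) :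
    ∃ w : EuclideanSpace ℝ (Fin 2) → ℝ,
      IsLipschitzWithOn 1 w (closure Ω) ∧
      (∀ x ∈ Ω, DifferentiableAt ℝ w x) ∧
      (∀ᵐ x ∂(volume.restrict Ω), ‖fderiv ℝ w x‖ = 1) ∧
      (∀ x ∈ frontier Ω, w x = u₀ x) := by
  have hdisj : ∀ x ∈ Ω, x ∉ frontier Ω := fun x hx hx' =>
    (hΩ.frontier_eq ▸ hx' : x ∈ closure Ω \ Ω).2 hx
  obtain ⟨w, hw, hwu, hwd, hw1⟩ := exists_eikonal_extension isClosed_frontier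
    (fun x hx y hy => by simpa using (le_abs_self _).trans (hu₀ x hx y hy))
  refine ⟨w, fun x _ y _ => by simpa using hw x y, fun x hx => hwd x (hdisj x hx), ?_, hwu⟩
  rw [ae_restrict_iff' hΩ.measurableSet]
  filter_upwards [hw1] with x hx1 hx
  simpa only [gradient, LinearIsometryEquiv.norm_map] using hx1 (hdisj x hx)
end
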